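/- arXiv:1405.1916 — 13 statements merged into one kernel-verified Lean document; each statement's English description precedes it below -/
import Mathlib

section
/- Let c ≥ 1 be an integer and λ₁, λ₂, μ, ν positive reals with λ = λ₁ + λ₂ satisfying λ < cν. For a real number a, define h : {0,1,…,c} × ℤ≥0 → ℝ by h(i,j) = λa − iνa + jμ(a−1) for 0 ≤ i ≤ c−2, h(c−1,j) = λ₁a − (c−1)νa + jμ(a−1) + λ₂, and h(c,j) = λ − cνa. Then for every real a with λ/(cν) < a < 1 the following hold: (1) h(i,j) < λ for every (i,j) ∈ {0,…,c} × ℤ≥0; and (2) there exist ε > 0 and an integer J ≥ 0 such that h(i,j) ≤ −ε whenever i = c or j > J; in particular h(i,j) ≤ −ε for all but finitely many states (i,j). -/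
/-- Foster–Lyapunov drift computation for the M/M/c retrial queue with one guard
channel: the drift function `h` with test function `φ(i,j) = a·i + j`. -/
theorem drift_bounds
    (c : ℕ) (hc : 1 ≤ c) (l1 l2 mu nu : ℝ)
    (hl1 : 0 < l1) (hl2 : 0 < l2) (hmu : 0 < mu) (hnu : 0 < nu)
    (hstab : l1 + l2 < (c : ℝ) * nu)
    (a : ℝ) (ha1 : (l1 + l2) / ((c : ℝ) * nu) < a) (ha2 : a < 1)
    (h : ℕ → ℕ → ℝ)
    (hmid : ∀ i j : ℕ, i + 2 ≤ c →
      h i j = (l1 + l2) * a - (i : ℝ) * nu * a + (j : ℝ) * mu * (a - 1))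
    (hcm1 : ∀ j : ℕ,
      h (c - 1) j = l1 * a - ((c : ℝ) - 1) * nu * a + (j : ℝ) * mu * (a - 1) + l2)
    (htop : ∀ j : ℕ, h c j = (l1 + l2) - (c : ℝ) * nu * a) :
    (∀ i j : ℕ, i ≤ c → h i j < l1 + l2) ∧
    (∃ ε : ℝ, 0 < ε ∧ ∃ J : ℕ, ∀ i j : ℕ, i ≤ c → (i = c ∨ J < j) → h i j ≤ -ε) := by
  have hcnu : 0 < (c : ℝ) * nu := by linarith
  have ha0 : 0 < a := lt_trans (div_pos (by linarith) hcnu) ha1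
  have hε : 0 < (c : ℝ) * nu * a - (l1 + l2) := by
    have := (div_lt_iff₀ hcnu).mp ha1
    linarith
  have hgap : 0 < mu * (1 - a) := mul_pos hmu (by linarith)
  have hbelow : ∀ i j : ℕ, i < c → h i j < l1 + l2 - (j : ℝ) * (mu * (1 - a)) := by
    intro i j hi
    rcases (by omega : i + 2 ≤ c ∨ i = c - 1) with hi' | rfl
    · rw [hmid i j hi']
      have h1 : 0 ≤ (i : ℝ) * nu * a := by positivity
      have h2 : (l1 + l2) * a < l1 + l2 := mul_lt_of_lt_one_right (by linarith) ha2
      linarith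
    · rw [hcm1 j]
      have hc' : (0 : ℝ) ≤ (c : ℝ) - 1 := by
        have : (1 : ℝ) ≤ c := by exact_mod_cast hc
        linarith
      have h1 : 0 ≤ ((c : ℝ) - 1) * nu * a := by positivity
      have h2 : l1 * a < l1 := mul_lt_of_lt_one_right hl1 ha2
      linarith
  refine ⟨fun i j hi => ?_, (c : ℝ) * nu * a - (l1 + l2), hε, ?_⟩
  · rcases hi.lt_or_eq with hi | rfl
    · have h1 : 0 ≤ (j : ℝ) * (mu * (1 - a)) := by positivity
      linarith [hbelow i j hi]
    · linarith [htop j]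
  · obtain ⟨J, hJ⟩ := exists_nat_gt ((c : ℝ) * nu * a / (mu * (1 - a)))
    rw [div_lt_iff₀ hgap] at hJ
    refine ⟨J, fun i j hi hij => ?_⟩
    rcases hi.lt_or_eq with hi | rfl
    · have hj : (J : ℝ) ≤ j := by exact_mod_cast (hij.resolve_left hi.ne).le
      have h1 := mul_le_mul_of_nonneg_right hj hgap.le
      linarith [hbelow i j hi]
    · linarith [htop j]
end

section
/- Let λ₁, λ₂, μ, ν be positive reals, λ = λ₁ + λ₂, and let (r_i^{(0,n)}, r_i^{(1,n)}) be a rate-matrix system with c = 2. Then for every integer n ≥ 1: r_0^{(0,n)} = λ₂ν / (nμ(λ+ν+nμ)), r_1^{(0,n)} = λ₂(λ+nμ) / (nμ(λ+ν+nμ)), r_0^{(1,n)} = λν / (nμ(λ+ν+nμ)), and r_1^{(1,n)} = λ(λ+nμ) / (nμ(λ+ν+nμ)). -/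
/-- A rate-matrix system for the level-dependent QBD process of the M/M/c retrial
queue with one guard channel: `r0 n i` is `r_i^{(0,n)}` (row `c-1` of `R^{(n)}`)
and `r1 n i` is `r_i^{(1,n)}` (row `c` of `R^{(n)}`).  Here `λ = l1 + l2`,
`b_i^{(n)} = -(λ + i·ν + n·μ)` for `i < c` and `b_c^{(n)} = -(λ + c·ν)`. -/
def IsRMS (c : ℕ) (l1 l2 mu nu : ℝ) (r0 r1 : ℕ → ℕ → ℝ) : Prop :=
  (∀ n i, 0 ≤ r0 n i) ∧ (∀ n i, 0 ≤ r1 n i) ∧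
  ∀ n : ℕ, 1 ≤ n →
    (-((l1 + l2) + (n : ℝ) * mu) * r0 n 0 + nu * r0 n 1 = 0) ∧
    (∀ i : ℕ, 1 ≤ i → i + 2 ≤ c →
      (l1 + l2) * r0 n (i - 1)
        - ((l1 + l2) + (i : ℝ) * nu + (n : ℝ) * mu) * r0 n i
        + ((i : ℝ) + 1) * nu * r0 n (i + 1)
        + ((n : ℝ) + 1) * mu *
            (r0 n (c - 1) * r0 (n + 1) (i - 1) + r0 n c * r1 (n + 1) (i - 1)) = 0) ∧
    ((l1 + l2) * r0 n (c - 2)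
        - ((l1 + l2) + ((c : ℝ) - 1) * nu + (n : ℝ) * mu) * r0 n (c - 1)
        + (c : ℝ) * nu * r0 n c
        + ((n : ℝ) + 1) * mu *
            (r0 n (c - 1) * r0 (n + 1) (c - 2) + r0 n c * r1 (n + 1) (c - 2)) = -l2) ∧
    (l1 * r0 n (c - 1) - ((l1 + l2) + (c : ℝ) * nu) * r0 n c
        + ((n : ℝ) + 1) * mu *
            (r0 n (c - 1) * r0 (n + 1) (c - 1) + r0 n c * r1 (n + 1) (c - 1)) = 0) ∧
    (-((l1 + l2) + (n : ℝ) * mu) * r1 n 0 + nu * r1 n 1 = 0) ∧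
    (∀ i : ℕ, 1 ≤ i → i + 1 ≤ c →
      (l1 + l2) * r1 n (i - 1)
        - ((l1 + l2) + (i : ℝ) * nu + (n : ℝ) * mu) * r1 n i
        + ((i : ℝ) + 1) * nu * r1 n (i + 1)
        + ((n : ℝ) + 1) * mu *
            (r1 n (c - 1) * r0 (n + 1) (i - 1) + r1 n c * r1 (n + 1) (i - 1)) = 0) ∧
    (l1 * r1 n (c - 1) - ((l1 + l2) + (c : ℝ) * nu) * r1 n c
        + ((n : ℝ) + 1) * mu *
            (r1 n (c - 1) * r0 (n + 1) (c - 1) + r1 n c * r1 (n + 1) (c - 1)) = -(l1 + l2)) ∧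
    (∑ i ∈ Finset.range c, r0 n i = l2 / ((n : ℝ) * mu)) ∧
    (∑ i ∈ Finset.range c, r1 n i = (l1 + l2) / ((n : ℝ) * mu))

/-- A linear system `a * x = nu * y`, `x + y = s / t` solved for `x` and `y`. -/
lemma eq_div_of_balance_of_sum {a nu s t x y : ℝ} (ht : t ≠ 0) (ha : a + nu ≠ 0)
    (hbal : -a * x + nu * y = 0) (hsum : x + y = s / t) :
    x = s * nu / (t * (a + nu)) ∧ y = s * a / (t * (a + nu)) := by
  rw [eq_div_iff ht] at hsum
  constructor <;> rw [eq_div_iff (mul_ne_zero ht ha)]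
  · linear_combination nu * hsum - t * hbal
  · linear_combination a * hsum + t * hbal

/-- Explicit expressions for `r_0^{(0,n)}, r_1^{(0,n)}, r_0^{(1,n)}, r_1^{(1,n)}`
for a rate-matrix system with `c = 2`. -/
theorem rate_matrix_c2_first_entries
    (l1 l2 mu nu : ℝ) (hl1 : 0 < l1) (hl2 : 0 < l2) (hmu : 0 < mu) (hnu : 0 < nu)
    (r0 r1 : ℕ → ℕ → ℝ) (hr : IsRMS 2 l1 l2 mu nu r0 r1) :
    ∀ n : ℕ, 1 ≤ n →
      r0 n 0 = l2 * nu / ((n : ℝ) * mu * ((l1 + l2) + nu + (n : ℝ) * mu)) ∧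
      r0 n 1 = l2 * ((l1 + l2) + (n : ℝ) * mu) /
        ((n : ℝ) * mu * ((l1 + l2) + nu + (n : ℝ) * mu)) ∧
      r1 n 0 = (l1 + l2) * nu / ((n : ℝ) * mu * ((l1 + l2) + nu + (n : ℝ) * mu)) ∧
      r1 n 1 = (l1 + l2) * ((l1 + l2) + (n : ℝ) * mu) /
        ((n : ℝ) * mu * ((l1 + l2) + nu + (n : ℝ) * mu)) := by
  intro n hn
  have hnpos : (0 : ℝ) < n := by exact_mod_cast hn
  obtain ⟨h0, -, -, -, h1, -, -, hs0, hs1⟩ := hr.2.2 n hn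
  simp only [Finset.sum_range_succ, Finset.sum_range_zero, zero_add] at hs0 hs1
  have ht : (n : ℝ) * mu ≠ 0 := by positivity
  have ha : (l1 + l2) + (n : ℝ) * mu + nu ≠ 0 := by positivity
  obtain ⟨hx0, hy0⟩ := eq_div_of_balance_of_sum ht ha h0 hs0
  obtain ⟨hx1, hy1⟩ := eq_div_of_balance_of_sum ht ha h1 hs1
  rw [add_right_comm (l1 + l2) nu]
  exact ⟨hx0, hy0, hx1, hy1⟩
end

section
/- Let λ₁, λ₂, μ, ν be positive reals, λ = λ₁ + λ₂, and let (r_i^{(0,n)}, r_i^{(1,n)}) be a rate-matrix system with c = 2. Then for every integer n ≥ 1: r_2^{(1,n)} = (λ/ν)·[ (λ+ν+(n+1)μ)/(3λ+2ν+2(n+1)μ) + (λ+nμ)·(λ(λ+(n+1)μ) + λ₁ν) / ( nμ(λ+ν+nμ)(3λ+2ν+2(n+1)μ) ) ]. -/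
/-- Two unknowns determined by their sum and the ratio given by a balance equation. -/
lemma eq_div_of_balance_of_add_eq {a nu x y S : ℝ} (h : a + nu ≠ 0)
    (hb : -a * x + nu * y = 0) (hs : x + y = S) :
    x = nu * S / (a + nu) ∧ y = a * S / (a + nu) := by
  subst hs
  constructor <;> rw [eq_div_iff h] <;> linarith

/-- Explicit expression for `r_2^{(1,n)}` for a rate-matrix system with `c = 2`. -/
theorem rate_matrix_c2_r2_of_row1
    (l1 l2 mu nu : ℝ) (hl1 : 0 < l1) (hl2 : 0 < l2) (hmu : 0 < mu) (hnu : 0 < nu)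
    (r0 r1 : ℕ → ℕ → ℝ) (hr : IsRMS 2 l1 l2 mu nu r0 r1) :
    ∀ n : ℕ, 1 ≤ n →
      r1 n 2 = ((l1 + l2) / nu) *
        (((l1 + l2) + nu + ((n : ℝ) + 1) * mu) /
            (3 * (l1 + l2) + 2 * nu + 2 * ((n : ℝ) + 1) * mu)
          + ((l1 + l2) + (n : ℝ) * mu) *
              ((l1 + l2) * ((l1 + l2) + ((n : ℝ) + 1) * mu) + l1 * nu) /
            ((n : ℝ) * mu * ((l1 + l2) + nu + (n : ℝ) * mu) *
              (3 * (l1 + l2) + 2 * nu + 2 * ((n : ℝ) + 1) * mu))) := by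
  intro n hn
  obtain ⟨-, -, hr⟩ := hr
  obtain ⟨-, -, -, -, hbal, hmid, -, -, hsum⟩ := hr n hn
  obtain ⟨hbal0, -, -, -, hbal1, -, -, hsum0, hsum1⟩ := hr (n + 1) (by omega)
  have hmid := hmid 1 le_rfl le_rfl
  simp only [Finset.sum_range_succ, Finset.sum_range_zero, zero_add] at hsum hsum0 hsum1
  push_cast at hbal0 hbal1 hsum0 hsum1
  have hn' : (0 : ℝ) < n := by exact_mod_cast hn
  have hD : (l1 + l2) + n * mu + nu ≠ 0 := by positivity
  have hD' : (l1 + l2) + (n + 1) * mu + nu ≠ 0 := by positivity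
  obtain ⟨h0, h1⟩ := eq_div_of_balance_of_add_eq hD hbal hsum
  have h00 := (eq_div_of_balance_of_add_eq hD' hbal0 hsum0).1
  have h10 := (eq_div_of_balance_of_add_eq hD' hbal1 hsum1).1
  norm_num at hmid
  rw [h0, h1, h00, h10] at hmid
  have hE : (l1 + l2) + nu + n * mu ≠ 0 := by positivity
  have hF : 3 * (l1 + l2) + 2 * nu + 2 * (n + 1) * mu ≠ 0 := by positivity
  have hn1 : (n : ℝ) + 1 ≠ 0 := by positivity
  have hn0 := hn'.ne'
  field_simp at hmid ⊢
  linear_combination hmid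
end

section
/- Let (r_i^{(0,n)}, r_i^{(1,n)}) be a rate-matrix system with parameters c, λ₁, λ₂, μ, ν and λ = λ₁ + λ₂. Then for every n ≥ 1: (1) 0 ≤ r_i^{(0,n)} ≤ λ₂/(nμ) and 0 ≤ r_i^{(1,n)} ≤ λ/(nμ) for every 0 ≤ i ≤ c−1; and (2) cν·r_c^{(0,n)} ≤ λ·r_{c−1}^{(0,n)} and cν·r_c^{(1,n)} ≤ λ·r_{c−1}^{(1,n)} + λ. -/
/-- Elementary bounds on the entries of the rate matrices: each of the first `c`
entries of the two nonzero rows is between `0` and the corresponding row sum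
`λ₂/(nμ)` resp. `λ/(nμ)`, and the last entries satisfy
`cν·r_c^{(0,n)} ≤ λ·r_{c−1}^{(0,n)}` and `cν·r_c^{(1,n)} ≤ λ·r_{c−1}^{(1,n)} + λ`. -/
theorem rate_matrix_entry_bounds
    (c : ℕ) (hc : 2 ≤ c)
    (l1 l2 mu nu : ℝ) (hl1 : 0 < l1) (hl2 : 0 < l2) (hmu : 0 < mu) (hnu : 0 < nu)
    (r0 r1 : ℕ → ℕ → ℝ) (hr : IsRMS c l1 l2 mu nu r0 r1) :
    ∀ n : ℕ, 1 ≤ n →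
      (∀ i : ℕ, i + 1 ≤ c →
        0 ≤ r0 n i ∧ r0 n i ≤ l2 / ((n : ℝ) * mu) ∧
        0 ≤ r1 n i ∧ r1 n i ≤ (l1 + l2) / ((n : ℝ) * mu)) ∧
      (c : ℝ) * nu * r0 n c ≤ (l1 + l2) * r0 n (c - 1) ∧
      (c : ℝ) * nu * r1 n c ≤ (l1 + l2) * r1 n (c - 1) + (l1 + l2) := by
  have key : ∀ n : ℕ, 1 ≤ n → ∀ i : ℕ, i + 1 ≤ c →
      r0 n i ≤ l2 / ((n : ℝ) * mu) ∧ r1 n i ≤ (l1 + l2) / ((n : ℝ) * mu) := by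
    intro n hn i hi
    obtain ⟨h0, h1, h⟩ := hr
    obtain ⟨-, -, -, -, -, -, -, hs0, hs1⟩ := h n hn
    have hmem : i ∈ Finset.range c := Finset.mem_range.2 hi
    rw [← hs0, ← hs1]
    exact ⟨Finset.single_le_sum (fun j _ => h0 n j) hmem,
      Finset.single_le_sum (fun j _ => h1 n j) hmem⟩
  intro n hn
  obtain ⟨h0, h1, h⟩ := hr
  refine ⟨fun i hi => ⟨h0 n i, (key n hn i hi).1, h1 n i, (key n hn i hi).2⟩, ?_⟩
  obtain ⟨-, -, -, hc0, -, -, hc1, -, -⟩ := h n hn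
  obtain ⟨k0, k1⟩ := key (n + 1) (by omega) (c - 1) (by omega)
  have hpos : 0 < ((n + 1 : ℕ) : ℝ) * mu := by positivity
  rw [le_div_iff₀ hpos] at k0 k1
  push_cast at k0 k1
  constructor
  · linarith [mul_le_mul_of_nonneg_left k0 (h0 n (c - 1)),
      mul_le_mul_of_nonneg_left k1 (h0 n c)]
  · linarith [mul_le_mul_of_nonneg_left k0 (h1 n (c - 1)),
      mul_le_mul_of_nonneg_left k1 (h1 n c)]
end

section
/- Let (r_i^{(0,n)}, r_i^{(1,n)}) be a rate-matrix system with parameters c, λ₁, λ₂, μ, ν and λ = λ₁ + λ₂. Then for every k = 0, 1, …, c, lim_{n→∞} n^k · r_{c−k}^{(0,n)} = θ_0^{(0,k)}; equivalently, r_{c−k}^{(0,n)} = θ_0^{(0,k)}/n^k + o(1/n^k) as n → ∞. -/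
/-- The leading Taylor coefficients of the row `r^{(0,n)}`:
`θ_0^{(0,0)} = 0`, `θ_0^{(0,1)} = λ₂/μ`, and
`θ_0^{(0,k)} = (λ₂/μ)·∏_{i=1}^{k−1} ((c−i)ν/μ)` for `k ≥ 2`. -/
noncomputable def theta0Row0 (c : ℕ) (l1 l2 mu nu : ℝ) : ℕ → ℝ :=
  fun k =>
    if k = 0 then 0
    else (l2 / mu) * ∏ i ∈ Finset.Icc 1 (k - 1), (((c : ℝ) - (i : ℝ)) * nu / mu)

open Filter Asymptotics in
/-- `f n = O(n⁻ᵏ)` as `n → ∞`. -/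
def DecaysAtOrder (k : ℕ) (f : ℕ → ℝ) : Prop :=
  f =O[atTop] fun n : ℕ => ((n : ℝ) ^ k)⁻¹

namespace DecaysAtOrder

open Filter Asymptotics Topology

variable {j k : ℕ} {f g : ℕ → ℝ}

theorem of_nonneg_of_le (C : ℝ) (hf : ∀ n, 0 ≤ f n)
    (h : ∀ n : ℕ, 1 ≤ n → f n ≤ C * ((n : ℝ) ^ k)⁻¹) : DecaysAtOrder k f := by
  refine IsBigO.of_bound C ?_
  filter_upwards [eventually_ge_atTop 1] with n hn
  rw [Real.norm_of_nonneg (hf n), Real.norm_of_nonneg (by positivity)]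
  exact h n hn

theorem mono (hjk : j ≤ k) (hf : DecaysAtOrder k f) : DecaysAtOrder j f := by
  refine IsBigO.trans hf (IsBigO.of_bound 1 ?_)
  filter_upwards [eventually_ge_atTop 1] with n hn
  have hn' : (1 : ℝ) ≤ n := by exact_mod_cast hn
  rw [Real.norm_of_nonneg (by positivity), Real.norm_of_nonneg (by positivity), one_mul]
  gcongr

theorem add (hf : DecaysAtOrder k f) (hg : DecaysAtOrder k g) :
    DecaysAtOrder k fun n => f n + g n :=
  IsBigO.add hf hg

theorem const_mul (a : ℝ) (hf : DecaysAtOrder k f) : DecaysAtOrder k fun n => a * f n :=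
  IsBigO.const_mul_left hf a

theorem mul (hf : DecaysAtOrder j f) (hg : DecaysAtOrder k g) :
    DecaysAtOrder (j + k) fun n => f n * g n := by
  have h := IsBigO.mul hf hg
  simpa only [DecaysAtOrder, pow_add, mul_inv] using h

theorem shift (hf : DecaysAtOrder k f) : DecaysAtOrder k fun n => f (n + 1) := by
  refine (IsBigO.comp_tendsto hf (tendsto_add_atTop_nat 1)).trans (IsBigO.of_bound 1 ?_)
  filter_upwards [eventually_ge_atTop 1] with n hn
  have hn' : (1 : ℝ) ≤ n := by exact_mod_cast hn
  simp only [Function.comp_apply]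
  rw [Real.norm_of_nonneg (by positivity), Real.norm_of_nonneg (by positivity), one_mul]
  gcongr
  simp

theorem succ_mul (hf : DecaysAtOrder (k + 1) f) (a : ℝ) :
    DecaysAtOrder k fun n => ((n : ℝ) + 1) * a * f n := by
  have h1 : (fun n : ℕ => ((n : ℝ) + 1) * a) =O[atTop] fun n : ℕ => (n : ℝ) := by
    refine IsBigO.of_bound (2 * |a|) ?_
    filter_upwards [eventually_ge_atTop 1] with n hn
    have hn' : (1 : ℝ) ≤ n := by exact_mod_cast hn
    rw [norm_mul, Real.norm_of_nonneg (by positivity : (0 : ℝ) ≤ n + 1),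
      Real.norm_of_nonneg (by positivity : (0 : ℝ) ≤ n), Real.norm_eq_abs]
    nlinarith [abs_nonneg a]
  refine (h1.mul hf).trans_eventuallyEq ?_
  filter_upwards [eventually_ge_atTop 1] with n hn
  have hn' : (n : ℝ) ≠ 0 := by positivity
  rw [pow_succ]
  field_simp

theorem succ_of_linear_mul_eq {a b : ℝ} (ha : 0 ≤ a) (hb : 0 < b)
    (hg : DecaysAtOrder k g) (h : ∀ n : ℕ, 1 ≤ n → (a + n * b) * f n = g n) :
    DecaysAtOrder (k + 1) f := by
  have h1 : f =O[atTop] fun n : ℕ => (n : ℝ)⁻¹ * g n := by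
    refine IsBigO.of_bound b⁻¹ ?_
    filter_upwards [eventually_ge_atTop 1] with n hn
    have hn' : (0 : ℝ) < n := by positivity
    rw [← h n hn, norm_mul, norm_mul,
      Real.norm_of_nonneg (by positivity : 0 ≤ (n : ℝ)⁻¹),
      Real.norm_of_nonneg (by positivity : 0 ≤ a + n * b)]
    have h2 : 1 ≤ b⁻¹ * ((n : ℝ)⁻¹ * (a + n * b)) := by
      field_simp
      linarith
    nlinarith [norm_nonneg (f n)]
  refine h1.trans ?_
  have h2 := (isBigO_refl (fun n : ℕ => (n : ℝ)⁻¹) atTop).mul hg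
  simpa only [pow_succ', mul_inv] using h2

theorem tendsto_pow_mul (hf : DecaysAtOrder (k + 1) f) :
    Tendsto (fun n : ℕ => (n : ℝ) ^ k * f n) atTop (𝓝 0) := by
  have h := (isBigO_refl (fun n : ℕ => (n : ℝ) ^ k) atTop).mul hf
  have h' : (fun n : ℕ => (n : ℝ) ^ k * f n) =O[atTop] fun n : ℕ => (n : ℝ)⁻¹ := by
    refine h.trans_eventuallyEq ?_
    filter_upwards [eventually_ge_atTop 1] with n hn
    have hn' : (n : ℝ) ≠ 0 := by positivity
    rw [pow_succ]
    field_simp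
  exact h'.trans_tendsto tendsto_inv_atTop_nhds_zero_nat

end DecaysAtOrder

open Filter Topology in
/-- If `(a + n b) fₙ = gₙ` and `nᵏ gₙ → L`, then `nᵏ⁺¹ fₙ → L / b`. -/
theorem tendsto_pow_succ_mul_of_linear_mul_eq {k : ℕ} {f g : ℕ → ℝ} {a b L : ℝ}
    (ha : 0 ≤ a) (hb : 0 < b) (h : ∀ n : ℕ, 1 ≤ n → (a + n * b) * f n = g n)
    (hg : Tendsto (fun n : ℕ => (n : ℝ) ^ k * g n) atTop (𝓝 L)) :
    Tendsto (fun n : ℕ => (n : ℝ) ^ (k + 1) * f n) atTop (𝓝 (L / b)) := by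
  have h1 : Tendsto (fun n : ℕ => a * (n : ℝ)⁻¹ + b) atTop (𝓝 (a * 0 + b)) :=
    (tendsto_inv_atTop_nhds_zero_nat.const_mul a).add_const b
  rw [mul_zero, zero_add] at h1
  refine (hg.div h1 hb.ne').congr' ?_
  filter_upwards [eventually_ge_atTop 1] with n hn
  have hn' : (0 : ℝ) < n := by positivity
  have h2 : a + n * b ≠ 0 := by positivity
  simp only [Pi.div_apply]
  rw [← h n hn, pow_succ]
  field_simp

namespace IsRMS

open Filter Topology

variable {c : ℕ} {l1 l2 mu nu : ℝ} {r0 r1 : ℕ → ℕ → ℝ}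

theorem row0_le (hr : IsRMS c l1 l2 mu nu r0 r1) {n i : ℕ} (hn : 1 ≤ n) (hi : i < c) :
    r0 n i ≤ l2 / (n * mu) := by
  obtain ⟨h0, -, h⟩ := hr
  obtain ⟨-, -, -, -, -, -, -, hs, -⟩ := h n hn
  rw [← hs]
  exact Finset.single_le_sum (fun j _ => h0 n j) (Finset.mem_range.2 hi)

theorem row1_le (hr : IsRMS c l1 l2 mu nu r0 r1) {n i : ℕ} (hn : 1 ≤ n) (hi : i < c) :
    r1 n i ≤ (l1 + l2) / (n * mu) := by
  obtain ⟨-, h1, h⟩ := hr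
  obtain ⟨-, -, -, -, -, -, -, -, hs⟩ := h n hn
  rw [← hs]
  exact Finset.single_le_sum (fun j _ => h1 n j) (Finset.mem_range.2 hi)

theorem decays_row0_one (hr : IsRMS c l1 l2 mu nu r0 r1) {i : ℕ} (hi : i < c) :
    DecaysAtOrder 1 fun n => r0 n i := by
  refine DecaysAtOrder.of_nonneg_of_le (l2 / mu) (fun n => hr.1 n i) fun n hn => ?_
  refine (hr.row0_le hn hi).trans_eq ?_
  rw [pow_one, div_mul_eq_div_div_swap, div_eq_mul_inv (l2 / mu)]

theorem decays_row1_one (hr : IsRMS c l1 l2 mu nu r0 r1) {i : ℕ} (hi : i < c) :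
    DecaysAtOrder 1 fun n => r1 n i := by
  refine DecaysAtOrder.of_nonneg_of_le ((l1 + l2) / mu) (fun n => hr.2.1 n i) fun n hn => ?_
  refine (hr.row1_le hn hi).trans_eq ?_
  rw [pow_one, div_mul_eq_div_div_swap, div_eq_mul_inv ((l1 + l2) / mu)]

theorem succ_mul_row0_le (hr : IsRMS c l1 l2 mu nu r0 r1) (hmu : 0 < mu) {i : ℕ} (n : ℕ)
    (hi : i < c) : ((n : ℝ) + 1) * mu * r0 (n + 1) i ≤ l2 := by
  have h := hr.row0_le (n := n + 1) (by omega) hi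
  rw [le_div_iff₀ (by positivity)] at h
  push_cast at h
  linarith

theorem succ_mul_row1_le (hr : IsRMS c l1 l2 mu nu r0 r1) (hmu : 0 < mu) {i : ℕ} (n : ℕ)
    (hi : i < c) : ((n : ℝ) + 1) * mu * r1 (n + 1) i ≤ l1 + l2 := by
  have h := hr.row1_le (n := n + 1) (by omega) hi
  rw [le_div_iff₀ (by positivity)] at h
  push_cast at h
  linarith

theorem row0_last_le (hr : IsRMS c l1 l2 mu nu r0 r1) (hc : 2 ≤ c) (hmu : 0 < mu)
    {n : ℕ} (hn : 1 ≤ n) : c * nu * r0 n c ≤ (l1 + l2) * r0 n (c - 1) := by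
  obtain ⟨-, -, -, h, -⟩ := hr.2.2 n hn
  have h0 := mul_le_mul_of_nonneg_left (hr.succ_mul_row0_le hmu n (i := c - 1) (by omega))
    (hr.1 n (c - 1))
  have h1 := mul_le_mul_of_nonneg_left (hr.succ_mul_row1_le hmu n (i := c - 1) (by omega))
    (hr.1 n c)
  linarith

theorem row1_last_le (hr : IsRMS c l1 l2 mu nu r0 r1) (hc : 2 ≤ c) (hmu : 0 < mu)
    {n : ℕ} (hn : 1 ≤ n) : c * nu * r1 n c ≤ (l1 + l2) + (l1 + l2) * r1 n (c - 1) := by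
  obtain ⟨-, -, -, -, -, -, h, -⟩ := hr.2.2 n hn
  have h0 := mul_le_mul_of_nonneg_left (hr.succ_mul_row0_le hmu n (i := c - 1) (by omega))
    (hr.2.1 n (c - 1))
  have h1 := mul_le_mul_of_nonneg_left (hr.succ_mul_row1_le hmu n (i := c - 1) (by omega))
    (hr.2.1 n c)
  linarith

theorem decays_row0_last (hr : IsRMS c l1 l2 mu nu r0 r1) (hc : 2 ≤ c) (hl : 0 < l1 + l2)
    (hmu : 0 < mu) (hnu : 0 < nu) : DecaysAtOrder 1 fun n => r0 n c := by
  have hc' : (0 : ℝ) < c * nu := by positivity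
  refine DecaysAtOrder.of_nonneg_of_le ((l1 + l2) * (l2 / mu) / (c * nu))
    (fun n => hr.1 n c) fun n hn => ?_
  have h := (hr.row0_last_le hc hmu hn).trans
    (mul_le_mul_of_nonneg_left (hr.row0_le hn (i := c - 1) (by omega)) hl.le)
  rw [mul_comm, ← le_div_iff₀ hc'] at h
  refine h.trans_eq ?_
  have hn' : (0 : ℝ) < n := by positivity
  field_simp

theorem decays_row1_last (hr : IsRMS c l1 l2 mu nu r0 r1) (hc : 2 ≤ c) (hl : 0 < l1 + l2)
    (hmu : 0 < mu) (hnu : 0 < nu) : DecaysAtOrder 0 fun n => r1 n c := by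
  have hc' : (0 : ℝ) < c * nu := by positivity
  refine DecaysAtOrder.of_nonneg_of_le (((l1 + l2) + (l1 + l2) * ((l1 + l2) / mu)) / (c * nu))
    (fun n => hr.2.1 n c) fun n hn => ?_
  have hn' : (1 : ℝ) ≤ n := by exact_mod_cast hn
  have h2 : (l1 + l2) / (n * mu) ≤ (l1 + l2) / mu := by
    gcongr
    nlinarith
  have h3 := mul_le_mul_of_nonneg_left
    ((hr.row1_le hn (i := c - 1) (by omega)).trans h2) hl.le
  rw [pow_zero, inv_one, mul_one, le_div_iff₀ hc']
  linarith [hr.row1_last_le hc hmu hn]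

/-- Entries of both rows at distance at least `k` from the last column are `O(n⁻ᵏ)`. -/
theorem decays (hr : IsRMS c l1 l2 mu nu r0 r1) (hc : 2 ≤ c) (hl : 0 < l1 + l2)
    (hmu : 0 < mu) (hnu : 0 < nu) {k : ℕ} (hk : 1 ≤ k) :
    ∀ i, i + k ≤ c →
      (DecaysAtOrder k fun n => r0 n i) ∧ DecaysAtOrder k fun n => r1 n i := by
  have hd0 := hr.decays_row0_one (i := c - 1) (by omega)
  have hd1 := hr.decays_row1_one (i := c - 1) (by omega)
  have hl0 := hr.decays_row0_last hc hl hmu hnu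
  have hl1 := hr.decays_row1_last hc hl hmu hnu
  induction k, hk using Nat.le_induction with
  | base => exact fun i hi => ⟨hr.decays_row0_one (by omega), hr.decays_row1_one (by omega)⟩
  | succ k hk ih =>
    intro i
    induction i with
    | zero =>
      intro hi
      obtain ⟨ih0, ih1⟩ := ih 1 (by omega)
      refine ⟨DecaysAtOrder.succ_of_linear_mul_eq hl.le hmu (ih0.const_mul nu) fun n hn => ?_,
        DecaysAtOrder.succ_of_linear_mul_eq hl.le hmu (ih1.const_mul nu) fun n hn => ?_⟩
      · obtain ⟨h, -⟩ := hr.2.2 n hn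
        linarith
      · obtain ⟨-, -, -, -, h, -⟩ := hr.2.2 n hn
        linarith
    | succ i ihi =>
      intro hi
      obtain ⟨hi0, hi1⟩ := ihi (by omega)
      obtain ⟨ih0, ih1⟩ := ih (i + 2) (by omega)
      have ha : 0 ≤ l1 + l2 + ((i + 1 : ℕ) : ℝ) * nu := by positivity
      constructor
      · have hp := ((hd0.mul hi0.shift).add (hl0.mul hi1.shift)).mono
          (show k + 1 ≤ 1 + (k + 1) by omega)
        refine DecaysAtOrder.succ_of_linear_mul_eq ha hmu
          ((((hi0.mono (Nat.le_succ k)).const_mul (l1 + l2)).add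
            (ih0.const_mul ((((i + 1 : ℕ) : ℝ) + 1) * nu))).add (hp.succ_mul mu))
          fun n hn => ?_
        obtain ⟨-, h, -⟩ := hr.2.2 n hn
        have h := h (i + 1) (by omega) (by omega)
        rw [Nat.add_sub_cancel] at h
        linarith
      · have hp := ((hd1.mul hi0.shift).mono (show k + 1 ≤ 1 + (k + 1) by omega)).add
          ((hl1.mul hi1.shift).mono (show k + 1 ≤ 0 + (k + 1) by omega))
        refine DecaysAtOrder.succ_of_linear_mul_eq ha hmu
          ((((hi1.mono (Nat.le_succ k)).const_mul (l1 + l2)).add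
            (ih1.const_mul ((((i + 1 : ℕ) : ℝ) + 1) * nu))).add (hp.succ_mul mu))
          fun n hn => ?_
        obtain ⟨-, -, -, -, -, h, -⟩ := hr.2.2 n hn
        have h := h (i + 1) (by omega) (by omega)
        rw [Nat.add_sub_cancel] at h
        linarith

theorem tendsto_mul_row0_pred_last (hr : IsRMS c l1 l2 mu nu r0 r1) (hc : 2 ≤ c)
    (hl : 0 < l1 + l2) (hmu : 0 < mu) (hnu : 0 < nu) :
    Tendsto (fun n : ℕ => (n : ℝ) ^ 1 * r0 n (c - 1)) atTop (𝓝 (l2 / mu)) := by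
  have hs : Tendsto (fun n : ℕ => ∑ i ∈ Finset.range (c - 1), (n : ℝ) ^ 1 * r0 n i)
      atTop (𝓝 (∑ i ∈ Finset.range (c - 1), (0 : ℝ))) := by
    refine tendsto_finsetSum _ fun i hi => DecaysAtOrder.tendsto_pow_mul ?_
    rw [Finset.mem_range] at hi
    exact (hr.decays hc hl hmu hnu (k := 2) (by omega) i (by omega)).1
  have h := hs.const_sub (l2 / mu)
  rw [Finset.sum_const_zero, sub_zero] at h
  refine h.congr' ?_
  filter_upwards [eventually_ge_atTop 1] with n hn
  have hn' : (0 : ℝ) < n := by positivity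
  obtain ⟨-, -, -, -, -, -, -, hsum, -⟩ := hr.2.2 n hn
  rw [show c = c - 1 + 1 by omega, Finset.sum_range_succ] at hsum
  rw [← Finset.mul_sum, eq_sub_of_add_eq hsum]
  field_simp
  ring

/-- The balance equations carry the leading coefficient from one column to the previous one. -/
theorem tendsto_pow_succ_mul_row0 (hr : IsRMS c l1 l2 mu nu r0 r1) (hc : 2 ≤ c)
    (hl : 0 < l1 + l2) (hmu : 0 < mu) (hnu : 0 < nu) {i k : ℕ} {L : ℝ} (hk : 1 ≤ k)
    (hi : i + 1 + k = c)
    (h : Tendsto (fun n : ℕ => (n : ℝ) ^ k * r0 n (i + 1)) atTop (𝓝 L)) :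
    Tendsto (fun n : ℕ => (n : ℝ) ^ (k + 1) * r0 n i) atTop
      (𝓝 (((i : ℝ) + 1) * nu * L / mu)) := by
  cases i with
  | zero =>
    refine tendsto_pow_succ_mul_of_linear_mul_eq hl.le hmu
      (g := fun n => nu * r0 n 1) (fun n hn => ?_) ?_
    · obtain ⟨h, -⟩ := hr.2.2 n hn
      linarith
    · convert h.const_mul nu using 2
      · ring
      · simp
  | succ i =>
    have hd0 := hr.decays_row0_one (i := c - 1) (by omega)
    have hl0 := hr.decays_row0_last hc hl hmu hnu
    obtain ⟨hi0, hi1⟩ := hr.decays hc hl hmu hnu (k := k + 2) (by omega) i (by omega)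
    have hp := (((hd0.mul hi0.shift).add (hl0.mul hi1.shift)).mono
      (show k + 2 ≤ 1 + (k + 2) by omega)).succ_mul mu
    have hrest :=
      (((hi0.mono (Nat.le_succ (k + 1))).const_mul (l1 + l2)).add hp).tendsto_pow_mul
    have ha : 0 ≤ l1 + l2 + ((i + 1 : ℕ) : ℝ) * nu := by positivity
    refine tendsto_pow_succ_mul_of_linear_mul_eq ha hmu
      (g := fun n => (((i + 1 : ℕ) : ℝ) + 1) * nu * r0 n (i + 1 + 1) +
        ((l1 + l2) * r0 n i + ((n : ℝ) + 1) * mu *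
          (r0 n (c - 1) * r0 (n + 1) i + r0 n c * r1 (n + 1) i))) (fun n hn => ?_) ?_
    · obtain ⟨-, h, -⟩ := hr.2.2 n hn
      have h := h (i + 1) (by omega) (by omega)
      rw [Nat.add_sub_cancel] at h
      linarith
    · have hsum := (h.const_mul ((((i + 1 : ℕ) : ℝ) + 1) * nu)).add hrest
      rw [add_zero] at hsum
      refine hsum.congr fun n => ?_
      ring

end IsRMS

theorem theta0Row0_succ (c : ℕ) (l1 l2 mu nu : ℝ) {k : ℕ} (hk : 1 ≤ k) :
    theta0Row0 c l1 l2 mu nu (k + 1) =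
      ((c : ℝ) - k) * nu * theta0Row0 c l1 l2 mu nu k / mu := by
  obtain ⟨m, rfl⟩ : ∃ m, k = m + 1 := ⟨k - 1, by omega⟩
  simp only [theta0Row0, Nat.add_sub_cancel, Nat.add_eq_zero_iff, one_ne_zero, and_false,
    if_false]
  rw [Finset.prod_Icc_succ_top (by omega)]
  ring

/-- One-term Taylor expansion (Lemma 3.1, row 0):
`lim_{n→∞} n^k · r_{c−k}^{(0,n)} = θ_0^{(0,k)}` for every `0 ≤ k ≤ c`. -/
theorem rate_matrix_one_term_expansion_row0
    (c : ℕ) (hc : 2 ≤ c)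
    (l1 l2 mu nu : ℝ) (hl1 : 0 < l1) (hl2 : 0 < l2) (hmu : 0 < mu) (hnu : 0 < nu)
    (r0 r1 : ℕ → ℕ → ℝ) (hr : IsRMS c l1 l2 mu nu r0 r1) :
    ∀ k : ℕ, k ≤ c →
      Filter.Tendsto (fun n : ℕ => (n : ℝ) ^ k * r0 n (c - k))
        Filter.atTop (nhds (theta0Row0 c l1 l2 mu nu k)) := by
  have hl : 0 < l1 + l2 := add_pos hl1 hl2
  intro k hkc
  rcases Nat.eq_zero_or_pos k with rfl | hk
  · simpa [theta0Row0] using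
      DecaysAtOrder.tendsto_pow_mul (k := 0) (hr.decays_row0_last hc hl hmu hnu)
  induction k, hk using Nat.le_induction with
  | base => simpa [theta0Row0] using hr.tendsto_mul_row0_pred_last hc hl hmu hnu
  | succ k hk ih =>
    have ih := ih (by omega)
    rw [show c - k = c - (k + 1) + 1 by omega] at ih
    have h := hr.tendsto_pow_succ_mul_row0 hc hl hmu hnu hk (by omega) ih
    rw [Nat.cast_sub hkc] at h
    rw [theta0Row0_succ c l1 l2 mu nu hk]
    convert h using 5
    push_cast
    ring
end

section
/- Let (r_i^{(0,n)}, r_i^{(1,n)}) be a rate-matrix system with parameters c, λ₁, λ₂, μ, ν and λ = λ₁ + λ₂. Then for every k = 0, 1, …, c, lim_{n→∞} n^k · r_{c−k}^{(1,n)} = θ_0^{(1,k)}; equivalently, r_{c−k}^{(1,n)} = θ_0^{(1,k)}/n^k + o(1/n^k) as n → ∞. -/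
/-- The leading Taylor coefficients of the row `r^{(1,n)}`:
`θ_0^{(1,0)} = λ/(cν)`, `θ_0^{(1,1)} = λ/μ`, and
`θ_0^{(1,k)} = (λ/μ)·∏_{i=1}^{k−1} ((c−i)ν/μ)` for `k ≥ 2`. -/
noncomputable def theta0Row1 (c : ℕ) (l1 l2 mu nu : ℝ) : ℕ → ℝ :=
  fun k =>
    if k = 0 then (l1 + l2) / ((c : ℝ) * nu)
    else ((l1 + l2) / mu) * ∏ i ∈ Finset.Icc 1 (k - 1), (((c : ℝ) - (i : ℝ)) * nu / mu)

open Filter Topology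

/-- A nonnegative sequence that is `O(n^{-(m+1)})` is `o(n^{-m})`. -/
theorem tendsto_pow_mul_zero_of_bound {f : ℕ → ℝ} (m : ℕ) (hf : ∀ n, 0 ≤ f n)
    (hb : ∃ K, ∀ n : ℕ, 1 ≤ n → (n : ℝ) ^ (m + 1) * f n ≤ K) :
    Tendsto (fun n : ℕ => (n : ℝ) ^ m * f n) atTop (𝓝 0) := by
  obtain ⟨K, hK⟩ := hb
  refine tendsto_of_tendsto_of_tendsto_of_le_of_le' tendsto_const_nhds
    (tendsto_const_div_atTop_nhds_zero_nat K) ?_ ?_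
  · exact Eventually.of_forall fun n => by have := hf n; positivity
  · filter_upwards [eventually_ge_atTop 1] with n hn
    have hn' : (0 : ℝ) < n := by exact_mod_cast hn
    rw [le_div_iff₀ hn']
    calc (n : ℝ) ^ m * f n * n = (n : ℝ) ^ (m + 1) * f n := by ring
      _ ≤ K := hK n hn

/-- Bootstrapping of polynomial decay: a nonnegative array with `z n i = O(1)` for `i ≤ c` and
`z n i = O(1/n)` for `i < c`, subject to a tridiagonal-type inequality, satisfies
`z n i = O(n^{-m})` for `i + m ≤ c`. -/
theorem pow_mul_bounded_of_recursive_bound {c : ℕ} {C : ℝ} {z : ℕ → ℕ → ℝ} (hC : 0 ≤ C)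
    (hz : ∀ n i, 0 ≤ z n i)
    (hzero : ∀ n : ℕ, 1 ≤ n → n * z n 0 ≤ C * z n 1)
    (hstep : ∀ n : ℕ, 1 ≤ n → ∀ i, i + 3 ≤ c →
      n * z n (i + 1) ≤ C * (z n i + z n (i + 2) + n * z (n + 1) i))
    (hle : ∀ i, i ≤ c → ∃ K, ∀ n : ℕ, 1 ≤ n → z n i ≤ K)
    (hlt : ∀ i, i < c → ∃ K, ∀ n : ℕ, 1 ≤ n → n * z n i ≤ K) (m : ℕ) :
    ∀ i, i + m ≤ c → ∃ K, ∀ n : ℕ, 1 ≤ n → (n : ℝ) ^ m * z n i ≤ K := by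
  induction m with
  | zero => simpa using hle
  | succ m ihm =>
    rcases Nat.eq_zero_or_pos m with rfl | hm
    · intro i hi
      simpa using hlt i (by omega)
    intro i
    induction i with
    | zero =>
      intro hi
      obtain ⟨K, hK⟩ := ihm 1 (by omega)
      refine ⟨C * K, fun n hn => ?_⟩
      calc (n : ℝ) ^ (m + 1) * z n 0 = (n : ℝ) ^ m * (n * z n 0) := by ring
        _ ≤ (n : ℝ) ^ m * (C * z n 1) := mul_le_mul_of_nonneg_left (hzero n hn) (by positivity)
        _ = C * ((n : ℝ) ^ m * z n 1) := by ring
        _ ≤ C * K := by gcongr; exact hK n hn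
    | succ i ihi =>
      intro hi
      obtain ⟨K₁, hK₁⟩ := ihm i (by omega)
      obtain ⟨K₂, hK₂⟩ := ihm (i + 2) (by omega)
      obtain ⟨K₃, hK₃⟩ := ihi (by omega)
      refine ⟨C * (K₁ + K₂ + K₃), fun n hn => ?_⟩
      have hnext : (n : ℝ) ^ (m + 1) * z (n + 1) i ≤ K₃ := by
        refine le_trans ?_ (hK₃ (n + 1) (by omega))
        have := hz (n + 1) i
        gcongr
        omega
      calc (n : ℝ) ^ (m + 1) * z n (i + 1) = (n : ℝ) ^ m * (n * z n (i + 1)) := by ring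
        _ ≤ (n : ℝ) ^ m * (C * (z n i + z n (i + 2) + n * z (n + 1) i)) :=
          mul_le_mul_of_nonneg_left (hstep n hn i (by omega)) (by positivity)
        _ = C * ((n : ℝ) ^ m * z n i + (n : ℝ) ^ m * z n (i + 2)
              + (n : ℝ) ^ (m + 1) * z (n + 1) i) := by ring
        _ ≤ C * (K₁ + K₂ + K₃) := by
          gcongr
          · exact hK₁ n hn
          · exact hK₂ n hn

theorem theta0Row1_succ (c : ℕ) (l1 l2 mu nu : ℝ) {k : ℕ} (hk : 1 ≤ k) :
    theta0Row1 c l1 l2 mu nu (k + 1) =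
      theta0Row1 c l1 l2 mu nu k * (((c : ℝ) - k) * nu / mu) := by
  obtain ⟨k, rfl⟩ := Nat.exists_eq_add_of_le' hk
  simp [theta0Row1, Finset.prod_Icc_succ_top, mul_assoc, -Finset.prod_div_distrib]

namespace IsRMS

variable {c : ℕ} {l1 l2 mu nu : ℝ} {r0 r1 : ℕ → ℕ → ℝ}

theorem mul_r0_le (hr : IsRMS c l1 l2 mu nu r0 r1) (hmu : 0 < mu) {n i : ℕ} (hn : 1 ≤ n)
    (hi : i < c) : n * mu * r0 n i ≤ l2 := by
  obtain ⟨h0, -, h⟩ := hr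
  obtain ⟨-, -, -, -, -, -, -, hs, -⟩ := h n hn
  have hn' : (0 : ℝ) < n := by exact_mod_cast hn
  have := Finset.single_le_sum (fun j _ => h0 n j) (Finset.mem_range.2 hi)
  rw [hs, le_div_iff₀ (by positivity)] at this
  linarith

theorem mul_r1_le (hr : IsRMS c l1 l2 mu nu r0 r1) (hmu : 0 < mu) {n i : ℕ} (hn : 1 ≤ n)
    (hi : i < c) : n * mu * r1 n i ≤ l1 + l2 := by
  obtain ⟨-, h1, h⟩ := hr
  obtain ⟨-, -, -, -, -, -, -, -, hs⟩ := h n hn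
  have hn' : (0 : ℝ) < n := by exact_mod_cast hn
  have := Finset.single_le_sum (fun j _ => h1 n j) (Finset.mem_range.2 hi)
  rw [hs, le_div_iff₀ (by positivity)] at this
  linarith

theorem r0_le (hr : IsRMS c l1 l2 mu nu r0 r1) (hmu : 0 < mu) {n i : ℕ} (hn : 1 ≤ n)
    (hi : i < c) : r0 n i ≤ l2 / mu := by
  have hn' : (1 : ℝ) ≤ n := by exact_mod_cast hn
  rw [le_div_iff₀ hmu]
  have := hr.mul_r0_le hmu hn hi
  have := mul_nonneg (sub_nonneg.2 hn') (mul_nonneg hmu.le (hr.1 n i))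
  linarith

theorem r1_le (hr : IsRMS c l1 l2 mu nu r0 r1) (hmu : 0 < mu) {n i : ℕ} (hn : 1 ≤ n)
    (hi : i < c) : r1 n i ≤ (l1 + l2) / mu := by
  have hn' : (1 : ℝ) ≤ n := by exact_mod_cast hn
  rw [le_div_iff₀ hmu]
  have := hr.mul_r1_le hmu hn hi
  have := mul_nonneg (sub_nonneg.2 hn') (mul_nonneg hmu.le (hr.2.1 n i))
  linarith

/-- All entries of the system are uniformly bounded. -/
theorem exists_bound (hr : IsRMS c l1 l2 mu nu r0 r1) (hc : 2 ≤ c) (hl1 : 0 < l1) (hl2 : 0 < l2)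
    (hmu : 0 < mu) (hnu : 0 < nu) :
    ∃ M, 0 ≤ M ∧ ∀ n : ℕ, 1 ≤ n → ∀ i, i ≤ c → r0 n i ≤ M ∧ r1 n i ≤ M := by
  set B := (l1 + l2) / mu with hB
  have hBpos : 0 < B := by positivity
  have hc' : (0 : ℝ) < c := by exact_mod_cast (by omega : 0 < c)
  set D := (l1 + l2) * (B + 1) / (c * nu) with hD
  have hDpos : 0 < D := by positivity
  have hr0B : ∀ n : ℕ, 1 ≤ n → ∀ i, i < c → r0 n i ≤ B := fun n hn i hi =>
    (hr.r0_le hmu hn hi).trans (by rw [hB]; gcongr; linarith)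
  have last : ∀ n : ℕ, 1 ≤ n → ∀ a b s : ℝ, 0 ≤ a → a ≤ B → 0 ≤ b → s ≤ l1 + l2 →
      l1 * a - ((l1 + l2) + c * nu) * b
        + ((n : ℝ) + 1) * mu * (a * r0 (n + 1) (c - 1) + b * r1 (n + 1) (c - 1)) = -s → b ≤ D := by
    intro n hn a b s ha haB hb hs he
    have e0 := mul_le_mul_of_nonneg_left
      (hr.mul_r0_le hmu (n := n + 1) (i := c - 1) (by omega) (by omega)) ha
    have e1 := mul_le_mul_of_nonneg_left
      (hr.mul_r1_le hmu (n := n + 1) (i := c - 1) (by omega) (by omega)) hb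
    push_cast at e0 e1
    have e2 := mul_le_mul_of_nonneg_left haB (by positivity : 0 ≤ l1 + l2)
    rw [hD, le_div_iff₀ (by positivity)]
    linarith
  refine ⟨B + D, by positivity, fun n hn i hi => ?_⟩
  rcases hi.lt_or_eq with hi | rfl
  · have := hr0B n hn i hi
    have := hr.r1_le hmu hn hi
    constructor <;> linarith
  · obtain ⟨-, -, -, e0, -, -, e1, -, -⟩ := hr.2.2 n hn
    have d0 := last n hn _ _ 0 (hr.1 n _) (hr0B n hn (i - 1) (by omega)) (hr.1 n _)
      (by positivity) (by simpa using e0)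
    have d1 := last n hn _ _ _ (hr.2.1 n _) (hr.r1_le hmu hn (i := i - 1) (by omega)) (hr.2.1 n _)
      le_rfl e1
    constructor <;> linarith

/-- Both rows decay like `n^{-m}` at distance `m` from the last column. -/
theorem pow_mul_add_bounded (hr : IsRMS c l1 l2 mu nu r0 r1) (hc : 2 ≤ c) (hl1 : 0 < l1)
    (hl2 : 0 < l2) (hmu : 0 < mu) (hnu : 0 < nu) (m i : ℕ) (him : i + m ≤ c) :
    ∃ K, ∀ n : ℕ, 1 ≤ n → (n : ℝ) ^ m * (r0 n i + r1 n i) ≤ K := by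
  obtain ⟨M, hM, hb⟩ := hr.exists_bound hc hl1 hl2 hmu hnu
  obtain ⟨h0, h1, h⟩ := id hr
  have hc' : (2 : ℝ) ≤ c := by exact_mod_cast hc
  have hcn : 0 < c * nu := by positivity
  refine pow_mul_bounded_of_recursive_bound (c := c) (z := fun n i => r0 n i + r1 n i)
    (C := (l1 + l2 + c * nu + 4 * mu * M) / mu) (by positivity)
    (fun n i => add_nonneg (h0 n i) (h1 n i)) ?_ ?_ ?_ ?_ m i him
  · intro n hn
    obtain ⟨e0, -, -, -, e1, -⟩ := h n hn
    rw [div_mul_eq_mul_div, le_div_iff₀ hmu]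
    have p0 := h0 n 0
    have p1 := h1 n 0
    have q0 := h0 n 1
    have q1 := h1 n 1
    have a1 : 0 ≤ (l1 + l2) * (r0 n 0 + r1 n 0) := by positivity
    have a2 : 0 ≤ (l1 + l2 + (c - 1) * nu + 4 * mu * M) * (r0 n 1 + r1 n 1) := by
      have : (0 : ℝ) ≤ c - 1 := by linarith
      positivity
    linarith
  · intro n hn i hi
    obtain ⟨-, e0, -, -, -, e1, -⟩ := h n hn
    have e0 := e0 (i + 1) (by omega) (by omega)
    have e1 := e1 (i + 1) (by omega) (by omega)
    simp only [Nat.add_sub_cancel, add_assoc, one_add_one_eq_two] at e0 e1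
    push_cast at e0 e1
    have hn' : (1 : ℝ) ≤ n := by exact_mod_cast hn
    have hi' : (i : ℝ) + 3 ≤ c := by exact_mod_cast hi
    rw [div_mul_eq_mul_div, le_div_iff₀ hmu]
    have p0 := h0 n i
    have p1 := h1 n i
    have q0 := h0 n (i + 1)
    have q1 := h1 n (i + 1)
    have s0 := h0 n (i + 2)
    have s1 := h1 n (i + 2)
    have t0 := h0 (n + 1) i
    have t1 := h1 (n + 1) i
    have a1 : 0 ≤ (l1 + l2 + (i + 1) * nu) * (r0 n (i + 1) + r1 n (i + 1)) := by positivity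
    have a2 : 0 ≤ (c * nu + 4 * mu * M) * (r0 n i + r1 n i) := by positivity
    have a3 : 0 ≤ (l1 + l2 + (c - (i + 2)) * nu + 4 * mu * M)
        * (r0 n (i + 2) + r1 n (i + 2)) := by
      have : (0 : ℝ) ≤ c - (i + 2) := by linarith
      positivity
    have a4 : 0 ≤ (l1 + l2 + c * nu) * (n * (r0 (n + 1) i + r1 (n + 1) i)) := by positivity
    have coupling : ∀ a b, a ≤ M → b ≤ M →
        ((n : ℝ) + 1) * mu * (a * r0 (n + 1) i + b * r1 (n + 1) i)
          ≤ 2 * n * mu * (M * (r0 (n + 1) i + r1 (n + 1) i)) := by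
      intro a b ha hb
      calc ((n : ℝ) + 1) * mu * (a * r0 (n + 1) i + b * r1 (n + 1) i)
          ≤ ((n : ℝ) + 1) * mu * (M * r0 (n + 1) i + M * r1 (n + 1) i) := by gcongr
        _ ≤ (2 * n) * mu * (M * r0 (n + 1) i + M * r1 (n + 1) i) := by gcongr; linarith
        _ = _ := by ring
    have b0 := coupling _ _ (hb n hn (c - 1) (by omega)).1 (hb n hn c le_rfl).1
    have b1 := coupling _ _ (hb n hn (c - 1) (by omega)).2 (hb n hn c le_rfl).2
    linarith
  · intro i hi
    exact ⟨M + M, fun n hn => add_le_add (hb n hn i hi).1 (hb n hn i hi).2⟩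
  · intro i hi
    refine ⟨(l2 + (l1 + l2)) / mu, fun n hn => ?_⟩
    have := hr.mul_r0_le hmu hn hi
    have := hr.mul_r1_le hmu hn hi
    rw [le_div_iff₀ hmu]
    linarith

theorem pow_mul_r1_tendsto_zero (hr : IsRMS c l1 l2 mu nu r0 r1) (hc : 2 ≤ c) (hl1 : 0 < l1)
    (hl2 : 0 < l2) (hmu : 0 < mu) (hnu : 0 < nu) (m i : ℕ) (him : i + m + 1 ≤ c) :
    Tendsto (fun n : ℕ => (n : ℝ) ^ m * r1 n i) atTop (𝓝 0) := by
  refine tendsto_pow_mul_zero_of_bound m (fun n => hr.2.1 n i) ?_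
  obtain ⟨K, hK⟩ := hr.pow_mul_add_bounded hc hl1 hl2 hmu hnu (m + 1) i him
  refine ⟨K, fun n hn => le_trans ?_ (hK n hn)⟩
  have := hr.1 n i
  gcongr
  linarith

theorem tendsto_mul_r1_pred (hr : IsRMS c l1 l2 mu nu r0 r1) (hc : 2 ≤ c) (hl1 : 0 < l1)
    (hl2 : 0 < l2) (hmu : 0 < mu) (hnu : 0 < nu) :
    Tendsto (fun n : ℕ => (n : ℝ) * r1 n (c - 1)) atTop (𝓝 ((l1 + l2) / mu)) := by
  have hsum : Tendsto (fun n : ℕ => ∑ i ∈ Finset.range (c - 1), (n : ℝ) ^ 1 * r1 n i)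
      atTop (𝓝 (∑ i ∈ Finset.range (c - 1), (0 : ℝ))) := by
    refine tendsto_finsetSum _ fun i hi => ?_
    rw [Finset.mem_range] at hi
    exact hr.pow_mul_r1_tendsto_zero hc hl1 hl2 hmu hnu 1 i (by omega)
  have := hsum.const_sub ((l1 + l2) / mu)
  simp only [Finset.sum_const_zero, sub_zero] at this
  refine this.congr' ?_
  filter_upwards [eventually_ge_atTop 1] with n hn
  obtain ⟨-, -, -, -, -, -, -, -, hs⟩ := hr.2.2 n hn
  have hn' : (n : ℝ) ≠ 0 := by exact_mod_cast (by omega : n ≠ 0)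
  obtain ⟨d, rfl⟩ := Nat.exists_eq_add_of_le' (by omega : 1 ≤ c)
  rw [Finset.sum_range_succ] at hs
  simp only [Nat.add_sub_cancel, pow_one, ← Finset.mul_sum]
  rw [← eq_sub_iff_add_eq'] at hs
  rw [hs]
  field_simp

theorem tendsto_r1_last (hr : IsRMS c l1 l2 mu nu r0 r1) (hc : 2 ≤ c) (hl1 : 0 < l1)
    (hl2 : 0 < l2) (hmu : 0 < mu) (hnu : 0 < nu) :
    Tendsto (fun n : ℕ => r1 n c) atTop (𝓝 ((l1 + l2) / (c * nu))) := by
  have hc' : (0 : ℝ) < c := by exact_mod_cast (by omega : 0 < c)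
  have hpred := hr.tendsto_mul_r1_pred hc hl1 hl2 hmu hnu
  have hzero : Tendsto (fun n : ℕ => r1 n (c - 1)) atTop (𝓝 0) := by
    simpa using hr.pow_mul_r1_tendsto_zero hc hl1 hl2 hmu hnu 0 (c - 1) (by omega)
  have hshift : Tendsto (fun n : ℕ => ((n : ℝ) + 1) * r1 (n + 1) (c - 1)) atTop
      (𝓝 ((l1 + l2) / mu)) := by
    simpa [Function.comp_def] using hpred.comp (tendsto_add_atTop_nat 1)
  have hcross : Tendsto
      (fun n : ℕ => r1 n (c - 1) * (((n : ℝ) + 1) * mu * r0 (n + 1) (c - 1))) atTop (𝓝 0) := by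
    refine squeeze_zero (g := fun n => r1 n (c - 1) * l2) (fun n => ?_) (fun n => ?_)
      (by simpa using hzero.mul_const l2)
    · have := hr.2.1 n (c - 1)
      have := hr.1 (n + 1) (c - 1)
      positivity
    · have := hr.mul_r0_le hmu (n := n + 1) (i := c - 1) (by omega) (by omega)
      push_cast at this
      exact mul_le_mul_of_nonneg_left this (hr.2.1 n (c - 1))
  have hnum := ((hzero.const_mul l1).add hcross).const_add (l1 + l2)
  have hden := (hshift.const_mul mu).const_sub (l1 + l2 + c * nu)
  have hlim : l1 + l2 + c * nu - mu * ((l1 + l2) / mu) = c * nu := by field_simp; ring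
  rw [hlim] at hden
  have hdiv := hnum.div hden (by positivity)
  simp only [mul_zero, add_zero] at hdiv
  refine hdiv.congr' ?_
  filter_upwards [eventually_ge_atTop 1] with n hn
  obtain ⟨-, -, -, -, -, -, e, -, -⟩ := hr.2.2 n hn
  have hle := hr.mul_r1_le hmu (n := n + 1) (i := c - 1) (by omega) (by omega)
  push_cast at hle
  have hcn : 0 < c * nu := by positivity
  have hpos : 0 < l1 + l2 + c * nu - mu * (((n : ℝ) + 1) * r1 (n + 1) (c - 1)) := by linarith
  rw [Pi.div_apply, div_eq_iff hpos.ne']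
  linarith

/-- The row-1 balance equation at column `i`, with the lower-order terms collected in `e`. -/
theorem exists_r1_balance (hr : IsRMS c l1 l2 mu nu r0 r1) (hc : 2 ≤ c) (hl1 : 0 < l1)
    (hl2 : 0 < l2) (hmu : 0 < mu) (hnu : 0 < nu) {i m : ℕ} (him : i + m + 1 ≤ c) :
    ∃ e : ℕ → ℝ, Tendsto (fun n : ℕ => (n : ℝ) ^ m * e n) atTop (𝓝 0) ∧
      ∀ n : ℕ, 1 ≤ n →
        ((l1 + l2) + i * nu + n * mu) * r1 n i = ((i : ℝ) + 1) * nu * r1 n (i + 1) + e n := by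
  obtain ⟨h0, h1, h⟩ := id hr
  rcases i with _ | i
  · refine ⟨0, by simp, fun n hn => ?_⟩
    obtain ⟨-, -, -, -, e, -⟩ := h n hn
    simp only [Nat.cast_zero, Pi.zero_apply]
    linarith
  refine ⟨fun n => (l1 + l2) * r1 n i + ((n : ℝ) + 1) * mu *
    (r1 n (c - 1) * r0 (n + 1) i + r1 n c * r1 (n + 1) i), ?_, fun n hn => ?_⟩
  · obtain ⟨M, hM, hb⟩ := hr.exists_bound hc hl1 hl2 hmu hnu
    obtain ⟨K₁, hK₁⟩ := hr.pow_mul_add_bounded hc hl1 hl2 hmu hnu (m + 1) i (by omega)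
    obtain ⟨K₂, hK₂⟩ := hr.pow_mul_add_bounded hc hl1 hl2 hmu hnu (m + 2) i (by omega)
    refine tendsto_pow_mul_zero_of_bound m (fun n => ?_)
      ⟨(l1 + l2) * K₁ + mu * M * K₂, fun n hn => ?_⟩
    · have := h1 n i
      have := h1 n (c - 1)
      have := h1 n c
      have := h0 (n + 1) i
      have := h1 (n + 1) i
      positivity
    · have p0 := h0 n i
      have p1 := h1 n i
      have t0 := h0 (n + 1) i
      have t1 := h1 (n + 1) i
      have hnext := hK₂ (n + 1) (by omega)
      push_cast at hnext
      calc (n : ℝ) ^ (m + 1) * ((l1 + l2) * r1 n i + ((n : ℝ) + 1) * mu *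
            (r1 n (c - 1) * r0 (n + 1) i + r1 n c * r1 (n + 1) i))
          ≤ (n : ℝ) ^ (m + 1) * ((l1 + l2) * (r0 n i + r1 n i) + ((n : ℝ) + 1) * mu *
            (M * r0 (n + 1) i + M * r1 (n + 1) i)) := by
            gcongr
            · linarith
            · exact (hb n hn (c - 1) (by omega)).2
            · exact (hb n hn c le_rfl).2
        _ = (l1 + l2) * ((n : ℝ) ^ (m + 1) * (r0 n i + r1 n i)) +
            mu * M * ((n : ℝ) ^ (m + 1) * ((n : ℝ) + 1) * (r0 (n + 1) i + r1 (n + 1) i)) := by ring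
        _ ≤ (l1 + l2) * ((n : ℝ) ^ (m + 1) * (r0 n i + r1 n i)) +
            mu * M * (((n : ℝ) + 1) ^ (m + 1) * ((n : ℝ) + 1)
              * (r0 (n + 1) i + r1 (n + 1) i)) := by
            gcongr
            linarith
        _ = (l1 + l2) * ((n : ℝ) ^ (m + 1) * (r0 n i + r1 n i)) +
            mu * M * (((n : ℝ) + 1) ^ (m + 2) * (r0 (n + 1) i + r1 (n + 1) i)) := by ring
        _ ≤ (l1 + l2) * K₁ + mu * M * K₂ := by
            gcongr
            exact hK₁ n hn
  · obtain ⟨-, -, -, -, -, e, -⟩ := h n hn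
    have e := e (i + 1) (by omega) (by omega)
    simp only [Nat.add_sub_cancel] at e
    linarith

end IsRMS

/-- One-term Taylor expansion (Lemma 3.1, row 1):
`lim_{n→∞} n^k · r_{c−k}^{(1,n)} = θ_0^{(1,k)}` for every `0 ≤ k ≤ c`. -/
theorem rate_matrix_one_term_expansion_row1
    (c : ℕ) (hc : 2 ≤ c)
    (l1 l2 mu nu : ℝ) (hl1 : 0 < l1) (hl2 : 0 < l2) (hmu : 0 < mu) (hnu : 0 < nu)
    (r0 r1 : ℕ → ℕ → ℝ) (hr : IsRMS c l1 l2 mu nu r0 r1) :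
    ∀ k : ℕ, k ≤ c →
      Filter.Tendsto (fun n : ℕ => (n : ℝ) ^ k * r1 n (c - k))
        Filter.atTop (nhds (theta0Row1 c l1 l2 mu nu k)) := by
  intro k
  induction k with
  | zero =>
    intro _
    simpa [theta0Row1] using hr.tendsto_r1_last hc hl1 hl2 hmu hnu
  | succ k ih =>
    intro hk
    rcases Nat.eq_zero_or_pos k with rfl | hk0
    · simpa [theta0Row1] using hr.tendsto_mul_r1_pred hc hl1 hl2 hmu hnu
    obtain ⟨i, rfl⟩ := Nat.exists_eq_add_of_le' hk
    obtain ⟨e, he, hbal⟩ := hr.exists_r1_balance hc hl1 hl2 hmu hnu (i := i) (m := k) le_rfl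
    have hlead := ih (by omega)
    rw [show i + (k + 1) - k = i + 1 by omega] at hlead
    rw [Nat.add_sub_cancel, theta0Row1_succ _ _ _ _ _ hk0]
    have hsmall := hr.pow_mul_r1_tendsto_zero hc hl1 hl2 hmu hnu k i le_rfl
    have hlim := (((hlead.const_mul (((i : ℝ) + 1) * nu)).add he).sub
      (hsmall.const_mul ((l1 + l2) + i * nu))).div_const mu
    convert hlim.congr' ?_ using 2
    · push_cast
      ring
    · filter_upwards [eventually_ge_atTop 1] with n hn
      rw [div_eq_iff hmu.ne']
      linear_combination -(n : ℝ) ^ k * hbal n hn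
end

section
/- Let (r_i^{(0,n)}, r_i^{(1,n)}) be a rate-matrix system with parameters c, λ₁, λ₂, μ, ν and λ = λ₁ + λ₂. Then for every k = 0, 1, …, c, the sequence n^{k+1}·(r_{c−k}^{(0,n)} − θ_0^{(0,k)}/n^k) is bounded in n; equivalently, r_{c−k}^{(0,n)} = θ_0^{(0,k)}/n^k + O(1/n^{k+1}) as n → ∞. -/
open Asymptotics Filter

namespace RateMatrix

/-- The principal filter on the positive integers: big-O along it is a bound valid for all
`n ≥ 1`. -/
def posFilter : Filter ℕ := 𝓟 {n | 1 ≤ n}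

/-- The `m`-th power of `1 / n`. -/
noncomputable def invPow (m n : ℕ) : ℝ := ((n : ℝ)⁻¹) ^ m

lemma invPow_nonneg (m n : ℕ) : 0 ≤ invPow m n := by
  unfold invPow; positivity

lemma isBigO_posFilter {f g : ℕ → ℝ} :
    f =O[posFilter] g ↔ ∃ C : ℝ, ∀ n : ℕ, 1 ≤ n → |f n| ≤ C * |g n| := by
  simp [posFilter, isBigO_principal]

lemma isBigO_congr {f g h : ℕ → ℝ} (hf : f =O[posFilter] h) (hfg : ∀ n, 1 ≤ n → g n = f n) :
    g =O[posFilter] h := by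
  rw [isBigO_posFilter] at *
  obtain ⟨C, hC⟩ := hf
  exact ⟨C, fun n hn => by rw [hfg n hn]; exact hC n hn⟩

lemma isBigO_of_nonneg_of_le {f g h : ℕ → ℝ} (hf : g =O[posFilter] h) (h0 : ∀ n, 0 ≤ f n)
    (hfg : ∀ n, 1 ≤ n → f n ≤ g n) : f =O[posFilter] h := by
  rw [isBigO_posFilter] at *
  obtain ⟨C, hC⟩ := hf
  refine ⟨C, fun n hn => le_trans ?_ (hC n hn)⟩
  rw [abs_of_nonneg (h0 n)]
  exact (hfg n hn).trans (le_abs_self _)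

lemma invPow_isBigO_invPow {a b : ℕ} (h : b ≤ a) : invPow a =O[posFilter] invPow b := by
  rw [isBigO_posFilter]
  refine ⟨1, fun n hn => ?_⟩
  rw [abs_of_nonneg (invPow_nonneg _ _), abs_of_nonneg (invPow_nonneg _ _), one_mul]
  have hn' : (1 : ℝ) ≤ n := by exact_mod_cast hn
  exact pow_le_pow_of_le_one (by positivity) (inv_le_one_of_one_le₀ hn') h

lemma isBigO_mul_invPow {f g : ℕ → ℝ} {a b : ℕ} (hf : f =O[posFilter] invPow a)
    (hg : g =O[posFilter] invPow b) : (fun n => f n * g n) =O[posFilter] invPow (a + b) := by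
  refine (hf.mul hg).congr_right fun n => ?_
  simp [invPow, pow_add]

lemma isBigO_shift {f : ℕ → ℝ} {m : ℕ} (hf : f =O[posFilter] invPow m) :
    (fun n => f (n + 1)) =O[posFilter] invPow m := by
  rw [isBigO_posFilter] at *
  obtain ⟨C, hC⟩ := hf
  refine ⟨|C|, fun n hn => (hC (n + 1) (by omega)).trans ?_⟩
  rw [abs_of_nonneg (invPow_nonneg _ _), abs_of_nonneg (invPow_nonneg _ _)]
  refine mul_le_mul (le_abs_self C) ?_ (invPow_nonneg _ _) (abs_nonneg _)
  have hn' : (0 : ℝ) < n := by exact_mod_cast hn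
  refine pow_le_pow_left₀ (by positivity) (inv_anti₀ hn' ?_) m
  push_cast; linarith

lemma isBigO_succ_mul {f : ℕ → ℝ} {m : ℕ} (hf : f =O[posFilter] invPow (m + 1)) :
    (fun n : ℕ => ((n : ℝ) + 1) * f n) =O[posFilter] invPow m := by
  rw [isBigO_posFilter] at *
  obtain ⟨C, hC⟩ := hf
  refine ⟨2 * C, fun n hn => ?_⟩
  have hn' : (1 : ℝ) ≤ n := by exact_mod_cast hn
  rw [abs_mul, abs_of_nonneg (by positivity : (0 : ℝ) ≤ (n : ℝ) + 1)]
  calc ((n : ℝ) + 1) * |f n| ≤ (2 * n) * |f n| :=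
        mul_le_mul_of_nonneg_right (by linarith) (abs_nonneg _)
    _ ≤ (2 * n) * (C * |invPow (m + 1) n|) :=
        mul_le_mul_of_nonneg_left (hC n hn) (by positivity)
    _ = 2 * C * |invPow m n| := by
        rw [abs_of_nonneg (invPow_nonneg _ _), abs_of_nonneg (invPow_nonneg _ _)]
        simp only [invPow, pow_succ]
        field_simp

lemma isBigO_of_linear_mul_eq {f g : ℕ → ℝ} {m : ℕ} {a mu : ℝ} (ha : 0 ≤ a) (hmu : 0 < mu)
    (hg : g =O[posFilter] invPow m) (h : ∀ n : ℕ, 1 ≤ n → (a + n * mu) * f n = g n) :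
    f =O[posFilter] invPow (m + 1) := by
  rw [isBigO_posFilter] at *
  obtain ⟨C, hC⟩ := hg
  refine ⟨C / mu, fun n hn => ?_⟩
  have hn' : (0 : ℝ) < n := by exact_mod_cast hn
  have key : (n * mu) * |f n| ≤ C * |invPow m n| := by
    refine le_trans ?_ (hC n hn)
    rw [← h n hn, abs_mul, abs_of_nonneg (by positivity : 0 ≤ a + n * mu)]
    exact mul_le_mul_of_nonneg_right (by linarith) (abs_nonneg _)
  have e : C / mu * |invPow (m + 1) n| = C * |invPow m n| / (n * mu) := by
    rw [abs_of_nonneg (invPow_nonneg _ _), abs_of_nonneg (invPow_nonneg _ _)]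
    simp only [invPow, pow_succ]
    field_simp
  rw [e, le_div_iff₀ (by positivity)]
  linarith

/-- The part of the balance equation at phase `i` of the row `x` that comes from phase `i - 1`. -/
def inflow (c : ℕ) (lam mu : ℝ) (r0 r1 x : ℕ → ℕ → ℝ) : ℕ → ℕ → ℝ
  | 0, _ => 0
  | i + 1, n => lam * x n i
      + mu * (((n : ℝ) + 1) * (x n (c - 1) * r0 (n + 1) i + x n c * r1 (n + 1) i))

lemma inflow_isBigO {c m i : ℕ} {lam mu : ℝ} {r0 r1 x : ℕ → ℕ → ℝ}
    (hx1 : (fun n => x n (c - 1)) =O[posFilter] invPow 1)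
    (hi : ∀ j, j + 1 = i → (fun n => x n j) =O[posFilter] invPow m ∧
      (fun n => r0 n j) =O[posFilter] invPow m ∧
      (fun n => x n c * r1 (n + 1) j) =O[posFilter] invPow (m + 1)) :
    inflow c lam mu r0 r1 x i =O[posFilter] invPow m := by
  cases i with
  | zero => exact isBigO_zero _ _
  | succ j =>
    obtain ⟨h1, h2, h3⟩ := hi j rfl
    have h4 := isBigO_mul_invPow hx1 (isBigO_shift h2)
    rw [add_comm 1 m] at h4
    exact (h1.const_mul_left lam).add ((isBigO_succ_mul (h4.add h3)).const_mul_left mu)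

section System

variable {c : ℕ} {l1 l2 mu nu : ℝ} {r0 r1 : ℕ → ℕ → ℝ}

lemma row0_balance (hr : IsRMS c l1 l2 mu nu r0 r1) {i n : ℕ} (hi : i + 2 ≤ c) (hn : 1 ≤ n) :
    ((l1 + l2 + i * nu) + n * mu) * r0 n i
      = ((i : ℝ) + 1) * nu * r0 n (i + 1) + inflow c (l1 + l2) mu r0 r1 r0 i n := by
  obtain ⟨e0, ei, -⟩ := hr.2.2 n hn
  cases i with
  | zero => simp only [inflow]; push_cast; simp only [zero_add]; linear_combination -e0
  | succ j =>
    have := ei (j + 1) (by omega) hi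
    simp only [inflow, Nat.add_sub_cancel] at *
    linear_combination -this

lemma row1_balance (hr : IsRMS c l1 l2 mu nu r0 r1) {i n : ℕ} (hi : i + 1 ≤ c) (hn : 1 ≤ n) :
    ((l1 + l2 + i * nu) + n * mu) * r1 n i
      = ((i : ℝ) + 1) * nu * r1 n (i + 1) + inflow c (l1 + l2) mu r0 r1 r1 i n := by
  obtain ⟨-, -, -, -, e0, ei, -⟩ := hr.2.2 n hn
  cases i with
  | zero => simp only [inflow]; push_cast; simp only [zero_add]; linear_combination -e0
  | succ j =>
    have := ei (j + 1) (by omega) hi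
    simp only [inflow, Nat.add_sub_cancel] at *
    linear_combination -this

lemma row0_le (hr : IsRMS c l1 l2 mu nu r0 r1) {i n : ℕ} (hi : i < c) (hn : 1 ≤ n) :
    r0 n i ≤ l2 / (n * mu) := by
  obtain ⟨-, -, -, -, -, -, -, h, -⟩ := hr.2.2 n hn
  rw [← h]
  exact Finset.single_le_sum (fun j _ => hr.1 n j) (Finset.mem_range.2 hi)

lemma row1_le (hr : IsRMS c l1 l2 mu nu r0 r1) {i n : ℕ} (hi : i < c) (hn : 1 ≤ n) :
    r1 n i ≤ (l1 + l2) / (n * mu) := by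
  obtain ⟨-, -, -, -, -, -, -, -, h⟩ := hr.2.2 n hn
  rw [← h]
  exact Finset.single_le_sum (fun j _ => hr.2.1 n j) (Finset.mem_range.2 hi)

lemma div_isBigO (a : ℝ) :
    (fun n : ℕ => a / (n * mu)) =O[posFilter] invPow 1 := by
  refine isBigO_congr ((isBigO_refl (invPow 1) posFilter).const_mul_left (a / mu)) fun n _ => ?_
  simp only [invPow, pow_one, div_eq_mul_inv, mul_inv]
  ring

lemma row0_isBigO_one (hr : IsRMS c l1 l2 mu nu r0 r1) {i : ℕ} (hi : i < c) :
    (fun n => r0 n i) =O[posFilter] invPow 1 :=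
  isBigO_of_nonneg_of_le (div_isBigO (mu := mu) l2) (fun n => hr.1 n i) fun _ hn => row0_le hr hi hn

lemma row1_isBigO_one (hr : IsRMS c l1 l2 mu nu r0 r1) {i : ℕ} (hi : i < c) :
    (fun n => r1 n i) =O[posFilter] invPow 1 :=
  isBigO_of_nonneg_of_le (div_isBigO (mu := mu) (l1 + l2)) (fun n => hr.2.1 n i)
    fun _ hn => row1_le hr hi hn

/-- The balance equation at phase `c` bounds the entry at `c` by the entry at `c - 1`. -/
lemma last_le (hr : IsRMS c l1 l2 mu nu r0 r1) (hc : 2 ≤ c) (hmu : 0 < mu) (hnu : 0 < nu)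
    {x : ℕ → ℕ → ℝ} {d : ℝ} {n : ℕ} (hn : 1 ≤ n) (hx : ∀ i, 0 ≤ x n i)
    (h : l1 * x n (c - 1) - ((l1 + l2) + (c : ℝ) * nu) * x n c
        + ((n : ℝ) + 1) * mu *
            (x n (c - 1) * r0 (n + 1) (c - 1) + x n c * r1 (n + 1) (c - 1)) = -d) :
    x n c ≤ (c * nu)⁻¹ * (d + (l1 + l2) * x n (c - 1)) := by
  have hc' : (0 : ℝ) < c := by exact_mod_cast (by omega : 0 < c)
  have hn' : (0 : ℝ) < (n : ℝ) + 1 := by positivity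
  have h0 := row0_le hr (i := c - 1) (n := n + 1) (by omega) (by omega)
  have h1 := row1_le hr (i := c - 1) (n := n + 1) (by omega) (by omega)
  push_cast at h0 h1
  rw [le_div_iff₀ (by positivity)] at h0 h1
  rw [le_inv_mul_iff₀ (by positivity)]
  nlinarith [mul_le_mul_of_nonneg_right h0 (hx (c - 1)), mul_le_mul_of_nonneg_right h1 (hx c)]

lemma row0_last_isBigO (hr : IsRMS c l1 l2 mu nu r0 r1) (hc : 2 ≤ c) (hmu : 0 < mu)
    (hnu : 0 < nu) : (fun n => r0 n c) =O[posFilter] invPow 1 := by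
  refine isBigO_of_nonneg_of_le (((row0_isBigO_one hr (by omega : c - 1 < c)).const_mul_left
    (l1 + l2)).const_mul_left (c * nu)⁻¹) (fun n => hr.1 n c) fun n hn => ?_
  obtain ⟨-, -, -, h, -⟩ := hr.2.2 n hn
  have := last_le (d := 0) hr hc hmu hnu hn (hr.1 n) (by rw [h, neg_zero])
  rwa [zero_add] at this

lemma row1_last_isBigO (hr : IsRMS c l1 l2 mu nu r0 r1) (hc : 2 ≤ c) (hmu : 0 < mu)
    (hnu : 0 < nu) : (fun n => r1 n c) =O[posFilter] invPow 0 := by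
  have h0 : (fun _ : ℕ => l1 + l2) =O[posFilter] invPow 0 := by
    have : invPow 0 = fun _ => (1 : ℝ) := by ext n; simp [invPow]
    rw [this]
    exact isBigO_const_const _ one_ne_zero _
  refine isBigO_of_nonneg_of_le ((h0.add (((row1_isBigO_one hr (by omega : c - 1 < c)).trans
    (invPow_isBigO_invPow zero_le_one)).const_mul_left (l1 + l2))).const_mul_left (c * nu)⁻¹)
    (fun n => hr.2.1 n c) fun n hn => ?_
  obtain ⟨-, -, -, -, -, -, h, -⟩ := hr.2.2 n hn
  exact last_le hr hc hmu hnu hn (hr.2.1 n) h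

/-- Both rows decay at least like `n ^ (-m)` in the phases `i ≤ c - m`. -/
lemma rows_isBigO (hr : IsRMS c l1 l2 mu nu r0 r1) (hc : 2 ≤ c) (hl1 : 0 < l1) (hl2 : 0 < l2)
    (hmu : 0 < mu) (hnu : 0 < nu) {m : ℕ} (hm : 1 ≤ m) :
    ∀ i, i + m ≤ c → (fun n => r0 n i) =O[posFilter] invPow m ∧
      (fun n => r1 n i) =O[posFilter] invPow m := by
  induction m, hm using Nat.le_induction with
  | base => exact fun i hi => ⟨row0_isBigO_one hr (by omega), row1_isBigO_one hr (by omega)⟩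
  | succ m hm ih =>
    intro i hi
    constructor
    · refine isBigO_of_linear_mul_eq (a := l1 + l2 + i * nu) (by positivity) hmu
        (((ih (i + 1) (by omega)).1.const_mul_left (((i : ℝ) + 1) * nu)).add
          (inflow_isBigO (row0_isBigO_one hr (by omega)) fun j hj =>
            ⟨(ih j (by omega)).1, (ih j (by omega)).1, ?_⟩))
        fun n hn => row0_balance hr (by omega) hn
      have := isBigO_mul_invPow (row0_last_isBigO hr hc hmu hnu) (isBigO_shift (ih j (by omega)).2)
      rwa [add_comm 1 m] at this
    · induction i with
      | zero =>
        exact isBigO_of_linear_mul_eq (a := l1 + l2 + (0 : ℕ) * nu) (by positivity) hmu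
          (((ih (0 + 1) (by omega)).2.const_mul_left (((0 : ℕ) + 1 : ℝ) * nu)).add
            (inflow_isBigO (row1_isBigO_one hr (by omega)) fun j hj => by omega))
          fun n hn => row1_balance hr (by omega) hn
      | succ i ihi =>
        refine isBigO_of_linear_mul_eq (a := l1 + l2 + (i + 1 : ℕ) * nu) (by positivity) hmu
          (((ih (i + 1 + 1) (by omega)).2.const_mul_left (((i + 1 : ℕ) + 1 : ℝ) * nu)).add
            (inflow_isBigO (row1_isBigO_one hr (by omega)) fun j hj =>
              ⟨(ih j (by omega)).2, (ih j (by omega)).1, ?_⟩))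
          fun n hn => row1_balance hr (by omega) hn
        obtain rfl : j = i := by omega
        have := isBigO_mul_invPow (row1_last_isBigO hr hc hmu hnu) (isBigO_shift (ihi (by omega)))
        rwa [zero_add] at this

lemma theta0Row0_succ {k : ℕ} (hk : 1 ≤ k) :
    theta0Row0 c l1 l2 mu nu (k + 1)
      = theta0Row0 c l1 l2 mu nu k * (((c : ℝ) - k) * nu / mu) := by
  obtain ⟨j, rfl⟩ : ∃ j, k = j + 1 := ⟨k - 1, by omega⟩
  simp only [theta0Row0, Nat.add_sub_cancel, Nat.succ_ne_zero, if_false]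
  rw [Finset.prod_Icc_succ_top (by omega), mul_assoc]

lemma row0_sub_theta_isBigO (hr : IsRMS c l1 l2 mu nu r0 r1) (hc : 2 ≤ c) (hl1 : 0 < l1)
    (hl2 : 0 < l2) (hmu : 0 < mu) (hnu : 0 < nu) {k : ℕ} (hk : 1 ≤ k) (hkc : k ≤ c) :
    (fun n => r0 n (c - k) - theta0Row0 c l1 l2 mu nu k * invPow k n)
      =O[posFilter] invPow (k + 1) := by
  have hrows := fun m hm => rows_isBigO (m := m) hr hc hl1 hl2 hmu hnu hm
  induction k, hk using Nat.le_induction with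
  | base =>
    have hs : (fun n => ∑ i ∈ Finset.range (c - 1), r0 n i) =O[posFilter] invPow 2 :=
      IsBigO.fun_sum fun i hi => (hrows 2 (by omega) i (by have := Finset.mem_range.1 hi; omega)).1
    refine isBigO_congr hs.neg_left fun n hn => ?_
    obtain ⟨-, -, -, -, -, -, -, h, -⟩ := hr.2.2 n hn
    obtain ⟨d, rfl⟩ : ∃ d, c = d + 1 := ⟨c - 1, by omega⟩
    rw [Finset.sum_range_succ] at h
    have e : theta0Row0 (d + 1) l1 l2 mu nu 1 * invPow 1 n = l2 / (n * mu) := by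
      simp [theta0Row0, invPow, div_eq_mul_inv]; ring
    rw [e, ← h, Nat.add_sub_cancel]
    ring
  | succ k hk ih =>
    obtain ⟨i, rfl⟩ : ∃ i, c = i + (k + 1) := ⟨c - (k + 1), by omega⟩
    have hlow := (hrows (k + 1) (by omega) i le_rfl).1
    have hin : inflow (i + (k + 1)) (l1 + l2) mu r0 r1 r0 i =O[posFilter] invPow (k + 1) := by
      refine inflow_isBigO (row0_isBigO_one hr (by omega)) fun j hj =>
        ⟨(hrows (k + 1) (by omega) j (by omega)).1, (hrows (k + 1) (by omega) j (by omega)).1, ?_⟩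
      have := isBigO_mul_invPow (row0_last_isBigO hr hc hmu hnu)
        (isBigO_shift (hrows (k + 1) (by omega) j (by omega)).2)
      rwa [add_comm 1 (k + 1)] at this
    refine isBigO_of_linear_mul_eq (a := 0) le_rfl hmu
      ((((ih (by omega)).const_mul_left (((i : ℝ) + 1) * nu)).add hin).sub
        (hlow.const_mul_left (l1 + l2 + i * nu))) fun n hn => ?_
    have hb := row0_balance (i := i) hr (by omega) hn
    have hn' : (n : ℝ) ≠ 0 := by exact_mod_cast (by omega : n ≠ 0)
    have e : invPow (k + 1) n * n = invPow k n := by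
      simp only [invPow, pow_succ]; field_simp
    rw [theta0Row0_succ hk, show i + (k + 1) - (k + 1) = i by omega,
      show i + (k + 1) - k = i + 1 by omega, ← e]
    push_cast
    have e2 : mu * (((i : ℝ) + (k + 1) - k) * nu / mu) = ((i : ℝ) + 1) * nu := by
      field_simp; ring
    linear_combination hb - n * theta0Row0 (i + (k + 1)) l1 l2 mu nu k * invPow (k + 1) n * e2

end System

end RateMatrix

/-- Improved expansion (Lemma 3.2, row 0):
`r_{c−k}^{(0,n)} = θ_0^{(0,k)}/n^k + O(1/n^{k+1})`, i.e. the sequence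
`n^{k+1}·(r_{c−k}^{(0,n)} − θ_0^{(0,k)}/n^k)` is bounded in `n`. -/
theorem rate_matrix_bigO_expansion_row0
    (c : ℕ) (hc : 2 ≤ c)
    (l1 l2 mu nu : ℝ) (hl1 : 0 < l1) (hl2 : 0 < l2) (hmu : 0 < mu) (hnu : 0 < nu)
    (r0 r1 : ℕ → ℕ → ℝ) (hr : IsRMS c l1 l2 mu nu r0 r1) :
    ∀ k : ℕ, k ≤ c →
      ∃ C : ℝ, ∀ n : ℕ, 1 ≤ n →
        |(n : ℝ) ^ (k + 1) *
          (r0 n (c - k) - theta0Row0 c l1 l2 mu nu k / (n : ℝ) ^ k)| ≤ C := by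
  intro k hk
  have h : (fun n => r0 n (c - k) - theta0Row0 c l1 l2 mu nu k * RateMatrix.invPow k n)
      =O[RateMatrix.posFilter] RateMatrix.invPow (k + 1) := by
    rcases Nat.eq_zero_or_pos k with rfl | hk0
    · simpa [theta0Row0] using RateMatrix.row0_last_isBigO hr hc hmu hnu
    · exact RateMatrix.row0_sub_theta_isBigO hr hc hl1 hl2 hmu hnu hk0 hk
  obtain ⟨C, hC⟩ := RateMatrix.isBigO_posFilter.1 h
  refine ⟨C, fun n hn => ?_⟩
  have hn' : (0 : ℝ) < n := by exact_mod_cast hn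
  have := hC n hn
  rw [abs_of_nonneg (RateMatrix.invPow_nonneg _ _), RateMatrix.invPow, RateMatrix.invPow, inv_pow,
    inv_pow, ← div_eq_mul_inv, ← div_eq_mul_inv, le_div_iff₀ (by positivity)] at this
  rwa [abs_mul, abs_of_nonneg (by positivity : (0 : ℝ) ≤ (n : ℝ) ^ (k + 1)), mul_comm]
end

section
/- Let (r_i^{(0,n)}, r_i^{(1,n)}) be a rate-matrix system with parameters c, λ₁, λ₂, μ, ν and λ = λ₁ + λ₂. Then for every k = 0, 1, …, c, the sequence n^{k+1}·(r_{c−k}^{(1,n)} − θ_0^{(1,k)}/n^k) is bounded in n; equivalently, r_{c−k}^{(1,n)} = θ_0^{(1,k)}/n^k + O(1/n^{k+1}) as n → ∞. -/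
/-- `f n = O(1 / n ^ p)`, uniformly over `n ≥ 1`. -/
def IsInvPowBounded (p : ℕ) (f : ℕ → ℝ) : Prop :=
  ∃ C : ℝ, ∀ n : ℕ, 1 ≤ n → |(n : ℝ) ^ p * f n| ≤ C

namespace IsInvPowBounded

variable {p q : ℕ} {f g : ℕ → ℝ}

theorem congr (hf : IsInvPowBounded p f) (h : ∀ n, 1 ≤ n → g n = f n) :
    IsInvPowBounded p g := by
  obtain ⟨C, hC⟩ := hf
  exact ⟨C, fun n hn => by rw [h n hn]; exact hC n hn⟩

theorem of_nonneg_of_le (hf : IsInvPowBounded p f) (h0 : ∀ n, 1 ≤ n → 0 ≤ g n)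
    (h : ∀ n, 1 ≤ n → g n ≤ f n) : IsInvPowBounded p g := by
  obtain ⟨C, hC⟩ := hf
  refine ⟨C, fun n hn => le_trans ?_ (hC n hn)⟩
  rw [abs_mul, abs_mul]
  have h1 : |g n| ≤ |f n| := abs_le_abs_of_nonneg (h0 n hn) (h n hn)
  gcongr

theorem const (a : ℝ) : IsInvPowBounded 0 fun _ => a :=
  ⟨|a|, fun n _ => by simp⟩

theorem zero (p : ℕ) : IsInvPowBounded p fun _ => 0 :=
  ⟨0, fun n _ => by simp⟩

theorem add (hf : IsInvPowBounded p f) (hg : IsInvPowBounded p g) :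
    IsInvPowBounded p fun n => f n + g n := by
  obtain ⟨C, hC⟩ := hf
  obtain ⟨D, hD⟩ := hg
  refine ⟨C + D, fun n hn => ?_⟩
  rw [mul_add]
  exact (abs_add_le _ _).trans (add_le_add (hC n hn) (hD n hn))

theorem mul (hf : IsInvPowBounded p f) (hg : IsInvPowBounded q g) :
    IsInvPowBounded (p + q) fun n => f n * g n := by
  obtain ⟨C, hC⟩ := hf
  obtain ⟨D, hD⟩ := hg
  refine ⟨C * D, fun n hn => ?_⟩
  have h : (n : ℝ) ^ (p + q) * (f n * g n) = ((n : ℝ) ^ p * f n) * ((n : ℝ) ^ q * g n) := by ring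
  rw [h, abs_mul]
  exact mul_le_mul (hC n hn) (hD n hn) (abs_nonneg _) ((abs_nonneg _).trans (hC n hn))

theorem const_mul (a : ℝ) (hf : IsInvPowBounded p f) : IsInvPowBounded p fun n => a * f n := by
  simpa using (const a).mul hf

theorem sub (hf : IsInvPowBounded p f) (hg : IsInvPowBounded p g) :
    IsInvPowBounded p fun n => f n - g n :=
  (hf.add (hg.const_mul (-1))).congr fun n _ => by ring

theorem sum {ι : Type*} {F : ι → ℕ → ℝ} (s : Finset ι) (h : ∀ i ∈ s, IsInvPowBounded p (F i)) :
    IsInvPowBounded p fun n => ∑ i ∈ s, F i n := by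
  classical
  induction s using Finset.induction_on with
  | empty => simpa using zero p
  | insert a s ha ih =>
    simp only [Finset.sum_insert ha]
    exact (h a (by simp)).add (ih fun i hi => h i (by simp [hi]))

theorem mono (hf : IsInvPowBounded p f) (hqp : q ≤ p) : IsInvPowBounded q f := by
  obtain ⟨C, hC⟩ := hf
  refine ⟨C, fun n hn => le_trans ?_ (hC n hn)⟩
  have h1 : (1 : ℝ) ≤ n := by exact_mod_cast hn
  rw [abs_mul, abs_mul, abs_of_nonneg (by positivity : (0 : ℝ) ≤ (n : ℝ) ^ q),
    abs_of_nonneg (by positivity : (0 : ℝ) ≤ (n : ℝ) ^ p)]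
  gcongr

theorem comp_succ (hf : IsInvPowBounded p f) : IsInvPowBounded p fun n => f (n + 1) := by
  obtain ⟨C, hC⟩ := hf
  refine ⟨C, fun n _ => le_trans ?_ (hC (n + 1) (by omega))⟩
  rw [abs_mul, abs_mul, abs_of_nonneg (by positivity : (0 : ℝ) ≤ (n : ℝ) ^ p),
    abs_of_nonneg (by positivity : (0 : ℝ) ≤ ((n + 1 : ℕ) : ℝ) ^ p)]
  gcongr
  omega

theorem natCast_mul (hf : IsInvPowBounded (p + 1) f) :
    IsInvPowBounded p fun n => (n : ℝ) * f n := by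
  obtain ⟨C, hC⟩ := hf
  refine ⟨C, fun n hn => ?_⟩
  rw [← mul_assoc, ← pow_succ]
  exact hC n hn

theorem natCast_add_one_mul (hf : IsInvPowBounded (p + 1) f) :
    IsInvPowBounded p fun n => ((n : ℝ) + 1) * f n :=
  (hf.natCast_mul.add (hf.mono (Nat.le_succ p))).congr fun n _ => by ring

theorem of_natCast_mul {a : ℝ} (ha : a ≠ 0) (hf : IsInvPowBounded p fun n => (n : ℝ) * a * f n) :
    IsInvPowBounded (p + 1) f := by
  obtain ⟨C, hC⟩ := hf.const_mul a⁻¹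
  refine ⟨C, fun n hn => ?_⟩
  convert hC n hn using 2
  field_simp
  ring

theorem of_const_mul {a : ℝ} (ha : a ≠ 0) (hf : IsInvPowBounded p fun n => a * f n) :
    IsInvPowBounded p f :=
  (hf.const_mul a⁻¹).congr fun n _ => by field_simp

end IsInvPowBounded

open IsInvPowBounded in
/-- The balance equation at a state `i ≥ 1` determines `n μ xᵢ` up to the contribution of
`xᵢ₊₁`, the remaining terms being of the order of `xᵢ` or smaller. -/
theorem isInvPowBounded_balance_residual {p s t c i : ℕ} {lam mu nu : ℝ}
    {x r0 r1 : ℕ → ℕ → ℝ} (hst : s + t = p + 1)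
    (heq : ∀ n, 1 ≤ n → lam * x n (i - 1)
        - (lam + (i : ℝ) * nu + (n : ℝ) * mu) * x n i
        + ((i : ℝ) + 1) * nu * x n (i + 1)
        + ((n : ℝ) + 1) * mu *
            (x n (c - 1) * r0 (n + 1) (i - 1) + x n c * r1 (n + 1) (i - 1)) = 0)
    (hx : IsInvPowBounded p fun n => x n i) (hx' : IsInvPowBounded p fun n => x n (i - 1))
    (hxc' : IsInvPowBounded 1 fun n => x n (c - 1)) (hxc : IsInvPowBounded s fun n => x n c)
    (h0 : IsInvPowBounded p fun n => r0 n (i - 1))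
    (h1 : IsInvPowBounded t fun n => r1 n (i - 1)) :
    IsInvPowBounded p fun n => (n : ℝ) * mu * x n i - ((i : ℝ) + 1) * nu * x n (i + 1) := by
  have ha := (hxc'.mul h0.comp_succ).mono (by omega : p + 1 ≤ 1 + p)
  have hb := (hxc.mul h1.comp_succ).mono hst.ge
  have hc := ((ha.add hb).natCast_add_one_mul).const_mul mu
  refine (((hx'.const_mul lam).sub (hx.const_mul (lam + i * nu))).add hc).congr fun n hn => ?_
  linear_combination -heq n hn

/-- Each entry `i < c` of a nonnegative row with sum `d / (n μ)` is at most `d / (n μ)`. -/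
theorem le_of_row_sum {c i n : ℕ} {d mu : ℝ} {x : ℕ → ℕ → ℝ} (h0 : ∀ n i, 0 ≤ x n i)
    (hsum : ∑ j ∈ Finset.range c, x n j = d / ((n : ℝ) * mu)) (hi : i < c) :
    x n i ≤ d / ((n : ℝ) * mu) :=
  hsum ▸ Finset.single_le_sum (f := fun j => x n j) (fun j _ => h0 n j) (Finset.mem_range.2 hi)

open IsInvPowBounded in
theorem isInvPowBounded_one_of_row_sum {c i : ℕ} {d mu : ℝ} (hmu : 0 < mu) {x : ℕ → ℕ → ℝ}
    (h0 : ∀ n i, 0 ≤ x n i)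
    (hsum : ∀ n, 1 ≤ n → ∑ j ∈ Finset.range c, x n j = d / ((n : ℝ) * mu)) (hi : i < c) :
    IsInvPowBounded 1 fun n => x n i := by
  have h : IsInvPowBounded 1 fun n => d / ((n : ℝ) * mu) := by
    refine of_natCast_mul (p := 0) hmu.ne' ((const d).congr fun n hn => ?_)
    have : (n : ℝ) ≠ 0 := by exact_mod_cast (by omega : n ≠ 0)
    field_simp
  exact h.of_nonneg_of_le (fun n _ => h0 n i) fun n hn => le_of_row_sum h0 (hsum n hn) hi

section RateMatrix

variable {c : ℕ} {l1 l2 mu nu : ℝ} {r0 r1 : ℕ → ℕ → ℝ}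

/-- The boundary equation at state `c` bounds the last entry of a row by the preceding one. -/
theorem IsRMS.last_le (hc : 2 ≤ c) (hmu : 0 < mu)
    (hr : IsRMS c l1 l2 mu nu r0 r1) {d : ℝ} {x : ℕ → ℕ → ℝ} (hx : ∀ n i, 0 ≤ x n i)
    {n : ℕ}
    (heq : l1 * x n (c - 1) - ((l1 + l2) + (c : ℝ) * nu) * x n c
        + ((n : ℝ) + 1) * mu *
            (x n (c - 1) * r0 (n + 1) (c - 1) + x n c * r1 (n + 1) (c - 1)) = -d) :
    (c : ℝ) * nu * x n c ≤ d + (l1 + l2) * x n (c - 1) := by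
  obtain ⟨h0, h1, h⟩ := hr
  obtain ⟨-, -, -, -, -, -, -, hs0, hs1⟩ := h (n + 1) (by omega)
  have hpos : 0 < ((n : ℝ) + 1) * mu := by positivity
  have e0 := le_of_row_sum h0 hs0 (by omega : c - 1 < c)
  have e1 := le_of_row_sum h1 hs1 (by omega : c - 1 < c)
  push_cast at e0 e1
  rw [le_div_iff₀ hpos] at e0 e1
  have m0 := mul_le_mul_of_nonneg_left e0 (hx n (c - 1))
  have m1 := mul_le_mul_of_nonneg_left e1 (hx n c)
  linarith

open IsInvPowBounded in
theorem IsRMS.last_bounded (hc : 2 ≤ c) (hmu : 0 < mu) (hnu : 0 < nu)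
    (hr : IsRMS c l1 l2 mu nu r0 r1) :
    IsInvPowBounded 1 (fun n => r0 n c) ∧ IsInvPowBounded 0 (fun n => r1 n c) := by
  have hr' := hr
  obtain ⟨h0, h1, h⟩ := hr'
  have hcnu : (c : ℝ) * nu ≠ 0 := by positivity
  have hb0 : IsInvPowBounded 1 fun n => r0 n (c - 1) :=
    isInvPowBounded_one_of_row_sum hmu h0 (fun n hn => (h n hn).2.2.2.2.2.2.2.1) (by omega)
  have hb1 : IsInvPowBounded 1 fun n => r1 n (c - 1) :=
    isInvPowBounded_one_of_row_sum hmu h1 (fun n hn => (h n hn).2.2.2.2.2.2.2.2) (by omega)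
  constructor
  · refine of_const_mul hcnu ((hb0.const_mul (l1 + l2)).of_nonneg_of_le
      (fun n _ => mul_nonneg (by positivity) (h0 n c)) fun n hn => ?_)
    have := hr.last_le hc hmu (d := 0) h0 (n := n) (by simpa using (h n hn).2.2.2.1)
    linarith
  · refine of_const_mul hcnu (((const (l1 + l2)).add
      ((hb1.mono zero_le_one).const_mul (l1 + l2))).of_nonneg_of_le
      (fun n _ => mul_nonneg (by positivity) (h1 n c)) fun n hn => ?_)
    exact hr.last_le hc hmu h1 (h n hn).2.2.2.2.2.2.1

open IsInvPowBounded in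
/-- Bootstrapped decay: each pass through the balance equations gains one order. -/
theorem IsRMS.isInvPowBounded_min (hc : 2 ≤ c) (hmu : 0 < mu) (hnu : 0 < nu)
    (hr : IsRMS c l1 l2 mu nu r0 r1) (m : ℕ) :
    ∀ i < c, IsInvPowBounded (min (m + 1) (c - i)) (fun n => r0 n i) ∧
      IsInvPowBounded (min (m + 1) (c - i)) (fun n => r1 n i) := by
  obtain ⟨hc0, hc1⟩ := hr.last_bounded hc hmu hnu
  obtain ⟨h0, h1, h⟩ := hr
  have hb0 : ∀ i < c, IsInvPowBounded 1 fun n => r0 n i := fun i hi =>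
    isInvPowBounded_one_of_row_sum hmu h0 (fun n hn => (h n hn).2.2.2.2.2.2.2.1) hi
  have hb1 : ∀ i < c, IsInvPowBounded 1 fun n => r1 n i := fun i hi =>
    isInvPowBounded_one_of_row_sum hmu h1 (fun n hn => (h n hn).2.2.2.2.2.2.2.2) hi
  induction m with
  | zero =>
    exact fun i hi => ⟨(hb0 i hi).mono (by omega), (hb1 i hi).mono (by omega)⟩
  | succ m ih =>
    have hzero : ∀ x : ℕ → ℕ → ℝ,
        (∀ n : ℕ, 1 ≤ n → -((l1 + l2) + (n : ℝ) * mu) * x n 0 + nu * x n 1 = 0) →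
        IsInvPowBounded (min (m + 1) (c - 0)) (fun n => x n 0) →
        IsInvPowBounded (min (m + 1) (c - 1)) (fun n => x n 1) →
        IsInvPowBounded (min (m + 1 + 1) (c - 0)) (fun n => x n 0) := by
      intro x hx hx0 hx1
      refine (of_natCast_mul (p := min (m + 1) (c - 1)) hmu.ne'
        (((hx1.const_mul nu).sub ((hx0.mono (by omega)).const_mul (l1 + l2))).congr
          fun n hn => ?_)).mono (by omega)
      linear_combination -hx n hn
    intro i
    induction i with
    | zero =>
      exact fun hi => ⟨hzero r0 (fun n hn => (h n hn).1) (ih 0 hi).1 (ih 1 (by omega)).1,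
        hzero r1 (fun n hn => (h n hn).2.2.2.2.1) (ih 0 hi).2 (ih 1 (by omega)).2⟩
    | succ i ihi =>
      intro hi
      have hi' : i < c := by omega
      have hstep : min (m + 1 + 1) (c - (i + 1)) ≤ min (m + 1) (c - (i + 1) - 1) + 1 := by omega
      constructor
      · rcases Nat.lt_or_ge (i + 2) c with hlt | hge
        · have hres := isInvPowBounded_balance_residual (p := min (m + 1) (c - (i + 1) - 1))
            (s := 1) (add_comm _ _)
            (fun n hn => (h n hn).2.1 (i + 1) (by omega) (by omega))
            ((ih (i + 1) hi).1.mono (by omega)) ((ih i hi').1.mono (by omega))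
            (hb0 (c - 1) (by omega)) hc0 ((ih i hi').1.mono (by omega))
            ((ih i hi').2.mono (by omega))
          have hnext := ((ih (i + 1 + 1) hlt).1.mono
            (by omega : min (m + 1) (c - (i + 1) - 1) ≤ _)).const_mul ((((i + 1 : ℕ) : ℝ) + 1) * nu)
          exact (of_natCast_mul hmu.ne'
            ((hres.add hnext).congr fun n _ => by ring)).mono hstep
        · exact (hb0 (i + 1) hi).mono (by omega)
      · have hres := isInvPowBounded_balance_residual (p := min (m + 1) (c - (i + 1) - 1))
          (s := 0) (zero_add _)
          (fun n hn => (h n hn).2.2.2.2.2.1 (i + 1) (by omega) (by omega))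
          ((ih (i + 1) hi).2.mono (by omega)) ((ih i hi').2.mono (by omega))
          (hb1 (c - 1) (by omega)) hc1 ((ih i hi').1.mono (by omega))
          ((ihi hi').2.mono (by omega))
        have hnext : IsInvPowBounded (min (m + 1) (c - (i + 1) - 1))
            fun n => r1 n (i + 1 + 1) := by
          rcases Nat.lt_or_ge (i + 2) c with hlt | hge
          · exact (ih (i + 1 + 1) hlt).2.mono (by omega)
          · obtain rfl : i + 1 + 1 = c := by omega
            exact hc1.mono (by omega)
        exact (of_natCast_mul hmu.ne' ((hres.add
          (hnext.const_mul ((((i + 1 : ℕ) : ℝ) + 1) * nu))).congr fun n _ => by ring)).mono hstep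

theorem IsRMS.isInvPowBounded (hc : 2 ≤ c) (hmu : 0 < mu) (hnu : 0 < nu)
    (hr : IsRMS c l1 l2 mu nu r0 r1) {i : ℕ} (hi : i < c) :
    IsInvPowBounded (c - i) (fun n => r0 n i) ∧ IsInvPowBounded (c - i) (fun n => r1 n i) := by
  obtain ⟨ha, hb⟩ := hr.isInvPowBounded_min hc hmu hnu c i hi
  exact ⟨ha.mono (by omega), hb.mono (by omega)⟩

open IsInvPowBounded in
theorem IsRMS.expansion_one (hc : 2 ≤ c) (hmu : 0 < mu) (hnu : 0 < nu)
    (hr : IsRMS c l1 l2 mu nu r0 r1) :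
    IsInvPowBounded 2 fun n => r1 n (c - 1) - (l1 + l2) / mu / (n : ℝ) := by
  have hs : IsInvPowBounded 2 fun n => ∑ i ∈ Finset.range (c - 1), r1 n i :=
    sum (F := fun i n => r1 n i) _ fun i hi => by
      have := Finset.mem_range.1 hi
      exact (hr.isInvPowBounded hc hmu hnu (by omega)).2.mono (by omega)
  refine (hs.const_mul (-1)).congr fun n hn => ?_
  have hsum := (hr.2.2 n hn).2.2.2.2.2.2.2.2
  rw [← Nat.sub_add_cancel (by omega : 1 ≤ c), Finset.sum_range_succ, mul_comm, ← div_div] at hsum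
  linear_combination hsum

open IsInvPowBounded in
theorem IsRMS.expansion_zero (hc : 2 ≤ c) (hmu : 0 < mu) (hnu : 0 < nu)
    (hr : IsRMS c l1 l2 mu nu r0 r1) :
    IsInvPowBounded 1 fun n => r1 n c - (l1 + l2) / ((c : ℝ) * nu) := by
  have hcnu : (c : ℝ) * nu ≠ 0 := by positivity
  have hlast := (hr.last_bounded hc hmu hnu).2
  obtain ⟨ha, hb⟩ := hr.isInvPowBounded hc hmu hnu (by omega : c - 1 < c)
  have ha := ha.mono (by omega : 1 ≤ c - (c - 1))
  have hb := hb.mono (by omega : 1 ≤ c - (c - 1))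
  have hprod := (hb.mul ha.comp_succ).natCast_add_one_mul.const_mul mu
  have hdev := (hlast.mul (hr.expansion_one hc hmu hnu).comp_succ).natCast_add_one_mul.const_mul mu
  refine of_const_mul hcnu (((hb.const_mul l1).add (hprod.add hdev)).congr fun n hn => ?_)
  have heq := (hr.2.2 n hn).2.2.2.2.2.2.1
  have hn1 : (n : ℝ) + 1 ≠ 0 := by positivity
  have e1 : (c : ℝ) * nu * ((l1 + l2) / ((c : ℝ) * nu)) = l1 + l2 := by field_simp
  have e2 : ((n : ℝ) + 1) * mu * ((l1 + l2) / mu / ((n : ℝ) + 1)) = l1 + l2 := by field_simp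
  push_cast
  linear_combination -heq - e1 + r1 n c * e2

end RateMatrix

theorem theta0Row1_succ_mul {c : ℕ} {l1 l2 mu nu : ℝ} (hmu : 0 < mu) (k : ℕ) :
    mu * theta0Row1 c l1 l2 mu nu (k + 2) =
      ((c : ℝ) - ((k + 1 : ℕ) : ℝ)) * nu * theta0Row1 c l1 l2 mu nu (k + 1) := by
  simp only [theta0Row1, Nat.add_eq_zero_iff, OfNat.ofNat_ne_zero, one_ne_zero, and_false, if_false,
    show k + 2 - 1 = k + 1 by omega, Nat.add_sub_cancel]
  rw [Finset.prod_Icc_succ_top (by omega)]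
  generalize ∏ i ∈ Finset.Icc 1 k, ((c : ℝ) - (i : ℝ)) * nu / mu = P
  field_simp

/-- Improved expansion (Lemma 3.2, row 1):
`r_{c−k}^{(1,n)} = θ_0^{(1,k)}/n^k + O(1/n^{k+1})`, i.e. the sequence
`n^{k+1}·(r_{c−k}^{(1,n)} − θ_0^{(1,k)}/n^k)` is bounded in `n`. -/
theorem rate_matrix_bigO_expansion_row1
    (c : ℕ) (hc : 2 ≤ c)
    (l1 l2 mu nu : ℝ) (hl1 : 0 < l1) (hl2 : 0 < l2) (hmu : 0 < mu) (hnu : 0 < nu)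
    (r0 r1 : ℕ → ℕ → ℝ) (hr : IsRMS c l1 l2 mu nu r0 r1) :
    ∀ k : ℕ, k ≤ c →
      ∃ C : ℝ, ∀ n : ℕ, 1 ≤ n →
        |(n : ℝ) ^ (k + 1) *
          (r1 n (c - k) - theta0Row1 c l1 l2 mu nu k / (n : ℝ) ^ k)| ≤ C := by
  intro k
  change k ≤ c → IsInvPowBounded (k + 1)
    fun n => r1 n (c - k) - theta0Row1 c l1 l2 mu nu k / (n : ℝ) ^ k
  induction k with
  | zero => exact fun _ => by simpa [theta0Row1] using hr.expansion_zero hc hmu hnu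
  | succ k ih =>
    intro hk
    rcases k with _ | k
    · simpa [theta0Row1] using hr.expansion_one hc hmu hnu
    have hprev := ih (by omega)
    obtain ⟨i, rfl⟩ : ∃ i, c = i + (k + 2) := ⟨c - (k + 2), by omega⟩
    have hi1 : i + (k + 2) - (k + 1) = i + 1 := by omega
    rw [hi1] at hprev
    rw [show i + (k + 2) - (k + 1 + 1) = i by omega]
    have hxi := (hr.isInvPowBounded hc hmu hnu (by omega : i < i + (k + 2))).2.mono
      (by omega : k + 2 ≤ _)
    have hres : IsInvPowBounded (k + 2) fun n =>
        (n : ℝ) * mu * r1 n i - ((i : ℝ) + 1) * nu * r1 n (i + 1) := by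
      rcases i with _ | i
      · refine (hxi.const_mul (-(l1 + l2))).congr fun n hn => ?_
        have := (hr.2.2 n hn).2.2.2.2.1
        push_cast
        linear_combination -this
      · obtain ⟨hy0, hy1⟩ := hr.isInvPowBounded hc hmu hnu (by omega : i < i + 1 + (k + 2))
        exact isInvPowBounded_balance_residual (s := 0) (t := k + 2 + 1) (zero_add _)
          (fun n hn => (hr.2.2 n hn).2.2.2.2.2.1 (i + 1) (by omega) (by omega))
          hxi (hy1.mono (by omega))
          ((hr.isInvPowBounded hc hmu hnu (by omega)).2.mono (by omega))
          (hr.last_bounded hc hmu hnu).2 (hy0.mono (by omega)) (hy1.mono (by omega))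
    refine IsInvPowBounded.of_natCast_mul hmu.ne'
      ((hres.add (hprev.const_mul (((i : ℝ) + 1) * nu))).congr fun n hn => ?_)
    have hn0 : (n : ℝ) ≠ 0 := by exact_mod_cast (by omega : n ≠ 0)
    have hθ := theta0Row1_succ_mul (c := i + (k + 2)) (l1 := l1) (l2 := l2) (nu := nu) hmu k
    have hcast : (((i + (k + 2) : ℕ) : ℝ) - ((k + 1 : ℕ) : ℝ)) = (i : ℝ) + 1 := by
      push_cast; ring
    rw [hcast] at hθ
    have hpow : (n : ℝ) * mu * (theta0Row1 (i + (k + 2)) l1 l2 mu nu (k + 1 + 1) /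
        (n : ℝ) ^ (k + 1 + 1)) =
        mu * theta0Row1 (i + (k + 2)) l1 l2 mu nu (k + 2) / (n : ℝ) ^ (k + 1) := by
      rw [pow_succ (n : ℝ) (k + 1)]
      field_simp
    rw [mul_sub, hpow, hθ]
    ring
end

section
/- Let (r_i^{(0,n)}, r_i^{(1,n)}) be a rate-matrix system with parameters c, λ₁, λ₂, μ, ν and λ = λ₁ + λ₂. Then there exist real numbers θ_m^{(0,k)} and θ_m^{(1,k)} (m ≥ 0, 0 ≤ k ≤ c), whose m = 0 values are θ_0^{(0,0)} = 0, θ_0^{(0,1)} = λ₂/μ, θ_0^{(0,k)} = (λ₂/μ)∏_{i=1}^{k−1}((c−i)ν/μ) for 2 ≤ k ≤ c, θ_0^{(1,0)} = λ/(cν), θ_0^{(1,1)} = λ/μ, θ_0^{(1,k)} = (λ/μ)∏_{i=1}^{k−1}((c−i)ν/μ) for 2 ≤ k ≤ c, such that for every integer m ≥ 1 and every k = 0, 1, …, c, as n → ∞: r_{c−k}^{(0,n)} = Σ_{i=0}^{m} (−1)^i θ_i^{(0,k)} · n^{−(k+i)} + O(n^{−(k+m+1)}) and r_{c−k}^{(1,n)}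 = Σ_{i=0}^{m} (−1)^i θ_i^{(1,k)} · n^{−(k+i)} + O(n^{−(k+m+1)}); that is, every nonzero entry of the rate matrices admits a full asymptotic Taylor-type expansion in powers of 1/n, to arbitrary order. -/
/-- The algebra of real sequences that agree, up to an error `O(n⁻ᴹ)`, with a polynomial
in `1/n`. -/
def expandable (M : ℕ) : Subalgebra ℝ (ℕ → ℝ) where
  carrier := {f | ∃ p : Polynomial ℝ, ∃ C : ℝ, ∀ n : ℕ, 1 ≤ n →
    |f n - p.eval ((n : ℝ)⁻¹)| ≤ C * ((n : ℝ)⁻¹) ^ M}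
  algebraMap_mem' a := ⟨Polynomial.C a, 0, fun n _ => by simp⟩
  add_mem' := by
    rintro f g ⟨p, C, hp⟩ ⟨q, D, hq⟩
    refine ⟨p + q, C + D, fun n hn => ?_⟩
    have h := abs_add_le (f n - p.eval ((n : ℝ)⁻¹)) (g n - q.eval ((n : ℝ)⁻¹))
    have e : (f + g) n - (p + q).eval ((n : ℝ)⁻¹)
        = (f n - p.eval ((n : ℝ)⁻¹)) + (g n - q.eval ((n : ℝ)⁻¹)) := by
      simp only [Pi.add_apply, Polynomial.eval_add]; ring
    rw [e, add_mul]
    linarith [hp n hn, hq n hn]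
  mul_mem' := by
    rintro f g ⟨p, C, hp⟩ ⟨q, D, hq⟩
    have bound : ∀ p : Polynomial ℝ, ∃ B : ℝ, ∀ n : ℕ, 1 ≤ n → |p.eval ((n : ℝ)⁻¹)| ≤ B := by
      intro p
      obtain ⟨B, hB⟩ := (isCompact_Icc (a := (0 : ℝ)) (b := 1)).exists_bound_of_continuousOn
        p.continuous.continuousOn
      exact ⟨B, fun n hn => hB _ ⟨by positivity, inv_le_one_of_one_le₀ (by exact_mod_cast hn)⟩⟩
    obtain ⟨A, hA⟩ := bound p
    obtain ⟨B, hB⟩ := bound q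
    refine ⟨p * q, C * D + C * B + A * D, fun n hn => ?_⟩
    have hC : 0 ≤ C := by simpa using (abs_nonneg _).trans (hp 1 le_rfl)
    have hD : 0 ≤ D := by simpa using (abs_nonneg _).trans (hq 1 le_rfl)
    have hn1 : ((n : ℝ)⁻¹) ≤ 1 := inv_le_one_of_one_le₀ (by exact_mod_cast hn)
    have hn0 : 0 ≤ ((n : ℝ)⁻¹) := by positivity
    have hε1 : ((n : ℝ)⁻¹) ^ M ≤ 1 := pow_le_one₀ hn0 hn1
    have hε0 : 0 ≤ ((n : ℝ)⁻¹) ^ M := by positivity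
    have h1 := hp n hn
    have h2 := hq n hn
    have h3 := hA n hn
    have h4 := hB n hn
    have e : (f * g) n - (p * q).eval ((n : ℝ)⁻¹)
        = (f n - p.eval ((n : ℝ)⁻¹)) * (g n - q.eval ((n : ℝ)⁻¹))
          + (f n - p.eval ((n : ℝ)⁻¹)) * q.eval ((n : ℝ)⁻¹)
          + p.eval ((n : ℝ)⁻¹) * (g n - q.eval ((n : ℝ)⁻¹)) := by
      simp only [Pi.mul_apply, Polynomial.eval_mul]; ring
    rw [e]
    generalize ((n : ℝ)⁻¹) ^ M = ε at *
    generalize f n - p.eval ((n : ℝ)⁻¹) = x at *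
    generalize g n - q.eval ((n : ℝ)⁻¹) = y at *
    generalize p.eval ((n : ℝ)⁻¹) = z at *
    generalize q.eval ((n : ℝ)⁻¹) = w at *
    have b1 : |x * y| ≤ C * D * ε := by
      rw [abs_mul]
      calc |x| * |y| ≤ (C * ε) * (D * ε) := by gcongr
        _ = C * D * ε * ε := by ring
        _ ≤ C * D * ε * 1 := by gcongr
        _ = C * D * ε := mul_one _
    have b2 : |x * w| ≤ C * B * ε := by
      rw [abs_mul]
      calc |x| * |w| ≤ (C * ε) * B := by gcongr
        _ = C * B * ε := by ring
    have b3 : |z * y| ≤ A * D * ε := by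
      have hA0 : 0 ≤ A := (abs_nonneg _).trans h3
      rw [abs_mul]
      calc |z| * |y| ≤ A * (D * ε) := by gcongr
        _ = A * D * ε := by ring
    calc |x * y + x * w + z * y| ≤ |x * y| + |x * w| + |z * y| := abs_add_three _ _ _
      _ ≤ (C * D + C * B + A * D) * ε := by linarith

namespace expandable

variable {M : ℕ} {f g : ℕ → ℝ}

lemma congr (hf : f ∈ expandable M) (h : ∀ n, 1 ≤ n → g n = f n) : g ∈ expandable M := by
  obtain ⟨p, C, hp⟩ := hf
  exact ⟨p, C, fun n hn => by rw [h n hn]; exact hp n hn⟩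

lemma const_mem (a : ℝ) : (fun _ => a) ∈ expandable M := (expandable M).algebraMap_mem a

lemma of_approx (hg : g ∈ expandable M) (C : ℝ)
    (h : ∀ n : ℕ, 1 ≤ n → |f n - g n| ≤ C * ((n : ℝ)⁻¹) ^ M) : f ∈ expandable M := by
  have : f - g ∈ expandable M := ⟨0, C, fun n hn => by simpa using h n hn⟩
  simpa using (expandable M).add_mem this hg

lemma of_bounded (C : ℝ) (h : ∀ n : ℕ, 1 ≤ n → |f n| ≤ C) : f ∈ expandable 0 :=
  ⟨0, C, fun n hn => by simpa using h n hn⟩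

lemma exists_bound (hf : f ∈ expandable 0) : ∃ C : ℝ, ∀ n : ℕ, 1 ≤ n → |f n| ≤ C := by
  obtain ⟨p, C, hp⟩ := hf
  obtain ⟨B, hB⟩ := (isCompact_Icc (a := (0 : ℝ)) (b := 1)).exists_bound_of_continuousOn
    p.continuous.continuousOn
  refine ⟨C + B, fun n hn => ?_⟩
  have h1 : |p.eval ((n : ℝ)⁻¹)| ≤ B :=
    hB _ ⟨by positivity, inv_le_one_of_one_le₀ (by exact_mod_cast hn)⟩
  have h2 := hp n hn
  have h3 := abs_add_le (f n - p.eval ((n : ℝ)⁻¹)) (p.eval ((n : ℝ)⁻¹))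
  simp only [pow_zero, mul_one] at h2
  simp only [sub_add_cancel] at h3
  linarith

lemma inv_mem : (fun n : ℕ => (n : ℝ)⁻¹) ∈ expandable M :=
  ⟨Polynomial.X, 0, fun n _ => by simp⟩

lemma inv_mul_mem (hf : f ∈ expandable M) :
    (fun n : ℕ => (n : ℝ)⁻¹ * f n) ∈ expandable (M + 1) := by
  obtain ⟨p, C, hp⟩ := hf
  refine ⟨Polynomial.X * p, C, fun n hn => ?_⟩
  have hn0 : 0 ≤ ((n : ℝ)⁻¹) := by positivity
  rw [Polynomial.eval_mul, Polynomial.eval_X, ← mul_sub, abs_mul, abs_of_nonneg hn0]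
  calc (n : ℝ)⁻¹ * |f n - p.eval ((n : ℝ)⁻¹)| ≤ (n : ℝ)⁻¹ * (C * ((n : ℝ)⁻¹) ^ M) := by
        gcongr; exact hp n hn
    _ = C * ((n : ℝ)⁻¹) ^ (M + 1) := by ring

lemma of_mul_self_mem (hf : (fun n : ℕ => (n : ℝ) * f n) ∈ expandable M) :
    f ∈ expandable (M + 1) := by
  refine congr (inv_mul_mem hf) fun n hn => ?_
  have : (n : ℝ) ≠ 0 := by positivity
  field_simp

lemma of_succ (hf : f ∈ expandable (M + 1)) : f ∈ expandable M := by
  obtain ⟨p, C, hp⟩ := hf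
  have hC : 0 ≤ C := by simpa using (abs_nonneg _).trans (hp 1 le_rfl)
  refine ⟨p, C, fun n hn => (hp n hn).trans ?_⟩
  have hn1 : ((n : ℝ)⁻¹) ≤ 1 := inv_le_one_of_one_le₀ (by exact_mod_cast hn)
  have hn0 : 0 ≤ ((n : ℝ)⁻¹) := by positivity
  gcongr C * ?_
  exact pow_le_pow_of_le_one hn0 hn1 (Nat.le_succ M)

lemma inv_add_one_mem : (fun n : ℕ => ((n : ℝ) + 1)⁻¹) ∈ expandable M := by
  induction M with
  | zero =>
    refine of_bounded 1 fun n _ => ?_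
    rw [abs_of_nonneg (by positivity)]
    exact inv_le_one_of_one_le₀ (by linarith [(Nat.cast_nonneg n : (0 : ℝ) ≤ n)])
  | succ M ih =>
    refine congr (inv_mul_mem ((expandable M).sub_mem (const_mem 1) ih)) fun n hn => ?_
    have : (n : ℝ) ≠ 0 := by positivity
    simp only [Pi.sub_apply]
    field_simp
    ring

lemma ratio_mem : (fun n : ℕ => (n : ℝ) / ((n : ℝ) + 1)) ∈ expandable M := by
  refine congr ((expandable M).sub_mem (const_mem 1) inv_add_one_mem) fun n _ => ?_
  simp only [Pi.sub_apply]
  field_simp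
  ring

lemma shift_mem (hf : f ∈ expandable M) : (fun n => f (n + 1)) ∈ expandable M := by
  obtain ⟨p, C, hp⟩ := hf
  have hC : 0 ≤ C := by simpa using (abs_nonneg _).trans (hp 1 le_rfl)
  have h1 : (fun n : ℕ => p.eval (((n : ℝ) + 1)⁻¹)) ∈ expandable M := by
    have := Polynomial.aeval_mem_adjoin_singleton ℝ (p := p) (fun n : ℕ => ((n : ℝ) + 1)⁻¹)
    have h2 := (Algebra.adjoin_le (Set.singleton_subset_iff.2 (inv_add_one_mem (M := M)))) this
    refine congr h2 fun n _ => ?_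
    simp
  refine of_approx h1 C fun n hn => ?_
  have h := hp (n + 1) (by omega)
  push_cast at h
  refine h.trans ?_
  have : (0 : ℝ) < n := by exact_mod_cast hn
  gcongr
  linarith

lemma tendsto_zero (hf : (fun n : ℕ => (n : ℝ) * f n) ∈ expandable 0) :
    Filter.Tendsto f Filter.atTop (nhds 0) := by
  obtain ⟨C, hC⟩ := exists_bound hf
  refine squeeze_zero_norm' ?_ (tendsto_const_div_atTop_nhds_zero_nat C)
  filter_upwards [Filter.eventually_ge_atTop 1] with n hn
  have h0 : (0 : ℝ) < n := by exact_mod_cast hn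
  rw [Real.norm_eq_abs, le_div_iff₀ h0]
  have := hC n hn
  rw [abs_mul, abs_of_pos h0] at this
  linarith

/-- A sequence expandable to every order converges, and subtracting its limit and multiplying
by `n` gives again a sequence expandable to every order. -/
lemma tendsto_and_mul_sub_mem (hf : ∀ M, f ∈ expandable M) :
    ∃ L : ℝ, Filter.Tendsto f Filter.atTop (nhds L) ∧
      ∀ M, (fun n : ℕ => (n : ℝ) * (f n - L)) ∈ expandable M := by
  have key : ∀ M, ∃ L : ℝ, (fun n : ℕ => (n : ℝ) * (f n - L)) ∈ expandable M := by
    intro M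
    obtain ⟨p, C, hp⟩ := hf (M + 1)
    refine ⟨p.coeff 0, p.divX, C, fun n hn => ?_⟩
    have hn0 : (0 : ℝ) < n := by exact_mod_cast hn
    have h := hp n hn
    have e : p.eval ((n : ℝ)⁻¹) = p.divX.eval ((n : ℝ)⁻¹) * (n : ℝ)⁻¹ + p.coeff 0 := by
      conv_lhs => rw [← Polynomial.divX_mul_X_add p]
      simp
    have e2 : (n : ℝ) * (f n - p.coeff 0) - p.divX.eval ((n : ℝ)⁻¹)
        = n * (f n - p.eval ((n : ℝ)⁻¹)) := by
      rw [e]; field_simp; ring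
    rw [e2, abs_mul, abs_of_pos hn0]
    calc (n : ℝ) * |f n - p.eval ((n : ℝ)⁻¹)| ≤ n * (C * ((n : ℝ)⁻¹) ^ (M + 1)) := by gcongr
      _ = C * ((n : ℝ)⁻¹) ^ M := by rw [pow_succ]; field_simp
  have lim : ∀ M (L : ℝ), (fun n : ℕ => (n : ℝ) * (f n - L)) ∈ expandable M →
      Filter.Tendsto f Filter.atTop (nhds L) := by
    intro M L h
    have h0 : (fun n : ℕ => (n : ℝ) * (f n - L)) ∈ expandable 0 := by
      induction M with
      | zero => exact h
      | succ M ih => exact ih (of_succ h)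
    simpa using (tendsto_zero h0).add_const L
  obtain ⟨L, hL⟩ := key 0
  refine ⟨L, lim 0 L hL, fun M => ?_⟩
  obtain ⟨L', hL'⟩ := key M
  rwa [tendsto_nhds_unique (lim 0 L hL) (lim M L' hL')]

/-- A sequence expandable to every order has one asymptotic series in `1/n`, whose constant
term is its limit. -/
lemma exists_series (hf : ∀ M, f ∈ expandable M) :
    ∃ a : ℕ → ℝ, Filter.Tendsto f Filter.atTop (nhds (a 0)) ∧
      ∀ m, ∃ C : ℝ, ∀ n : ℕ, 1 ≤ n →
        |f n - ∑ i ∈ Finset.range m, a i / (n : ℝ) ^ i| ≤ C / (n : ℝ) ^ m := by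
  let T := {f : ℕ → ℝ // ∀ M, f ∈ expandable M}
  choose L hL hstep using fun f : T => tendsto_and_mul_sub_mem f.2
  let G : ℕ → T := fun j => Nat.rec ⟨f, hf⟩ (fun _ g => ⟨_, hstep g⟩) j
  have hG : ∀ j n, (G (j + 1)).1 n = (n : ℝ) * ((G j).1 n - L (G j)) := fun _ _ => rfl
  refine ⟨fun j => L (G j), hL (G 0), fun m => ?_⟩
  have e : ∀ n : ℕ, 1 ≤ n →
      f n - ∑ i ∈ Finset.range m, L (G i) / (n : ℝ) ^ i = (G m).1 n / (n : ℝ) ^ m := by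
    intro n hn
    have h0 : (n : ℝ) ≠ 0 := by positivity
    induction m with
    | zero => simp [G]
    | succ m ih =>
      rw [Finset.sum_range_succ, ← sub_sub, ih, hG]
      field_simp
      ring
  obtain ⟨C, hC⟩ := exists_bound ((G m).2 0)
  refine ⟨C, fun n hn => ?_⟩
  rw [e n hn, abs_div, abs_of_nonneg (by positivity : (0 : ℝ) ≤ (n : ℝ) ^ m)]
  gcongr
  exact hC n hn

end expandable

/-- The equations satisfied by one row `x` of the rate matrices, with the equation at level `c`
rewritten by means of the row sums of `r0` and `r1`; `s` is the total of the row sum and `t` the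
source term at level `c`. -/
structure IsRateRow (c : ℕ) (l mu nu : ℝ) (r0 r1 : ℕ → ℕ → ℝ) (s t : ℝ)
    (x : ℕ → ℕ → ℝ) : Prop where
  nonneg : ∀ n i, 0 ≤ x n i
  zero : ∀ n : ℕ, 1 ≤ n → -(l + (n : ℝ) * mu) * x n 0 + nu * x n 1 = 0
  mid : ∀ n : ℕ, 1 ≤ n → ∀ i : ℕ, i + 3 ≤ c →
    l * x n i - (l + ((i : ℝ) + 1) * nu + (n : ℝ) * mu) * x n (i + 1)
      + ((i : ℝ) + 2) * nu * x n (i + 2)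
      + ((n : ℝ) + 1) * mu * (x n (c - 1) * r0 (n + 1) i + x n c * r1 (n + 1) i) = 0
  sum : ∀ n : ℕ, 1 ≤ n → ∑ i ∈ Finset.range (c - 1), x n i + x n (c - 1) = s / ((n : ℝ) * mu)
  last : ∀ n : ℕ, 1 ≤ n → (c : ℝ) * nu * x n c = l * x n (c - 1) + t
      - ((n : ℝ) + 1) * mu * (x n (c - 1) * ∑ i ∈ Finset.range (c - 1), r0 (n + 1) i
        + x n c * ∑ i ∈ Finset.range (c - 1), r1 (n + 1) i)

section

variable {c : ℕ} {l1 l2 mu nu : ℝ} {r0 r1 : ℕ → ℕ → ℝ}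

lemma IsRMS.isRateRow (hc : 2 ≤ c) (hmu : 0 < mu) (hr : IsRMS c l1 l2 mu nu r0 r1) :
    IsRateRow c (l1 + l2) mu nu r0 r1 l2 0 r0 ∧
      IsRateRow c (l1 + l2) mu nu r0 r1 (l1 + l2) (l1 + l2) r1 := by
  obtain ⟨p0, p1, h⟩ := hr
  have split : ∀ x : ℕ → ℝ, ∑ i ∈ Finset.range c, x i
      = ∑ i ∈ Finset.range (c - 1), x i + x (c - 1) := by
    intro x
    conv_lhs => rw [show c = c - 1 + 1 by omega]
    rw [Finset.sum_range_succ]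
  have tot0 : ∀ n : ℕ, ((n : ℝ) + 1) * mu * r0 (n + 1) (c - 1)
      = l2 - ((n : ℝ) + 1) * mu * ∑ i ∈ Finset.range (c - 1), r0 (n + 1) i := by
    intro n
    obtain ⟨-, -, -, -, -, -, -, h8, -⟩ := h (n + 1) (by omega)
    rw [split] at h8
    push_cast at h8
    have h0 : ((n : ℝ) + 1) * mu ≠ 0 := by positivity
    field_simp at h8
    linarith
  have tot1 : ∀ n : ℕ, ((n : ℝ) + 1) * mu * r1 (n + 1) (c - 1)
      = (l1 + l2) - ((n : ℝ) + 1) * mu * ∑ i ∈ Finset.range (c - 1), r1 (n + 1) i := by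
    intro n
    obtain ⟨-, -, -, -, -, -, -, -, h9⟩ := h (n + 1) (by omega)
    rw [split] at h9
    push_cast at h9
    have h0 : ((n : ℝ) + 1) * mu ≠ 0 := by positivity
    field_simp at h9
    linarith
  constructor
  · refine ⟨p0, fun n hn => (h n hn).1, fun n hn i hi => ?_, fun n hn => ?_, fun n hn => ?_⟩
    · have := (h n hn).2.1 (i + 1) (by omega) (by omega)
      simp only [Nat.add_sub_cancel] at this
      push_cast at this
      linear_combination this
    · rw [← split]; exact (h n hn).2.2.2.2.2.2.2.1
    · have := (h n hn).2.2.2.1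
      linear_combination -this + r0 n (c - 1) * tot0 n + r0 n c * tot1 n
  · refine ⟨p1, fun n hn => (h n hn).2.2.2.2.1, fun n hn i hi => ?_, fun n hn => ?_,
      fun n hn => ?_⟩
    · have := (h n hn).2.2.2.2.2.1 (i + 1) (by omega) (by omega)
      simp only [Nat.add_sub_cancel] at this
      push_cast at this
      linear_combination this
    · rw [← split]; exact (h n hn).2.2.2.2.2.2.2.2
    · have := (h n hn).2.2.2.2.2.2.1
      linear_combination -this + r1 n (c - 1) * tot0 n + r1 n c * tot1 n

end

namespace IsRateRow

variable {c : ℕ} {l mu nu s t : ℝ} {r0 r1 x : ℕ → ℕ → ℝ}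

lemma le_sum (hc : 2 ≤ c) (hx : IsRateRow c l mu nu r0 r1 s t x) {n i : ℕ} (hn : 1 ≤ n)
    (hi : i < c) : x n i ≤ s / ((n : ℝ) * mu) := by
  rw [← hx.sum n hn]
  rcases eq_or_ne i (c - 1) with rfl | hne
  · have := Finset.sum_nonneg fun i (_ : i ∈ Finset.range (c - 1)) => hx.nonneg n i
    linarith
  · have := Finset.single_le_sum (fun i _ => hx.nonneg n i)
      (Finset.mem_range.2 (show i < c - 1 by omega))
    linarith [hx.nonneg n (c - 1)]

lemma mul_mem_zero (hc : 2 ≤ c) (hmu : 0 < mu) (hx : IsRateRow c l mu nu r0 r1 s t x) {i : ℕ}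
    (hi : i < c) : (fun n : ℕ => (n : ℝ) * x n i) ∈ expandable 0 := by
  refine expandable.of_bounded (s / mu) fun n hn => ?_
  have h0 : (0 : ℝ) < n := by exact_mod_cast hn
  rw [abs_of_nonneg (mul_nonneg h0.le (hx.nonneg n i))]
  calc (n : ℝ) * x n i ≤ n * (s / ((n : ℝ) * mu)) := by
        gcongr; exact hx.le_sum hc hn hi
    _ = s / mu := by field_simp

lemma mem_zero (hc : 2 ≤ c) (hl : 0 ≤ l) (hmu : 0 < mu) (hnu : 0 < nu)
    (hr0 : ∀ n i, 0 ≤ r0 n i) (hr1 : ∀ n i, 0 ≤ r1 n i)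
    (hx : IsRateRow c l mu nu r0 r1 s t x) {i : ℕ} (hi : i ≤ c) :
    (fun n : ℕ => x n i) ∈ expandable 0 := by
  rcases hi.lt_or_eq with hi | rfl
  · exact expandable.of_succ (expandable.of_mul_self_mem (hx.mul_mem_zero hc hmu hi))
  · have hlow : (fun n : ℕ => x n (i - 1)) ∈ expandable 0 :=
      expandable.of_succ (expandable.of_mul_self_mem (hx.mul_mem_zero hc hmu (by omega)))
    obtain ⟨C, hC⟩ := expandable.exists_bound hlow
    refine expandable.of_bounded ((l * C + t) / (i * nu)) fun n hn => ?_
    have hi0 : (0 : ℝ) < i := by exact_mod_cast (by omega : 0 < i)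
    rw [abs_of_nonneg (hx.nonneg n i), le_div_iff₀ (by positivity)]
    have h1 := hx.last n hn
    have h2 : 0 ≤ x n (i - 1) * ∑ j ∈ Finset.range (i - 1), r0 (n + 1) j :=
      mul_nonneg (hx.nonneg _ _) (Finset.sum_nonneg fun _ _ => hr0 _ _)
    have h3 : 0 ≤ x n i * ∑ j ∈ Finset.range (i - 1), r1 (n + 1) j :=
      mul_nonneg (hx.nonneg _ _) (Finset.sum_nonneg fun _ _ => hr1 _ _)
    have h4 : 0 ≤ ((n : ℝ) + 1) * mu := by positivity
    have h5 := mul_nonneg h4 (add_nonneg h2 h3)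
    have h6 : l * x n (i - 1) ≤ l * C := by
      gcongr; exact (le_abs_self _).trans (hC n hn)
    linarith

/-- The induction step, from `j` to `j + 1`, for the bounds `x_i = O(n^{-j})`, `i + j ≤ c`. -/
lemma pow_succ_mul_mem_zero (hmu : 0 < mu) (hx : IsRateRow c l mu nu r0 r1 s t x) {j : ℕ}
    (ha : (fun n : ℕ => x n (c - 1)) ∈ expandable 0) (hb : (fun n : ℕ => x n c) ∈ expandable 0)
    (hj : ∀ i, i + j ≤ c → (fun n : ℕ => (n : ℝ) ^ j * x n i) ∈ expandable 0) {i : ℕ}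
    (hi : i + (j + 1) ≤ c) (hj1 : 1 ≤ j)
    (h0 : ∀ k, i = k + 1 → (fun n : ℕ => (n : ℝ) ^ (j + 1) * r0 n k) ∈ expandable 0)
    (h1 : ∀ k, i = k + 1 → (fun n : ℕ => (n : ℝ) ^ (j + 1) * r1 n k) ∈ expandable 0) :
    (fun n : ℕ => (n : ℝ) ^ (j + 1) * x n i) ∈ expandable 0 := by
  set E := expandable 0
  rcases i with _ | k
  · refine expandable.congr (E.sub_mem (E.smul_mem (hj 1 (by omega)) (nu / mu))
      (E.smul_mem (hj 0 (by omega)) (l / mu))) fun n hn => ?_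
    simp only [Pi.sub_apply, Pi.smul_apply, smul_eq_mul]
    field_simp
    linear_combination -(n : ℝ) ^ j * hx.zero n hn
  · have e := E.add_mem (E.sub_mem (E.add_mem
      (E.smul_mem (hj (k + 2) (by omega)) (((k : ℝ) + 2) * nu / mu))
      (E.smul_mem (hj k (by omega)) (l / mu)))
      (E.smul_mem (hj (k + 1) (by omega)) ((l + ((k : ℝ) + 1) * nu) / mu)))
      (E.mul_mem (E.pow_mem expandable.ratio_mem j)
        (E.add_mem (E.mul_mem ha (expandable.shift_mem (h0 k rfl)))
          (E.mul_mem hb (expandable.shift_mem (h1 k rfl)))))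
    refine expandable.congr e fun n hn => ?_
    simp only [Pi.sub_apply, Pi.add_apply, Pi.mul_apply, Pi.pow_apply, Pi.smul_apply, smul_eq_mul]
    push_cast
    rw [div_pow]
    field_simp
    linear_combination -(n : ℝ) ^ j * ((n : ℝ) + 1) ^ j * hx.mid n hn k (by omega)

end IsRateRow

section

variable {c : ℕ} {l mu nu s0 t0 s1 t1 : ℝ} {r0 r1 : ℕ → ℕ → ℝ}

/-- Both rows satisfy `x_{c-j} = O(n^{-j})`. -/
lemma rate_rows_pow_mul_mem_zero (hc : 2 ≤ c) (hl : 0 ≤ l) (hmu : 0 < mu) (hnu : 0 < nu)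
    (h0 : IsRateRow c l mu nu r0 r1 s0 t0 r0) (h1 : IsRateRow c l mu nu r0 r1 s1 t1 r1) (j : ℕ) :
    ∀ i, i + j ≤ c → (fun n : ℕ => (n : ℝ) ^ j * r0 n i) ∈ expandable 0 ∧
      (fun n : ℕ => (n : ℝ) ^ j * r1 n i) ∈ expandable 0 := by
  have m0 := fun i hi => h0.mem_zero hc hl hmu hnu h0.nonneg h1.nonneg (i := i) hi
  have m1 := fun i hi => h1.mem_zero hc hl hmu hnu h0.nonneg h1.nonneg (i := i) hi
  induction j with
  | zero => intro i hi; simpa using ⟨m0 i hi, m1 i hi⟩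
  | succ j ih =>
    rcases Nat.eq_zero_or_pos j with rfl | hj
    · intro i hi
      simpa using ⟨h0.mul_mem_zero hc hmu (by omega : i < c), h1.mul_mem_zero hc hmu (by omega)⟩
    · intro i hi
      induction i with
      | zero =>
        exact ⟨h0.pow_succ_mul_mem_zero hmu (m0 _ (by omega)) (m0 _ le_rfl)
            (fun i hi => (ih i hi).1) hi hj (by simp) (by simp),
          h1.pow_succ_mul_mem_zero hmu (m1 _ (by omega)) (m1 _ le_rfl)
            (fun i hi => (ih i hi).2) hi hj (by simp) (by simp)⟩
      | succ k ihk =>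
        obtain ⟨k0, k1⟩ := ihk (by omega)
        refine ⟨h0.pow_succ_mul_mem_zero hmu (m0 _ (by omega)) (m0 _ le_rfl)
            (fun i hi => (ih i hi).1) hi hj ?_ ?_,
          h1.pow_succ_mul_mem_zero hmu (m1 _ (by omega)) (m1 _ le_rfl)
            (fun i hi => (ih i hi).2) hi hj ?_ ?_⟩ <;>
        · rintro _ ⟨⟩; assumption

end

/-- The entry `c - k` of a row, scaled by its order of magnitude `n ^ k`. -/
def scaledEntry (c : ℕ) (x : ℕ → ℕ → ℝ) (k n : ℕ) : ℝ := (n : ℝ) ^ k * x n (c - k)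

lemma sq_mul_sum_mem {c M : ℕ} {x : ℕ → ℕ → ℝ}
    (hM : ∀ k ≤ c, scaledEntry c x k ∈ expandable M) :
    (fun n : ℕ => (n : ℝ) ^ 2 * ∑ i ∈ Finset.range (c - 1), x n i) ∈ expandable M := by
  have h := (expandable M).sum_mem (t := Finset.range (c - 1))
    (f := fun i n => ((n : ℝ)⁻¹) ^ (c - i - 2) * scaledEntry c x (c - i) n) fun i hi =>
      (expandable M).mul_mem ((expandable M).pow_mem expandable.inv_mem _) (hM _ (by omega))
  refine expandable.congr h fun n hn => ?_
  have h0 : (n : ℝ) ≠ 0 := by positivity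
  rw [Finset.sum_apply, Finset.mul_sum]
  refine Finset.sum_congr rfl fun i hi => ?_
  have hi := Finset.mem_range.1 hi
  obtain ⟨d, rfl⟩ : ∃ d, c = i + 2 + d := ⟨c - (i + 2), by omega⟩
  simp only [scaledEntry, show i + 2 + d - i = d + 2 by omega,
    Nat.add_sub_cancel, show i + 2 + d - (d + 2) = i by omega]
  rw [pow_add, inv_pow]
  field_simp

namespace IsRateRow

variable {c M : ℕ} {l mu nu s t : ℝ} {r0 r1 x : ℕ → ℕ → ℝ}

lemma scaledEntry_one_sub_mem (hmu : 0 < mu) (hx : IsRateRow c l mu nu r0 r1 s t x)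
    (hM : ∀ k ≤ c, scaledEntry c x k ∈ expandable M) :
    (fun n : ℕ => (n : ℝ) * (scaledEntry c x 1 n - s / mu)) ∈ expandable M := by
  refine expandable.congr ((expandable M).neg_mem (sq_mul_sum_mem hM)) fun n hn => ?_
  have h := hx.sum n hn
  have h0 : (n : ℝ) ≠ 0 := by positivity
  have e : s / mu = n * (s / ((n : ℝ) * mu)) := by field_simp
  rw [e, ← h]
  simp only [scaledEntry, Pi.neg_apply]
  ring

lemma scaledEntry_zero_sub_mem (hc : 2 ≤ c) (hnu : 0 < nu)
    (hx : IsRateRow c l mu nu r0 r1 s t x)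
    (hM : ∀ k ≤ c, scaledEntry c x k ∈ expandable M)
    (hM0 : ∀ k ≤ c, scaledEntry c r0 k ∈ expandable M)
    (hM1 : ∀ k ≤ c, scaledEntry c r1 k ∈ expandable M) :
    (fun n : ℕ => (n : ℝ) * (scaledEntry c x 0 n - t / ((c : ℝ) * nu))) ∈ expandable M := by
  set E := expandable M
  have hc0 : (0 : ℝ) < c := by exact_mod_cast (by omega : 0 < c)
  have e := E.smul_mem (E.sub_mem (E.smul_mem (hM 1 (by omega)) l)
    (E.smul_mem (E.mul_mem expandable.ratio_mem
      (E.add_mem (E.mul_mem (E.mul_mem expandable.inv_mem (hM 1 (by omega)))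
          (expandable.shift_mem (sq_mul_sum_mem hM0)))
        (E.mul_mem (hM 0 (by omega)) (expandable.shift_mem (sq_mul_sum_mem hM1))))) mu))
    (((c : ℝ) * nu)⁻¹)
  refine expandable.congr e fun n hn => ?_
  have h0 : (n : ℝ) ≠ 0 := by positivity
  simp only [scaledEntry, Pi.sub_apply, Pi.add_apply, Pi.mul_apply, Pi.smul_apply, smul_eq_mul]
  push_cast
  simp only [Nat.sub_zero, pow_zero, pow_one, one_mul]
  field_simp
  linear_combination hx.last n hn

lemma scaledEntry_succ_sub_mem (hmu : 0 < mu)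
    (hx : IsRateRow c l mu nu r0 r1 s t x)
    (hM : ∀ k ≤ c, scaledEntry c x k ∈ expandable M)
    (hM0 : ∀ k ≤ c, scaledEntry c r0 k ∈ expandable M)
    (hM1 : ∀ k ≤ c, scaledEntry c r1 k ∈ expandable M) {k : ℕ} (hk : 1 ≤ k) (hkc : k + 1 ≤ c) :
    (fun n : ℕ => (n : ℝ) * (scaledEntry c x (k + 1) n
      - ((c : ℝ) - k) * nu / mu * scaledEntry c x k n)) ∈ expandable M := by
  set E := expandable M
  rcases hkc.lt_or_eq with hlt | rfl
  · obtain ⟨i, rfl⟩ : ∃ i, c = i + k + 2 := ⟨c - (k + 2), by omega⟩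
    have e := E.add_mem (E.sub_mem
      (E.smul_mem (E.mul_mem expandable.inv_mem (hM (k + 2) (by omega))) (l / mu))
      (E.smul_mem (hM (k + 1) (by omega)) ((l + ((i : ℝ) + 1) * nu) / mu)))
      (E.mul_mem (E.pow_mem expandable.ratio_mem (k + 1))
        (E.add_mem (E.mul_mem (E.mul_mem expandable.inv_mem (hM 1 (by omega)))
            (expandable.shift_mem (hM0 (k + 2) (by omega))))
          (E.mul_mem (hM 0 (by omega)) (expandable.shift_mem (hM1 (k + 2) (by omega))))))
    refine expandable.congr e fun n hn => ?_
    have h0 : (n : ℝ) ≠ 0 := by positivity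
    have h := hx.mid n hn i (by omega)
    rw [show i + k + 2 - 1 = i + k + 1 by omega] at h
    simp only [scaledEntry, Pi.sub_apply, Pi.add_apply, Pi.mul_apply, Pi.pow_apply, Pi.smul_apply,
      smul_eq_mul, show i + k + 2 - (k + 2) = i by omega,
      Nat.sub_zero, show i + k + 2 - (k + 1) = i + 1 by omega, show i + k + 2 - k = i + 2 by omega]
    push_cast
    simp only [pow_zero, pow_one, one_mul]
    rw [show ((n : ℝ) + 1) ^ (k + 2) = ((n : ℝ) + 1) ^ (k + 1) * ((n : ℝ) + 1) by ring, div_pow]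
    field_simp
    linear_combination -(n : ℝ) ^ (k + 2) * h
  · refine expandable.congr (E.smul_mem (hM (k + 1) le_rfl) (-(l / mu))) fun n hn => ?_
    have h := hx.zero n hn
    simp only [scaledEntry, Pi.smul_apply, smul_eq_mul, show k + 1 - (k + 1) = 0 by omega,
      show k + 1 - k = 1 by omega]
    push_cast
    field_simp
    linear_combination -(n : ℝ) ^ (k + 1) * h

lemma scaledEntry_mem_succ (hc : 2 ≤ c) (hmu : 0 < mu) (hnu : 0 < nu)
    (hx : IsRateRow c l mu nu r0 r1 s t x)
    (hM : ∀ k ≤ c, scaledEntry c x k ∈ expandable M)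
    (hM0 : ∀ k ≤ c, scaledEntry c r0 k ∈ expandable M)
    (hM1 : ∀ k ≤ c, scaledEntry c r1 k ∈ expandable M) :
    ∀ k ≤ c, scaledEntry c x k ∈ expandable (M + 1) := by
  have of_sub : ∀ {f g : ℕ → ℝ}, g ∈ expandable (M + 1) →
      (fun n : ℕ => (n : ℝ) * (f n - g n)) ∈ expandable M → f ∈ expandable (M + 1) := by
    intro f g hg h
    have h' : f - g ∈ expandable (M + 1) := expandable.of_mul_self_mem h
    simpa using (expandable (M + 1)).add_mem h' hg
  intro k hk
  rcases Nat.eq_zero_or_pos k with rfl | hk1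
  · exact of_sub (expandable.const_mem _) (hx.scaledEntry_zero_sub_mem hc hnu hM hM0 hM1)
  · induction k, hk1 using Nat.le_induction with
    | base => exact of_sub (expandable.const_mem _) (hx.scaledEntry_one_sub_mem hmu hM)
    | succ k hk1 ih =>
      exact of_sub ((expandable (M + 1)).smul_mem (ih (by omega)) (((c : ℝ) - k) * nu / mu))
        (hx.scaledEntry_succ_sub_mem hmu hM hM0 hM1 hk1 hk)

/-- A row expandable to every order has the asymptotic series and leading coefficients of the
expansion theorem. -/
lemma exists_coeffs (hc : 2 ≤ c) (hmu : 0 < mu) (hnu : 0 < nu)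
    (hx : IsRateRow c l mu nu r0 r1 s t x)
    (hM : ∀ M, ∀ k ≤ c, scaledEntry c x k ∈ expandable M)
    (hM0 : ∀ k ≤ c, scaledEntry c r0 k ∈ expandable 0)
    (hM1 : ∀ k ≤ c, scaledEntry c r1 k ∈ expandable 0) :
    ∃ th : ℕ → ℕ → ℝ,
      th 0 0 = t / ((c : ℝ) * nu) ∧ th 0 1 = s / mu ∧
      (∀ k : ℕ, 2 ≤ k → k ≤ c → th 0 k = (s / mu) *
        ∏ i ∈ Finset.Icc 1 (k - 1), (((c : ℝ) - (i : ℝ)) * nu / mu)) ∧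
      ∀ m : ℕ, 1 ≤ m → ∀ k : ℕ, k ≤ c → ∃ C : ℝ, ∀ n : ℕ, 1 ≤ n →
        |x n (c - k) - ∑ i ∈ Finset.range (m + 1), (-1 : ℝ) ^ i * th i k / (n : ℝ) ^ (k + i)| ≤
          C / (n : ℝ) ^ (k + m + 1) := by
  have hser : ∀ k, ∃ a : ℕ → ℝ, k ≤ c →
      Filter.Tendsto (scaledEntry c x k) Filter.atTop (nhds (a 0)) ∧
      ∀ m, ∃ C : ℝ, ∀ n : ℕ, 1 ≤ n →
        |scaledEntry c x k n - ∑ i ∈ Finset.range m, a i / (n : ℝ) ^ i| ≤ C / (n : ℝ) ^ m := by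
    intro k
    by_cases hk : k ≤ c
    · obtain ⟨a, ha⟩ := expandable.exists_series fun M => hM M k hk
      exact ⟨a, fun _ => ha⟩
    · exact ⟨0, fun h => absurd h hk⟩
  choose a ha using hser
  have lim1 : Filter.Tendsto (scaledEntry c x 1) Filter.atTop (nhds (s / mu)) := by
    simpa using (expandable.tendsto_zero
      (hx.scaledEntry_one_sub_mem hmu (hM 0))).add_const (s / mu)
  have lim0 : Filter.Tendsto (scaledEntry c x 0) Filter.atTop (nhds (t / ((c : ℝ) * nu))) := by
    simpa using (expandable.tendsto_zero
      (hx.scaledEntry_zero_sub_mem hc hnu (hM 0) hM0 hM1)).add_const (t / ((c : ℝ) * nu))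
  have limk : ∀ k, 1 ≤ k → k ≤ c → Filter.Tendsto (scaledEntry c x k) Filter.atTop
      (nhds ((s / mu) * ∏ i ∈ Finset.Icc 1 (k - 1), (((c : ℝ) - (i : ℝ)) * nu / mu))) := by
    intro k hk hkc
    induction k, hk using Nat.le_induction with
    | base => simpa using lim1
    | succ k hk ih =>
      have h := (expandable.tendsto_zero
        (hx.scaledEntry_succ_sub_mem hmu (hM 0) hM0 hM1 hk hkc)).add
        ((ih (by omega)).const_mul (((c : ℝ) - k) * nu / mu))
      obtain ⟨j, rfl⟩ : ∃ j, k = j + 1 := ⟨k - 1, by omega⟩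
      simp only [sub_add_cancel, zero_add, Nat.add_sub_cancel] at h ⊢
      rw [Finset.prod_Icc_succ_top (by omega : 1 ≤ j + 1)]
      convert h using 2
      ring
  refine ⟨fun i k => (-1) ^ i * a k i, ?_, ?_, fun k hk hkc => ?_, fun m _ k hk => ?_⟩
  · simpa using tendsto_nhds_unique (ha 0 (by omega)).1 lim0
  · simpa using tendsto_nhds_unique (ha 1 (by omega)).1 lim1
  · simpa using tendsto_nhds_unique (ha k hkc).1 (limk k (by omega) hkc)
  · obtain ⟨C, hC⟩ := (ha k hk).2 (m + 1)
    refine ⟨C, fun n hn => ?_⟩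
    have h0 : (0 : ℝ) < n := by exact_mod_cast hn
    have e : x n (c - k)
        - ∑ i ∈ Finset.range (m + 1), (-1 : ℝ) ^ i * ((-1) ^ i * a k i) / (n : ℝ) ^ (k + i)
        = (scaledEntry c x k n - ∑ i ∈ Finset.range (m + 1), a k i / (n : ℝ) ^ i)
          / (n : ℝ) ^ k := by
      rw [sub_div, Finset.sum_div, scaledEntry]
      congr 1
      · field_simp
      · refine Finset.sum_congr rfl fun i _ => ?_
        rw [← mul_assoc, ← mul_pow, pow_add]
        norm_num
        field_simp
    rw [e, abs_div, abs_of_pos (pow_pos h0 k), div_le_iff₀ (pow_pos h0 k)]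
    refine (hC n hn).trans (le_of_eq ?_)
    rw [add_assoc, pow_add (n : ℝ) k]
    field_simp

end IsRateRow

/-- Full Taylor-type expansion (Theorem 3.1): there exist coefficients
`θ_m^{(0,k)}` and `θ_m^{(1,k)}` (with the specified `m = 0` values) such that
for every `m ≥ 1` and `0 ≤ k ≤ c`,
`r_{c−k}^{(ℓ,n)} = Σ_{i=0}^{m} (−1)^i θ_i^{(ℓ,k)} n^{−(k+i)} + O(n^{−(k+m+1)})`. -/
theorem rate_matrix_full_taylor_expansion
    (c : ℕ) (hc : 2 ≤ c)
    (l1 l2 mu nu : ℝ) (hl1 : 0 < l1) (hl2 : 0 < l2) (hmu : 0 < mu) (hnu : 0 < nu)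
    (r0 r1 : ℕ → ℕ → ℝ) (hr : IsRMS c l1 l2 mu nu r0 r1) :
    ∃ th0 th1 : ℕ → ℕ → ℝ,
      th0 0 0 = 0 ∧
      th0 0 1 = l2 / mu ∧
      (∀ k : ℕ, 2 ≤ k → k ≤ c →
        th0 0 k = (l2 / mu) *
          ∏ i ∈ Finset.Icc 1 (k - 1), (((c : ℝ) - (i : ℝ)) * nu / mu)) ∧
      th1 0 0 = (l1 + l2) / ((c : ℝ) * nu) ∧
      th1 0 1 = (l1 + l2) / mu ∧
      (∀ k : ℕ, 2 ≤ k → k ≤ c →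
        th1 0 k = ((l1 + l2) / mu) *
          ∏ i ∈ Finset.Icc 1 (k - 1), (((c : ℝ) - (i : ℝ)) * nu / mu)) ∧
      (∀ m : ℕ, 1 ≤ m → ∀ k : ℕ, k ≤ c →
        (∃ C : ℝ, ∀ n : ℕ, 1 ≤ n →
          |r0 n (c - k) -
            ∑ i ∈ Finset.range (m + 1), (-1 : ℝ) ^ i * th0 i k / (n : ℝ) ^ (k + i)| ≤
          C / (n : ℝ) ^ (k + m + 1)) ∧
        (∃ C : ℝ, ∀ n : ℕ, 1 ≤ n →
          |r1 n (c - k) -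
            ∑ i ∈ Finset.range (m + 1), (-1 : ℝ) ^ i * th1 i k / (n : ℝ) ^ (k + i)| ≤
          C / (n : ℝ) ^ (k + m + 1))) := by
  obtain ⟨h0, h1⟩ := hr.isRateRow hc hmu
  have hmem : ∀ M, (∀ k ≤ c, scaledEntry c r0 k ∈ expandable M) ∧
      ∀ k ≤ c, scaledEntry c r1 k ∈ expandable M := by
    intro M
    induction M with
    | zero =>
      have h := rate_rows_pow_mul_mem_zero hc (by positivity) hmu hnu h0 h1
      exact ⟨fun k hk => (h k (c - k) (by omega)).1, fun k hk => (h k (c - k) (by omega)).2⟩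
    | succ M ih =>
      exact ⟨h0.scaledEntry_mem_succ hc hmu hnu ih.1 ih.1 ih.2,
        h1.scaledEntry_mem_succ hc hmu hnu ih.2 ih.1 ih.2⟩
  obtain ⟨th0, a0, a1, a2, a3⟩ :=
    h0.exists_coeffs hc hmu hnu (fun M => (hmem M).1) (hmem 0).1 (hmem 0).2
  obtain ⟨th1, b0, b1, b2, b3⟩ :=
    h1.exists_coeffs hc hmu hnu (fun M => (hmem M).2) (hmem 0).1 (hmem 0).2
  exact ⟨th0, th1, by simpa using a0, a1, a2, b0, b1, b2,
    fun m hm k hk => ⟨a3 m hm k hk, b3 m hm k hk⟩⟩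
end

section
/- Let ρ ∈ (0,1), a > 0 and b ∈ ℝ with b ≠ am − m² for every integer m ≥ 0. Let (M^{(n)})_{n≥1} be a sequence of 2 × 2 real matrices whose maximum absolute row sums satisfy ‖M^{(n)}‖_∞ = ρ·(1 + a/n + b/n²) + O(1/n³) as n → ∞. Let v_0 ∈ ℝ² and define v_n = v_{n−1} M^{(n)} (row vector–matrix product) for n ≥ 1. Then ‖v_n‖₁ = O(n^{a} ρ^{n}) as n → ∞, i.e., there is a constant C such that |v_n(1)| + |v_n(2)| ≤ C·n^{a} ρ^{n} for all large n. -/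
/-- The maximum absolute row sum of a `2 × 2` real matrix. -/
def rowSupNorm2 (M : Matrix (Fin 2) (Fin 2) ℝ) : ℝ :=
  max (|M 0 0| + |M 0 1|) (|M 1 0| + |M 1 1|)

theorem sum_abs_vecMul_le_rowSupNorm2 (A : Matrix (Fin 2) (Fin 2) ℝ) (x : Fin 2 → ℝ) :
    |∑ i, x i * A i 0| + |∑ i, x i * A i 1| ≤ (|x 0| + |x 1|) * rowSupNorm2 A := by
  simp only [Fin.sum_univ_two]
  have h0 := abs_add_le (x 0 * A 0 0) (x 1 * A 1 0)
  have h1 := abs_add_le (x 0 * A 0 1) (x 1 * A 1 1)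
  simp only [abs_mul] at h0 h1
  have r0 : |A 0 0| + |A 0 1| ≤ rowSupNorm2 A := le_max_left _ _
  have r1 : |A 1 0| + |A 1 1| ≤ rowSupNorm2 A := le_max_right _ _
  have k0 := mul_le_mul_of_nonneg_left r0 (abs_nonneg (x 0))
  have k1 := mul_le_mul_of_nonneg_left r1 (abs_nonneg (x 1))
  linarith

theorem one_add_div_le_exp_sub {a K x : ℝ} (ha : 0 ≤ a) (hK : 0 ≤ K) (hx : 0 < x) :
    1 + a / (x + 1) + K / (x + 1) ^ 2 ≤
      Real.exp ((a * Real.log (x + 1) - K / (x + 1)) - (a * Real.log x - K / x)) := by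
  have hlog : 1 / (x + 1) ≤ Real.log (x + 1) - Real.log x := by
    have h := Real.one_sub_inv_le_log_of_pos (show 0 < (x + 1) / x by positivity)
    rw [Real.log_div (by positivity) hx.ne'] at h
    refine le_trans (le_of_eq ?_) h
    field_simp
    ring
  have hsq : 1 / (x + 1) ^ 2 ≤ 1 / x - 1 / (x + 1) := by
    rw [div_sub_div _ _ (by positivity) (by positivity),
      div_le_div_iff₀ (by positivity) (by positivity)]
    nlinarith
  have h1 := mul_le_mul_of_nonneg_left hlog ha
  have h2 := mul_le_mul_of_nonneg_left hsq hK
  have h3 := Real.add_one_le_exp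
    ((a * Real.log (x + 1) - K / (x + 1)) - (a * Real.log x - K / x))
  simp only [div_eq_mul_inv, one_mul] at *
  linarith

theorem le_const_mul_rpow_mul_pow_of_ratio_le {ρ a K : ℝ} (hρ : 0 < ρ) (ha : 0 ≤ a)
    (hK : 0 ≤ K) {s : ℕ → ℝ} (hs : ∀ n, 0 ≤ s n)
    (h : ∀ n : ℕ, 1 ≤ n →
      s (n + 1) ≤ s n * (ρ * (1 + a / ((n : ℝ) + 1) + K / ((n : ℝ) + 1) ^ 2))) :
    ∃ C : ℝ, ∀ n : ℕ, 1 ≤ n → s n ≤ C * (n : ℝ) ^ a * ρ ^ n := by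
  set E : ℝ → ℝ := fun x => a * Real.log x - K / x with hE
  set D : ℝ := s 1 / (ρ * Real.exp (E 1)) with hD
  have hD0 : 0 ≤ D := div_nonneg (hs 1) (by positivity)
  have key : ∀ n : ℕ, 1 ≤ n → s n ≤ D * ρ ^ n * Real.exp (E n) := by
    intro n hn
    induction n, hn using Nat.le_induction with
    | base =>
      rw [hD]
      apply le_of_eq
      push_cast
      field_simp
    | succ n hn ih =>
      have hx : (0 : ℝ) < n := by exact_mod_cast hn
      calc s (n + 1)
          ≤ s n * (ρ * (1 + a / ((n : ℝ) + 1) + K / ((n : ℝ) + 1) ^ 2)) := h n hn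
        _ ≤ (D * ρ ^ n * Real.exp (E n)) * (ρ * Real.exp (E (n + 1) - E n)) := by
            gcongr
            exact one_add_div_le_exp_sub ha hK hx
        _ = D * ρ ^ (n + 1) * (Real.exp (E n) * Real.exp (E (n + 1) - E n)) := by ring
        _ = D * ρ ^ (n + 1) * Real.exp (E ((n + 1 : ℕ) : ℝ)) := by
            rw [← Real.exp_add, add_sub_cancel]
            push_cast
            rfl
  refine ⟨D, fun n hn => (key n hn).trans ?_⟩
  have hx : (0 : ℝ) < n := by exact_mod_cast hn
  have hexp : Real.exp (E n) ≤ (n : ℝ) ^ a := by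
    rw [Real.rpow_def_of_pos hx]
    apply Real.exp_le_exp.2
    have : 0 ≤ K / (n : ℝ) := by positivity
    simp only [hE]
    linarith
  calc D * ρ ^ n * Real.exp (E n) ≤ D * ρ ^ n * (n : ℝ) ^ a := by gcongr
    _ = D * (n : ℝ) ^ a * ρ ^ n := by ring

/-- Theorem 4.1 (abstract form): if `‖M^{(n)}‖_∞ = ρ(1 + a/n + b/n²) + O(1/n³)`
with `0 < ρ < 1`, `a > 0` and `b ≠ am − m²` for all integers `m ≥ 0`, and
`v_n = v_{n−1} M^{(n)}`, then `‖v_n‖₁ = O(n^a ρ^n)` as `n → ∞`. -/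
theorem iterated_row_vector_asymptotic_bound
    (ρ a b : ℝ) (hρ0 : 0 < ρ) (hρ1 : ρ < 1) (ha : 0 < a)
    (hb : ∀ m : ℕ, b ≠ a * (m : ℝ) - (m : ℝ) ^ 2)
    (M : ℕ → Matrix (Fin 2) (Fin 2) ℝ)
    (hM : ∃ C3 : ℝ, ∀ n : ℕ, 1 ≤ n →
      |rowSupNorm2 (M n) - ρ * (1 + a / (n : ℝ) + b / (n : ℝ) ^ 2)| ≤
        C3 / (n : ℝ) ^ 3)
    (v : ℕ → Fin 2 → ℝ)
    (hv : ∀ n : ℕ, 1 ≤ n → ∀ j : Fin 2, v n j = ∑ i, v (n - 1) i * M n i j) :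
    ∃ C : ℝ, ∃ N0 : ℕ, ∀ n : ℕ, N0 ≤ n →
      |v n 0| + |v n 1| ≤ C * (n : ℝ) ^ a * ρ ^ n := by
  obtain ⟨C3, hC3⟩ := hM
  obtain ⟨C, hC⟩ := le_const_mul_rpow_mul_pow_of_ratio_le (s := fun n => |v n 0| + |v n 1|)
    hρ0 ha.le (show 0 ≤ |b| + |C3| / ρ by positivity) (fun n => by positivity) (fun n _ => by
      have hbound : rowSupNorm2 (M (n + 1)) ≤
          ρ * (1 + a / ((n : ℝ) + 1) + (|b| + |C3| / ρ) / ((n : ℝ) + 1) ^ 2) := by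
        have h := (abs_le.1 (hC3 (n + 1) (by omega))).2
        push_cast at h
        have hcube : C3 / ((n : ℝ) + 1) ^ 3 ≤ |C3| / ((n : ℝ) + 1) ^ 2 := by
          gcongr
          · exact le_abs_self C3
          · linarith [n.cast_nonneg (α := ℝ)]
          · norm_num
        have hquad : ρ * (b / ((n : ℝ) + 1) ^ 2) ≤ ρ * (|b| / ((n : ℝ) + 1) ^ 2) := by
          gcongr
          exact le_abs_self b
        have hsplit : ρ * ((|b| + |C3| / ρ) / ((n : ℝ) + 1) ^ 2) =
            ρ * (|b| / ((n : ℝ) + 1) ^ 2) + |C3| / ((n : ℝ) + 1) ^ 2 := by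
          field_simp
        linarith
      have hstep := sum_abs_vecMul_le_rowSupNorm2 (M (n + 1)) (v n)
      have hrec := hv (n + 1) (by omega)
      simp only [Nat.add_sub_cancel] at hrec
      simp only [hrec]
      exact hstep.trans (mul_le_mul_of_nonneg_left hbound (by positivity)))
  exact ⟨C, 1, hC⟩
end

section
/- Let (r_i^{(0,n)}, r_i^{(1,n)}) be a rate-matrix system with parameters c, λ₁, λ₂, μ, ν and λ = λ₁ + λ₂, and assume λ < cν; set ρ = λ/(cν) and a = (c²ν + λ)/(cμ). Suppose real numbers π_{i,n} (0 ≤ i ≤ c, n ≥ 0) satisfy π_{i,n} = π_{c−1,n−1}·r_i^{(0,n)} + π_{c,n−1}·r_i^{(1,n)} for all n ≥ 1 and 0 ≤ i ≤ c, and that |π_{c−1,n}| + |π_{c,n}| = O(n^{a} ρ^{n}) as n → ∞. Then for each i = 0, 1, …, c, π_{i,n} = O(n^{a−c+i} ρ^{n}) as n → ∞. -/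
/-- One step of the order-raising argument: `y` solves a balance equation whose remaining terms
have known polynomial decay. -/
theorem mul_pow_le_of_balance {n lam mu j b x y z A D p q M K1 K2 : ℝ} (k : ℕ)
    (hn : 1 ≤ n) (hlam : 0 ≤ lam) (hmu : 0 < mu) (hj : 0 ≤ j) (hb : 0 ≤ b)
    (hx : 0 ≤ x) (hy : 0 ≤ y) (hp : 0 ≤ p) (hq : 0 ≤ q)
    (hA : A ≤ M) (hD : D ≤ M) (hM : 0 ≤ M)
    (hbal : (b + n * mu) * y = lam * x + j * z + (n + 1) * mu * (A * p + D * q))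
    (hxK : x * n ^ (k + 2) ≤ K1) (hzK : z * n ^ (k + 1) ≤ K2)
    (hpK : p * (n + 1) ^ (k + 2) ≤ K1) (hqK : q * (n + 1) ^ (k + 2) ≤ K1) :
    y * n ^ (k + 2) ≤ (lam * K1 + j * K2 + mu * (M * (K1 + K1))) / mu := by
  rw [le_div_iff₀ hmu]
  have hn0 : 0 ≤ n := by linarith
  have hpow : n ^ (k + 1) ≤ n ^ (k + 2) := pow_le_pow_right₀ hn (by omega)
  have hshift : (n + 1) * n ^ (k + 1) ≤ (n + 1) ^ (k + 2) := by
    rw [pow_succ' (n + 1) (k + 1)]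
    gcongr
    linarith
  have hx1 : lam * (x * n ^ (k + 1)) ≤ lam * K1 := by
    refine mul_le_mul_of_nonneg_left (le_trans ?_ hxK) hlam
    gcongr
  have hz1 : j * (z * n ^ (k + 1)) ≤ j * K2 := mul_le_mul_of_nonneg_left hzK hj
  have hApDq : A * p + D * q ≤ M * (p + q) := by
    nlinarith [mul_le_mul_of_nonneg_right hA hp, mul_le_mul_of_nonneg_right hD hq]
  have htail : mu * ((A * p + D * q) * ((n + 1) * n ^ (k + 1))) ≤ mu * (M * (K1 + K1)) := by
    refine mul_le_mul_of_nonneg_left ?_ hmu.le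
    calc (A * p + D * q) * ((n + 1) * n ^ (k + 1))
        ≤ M * (p + q) * ((n + 1) * n ^ (k + 1)) := by gcongr
      _ ≤ M * (p + q) * (n + 1) ^ (k + 2) := by gcongr
      _ = M * (p * (n + 1) ^ (k + 2) + q * (n + 1) ^ (k + 2)) := by ring
      _ ≤ M * (K1 + K1) := by gcongr
  have hby : 0 ≤ b * y * n ^ (k + 1) := by positivity
  have hkey : (b + n * mu) * y * n ^ (k + 1) = lam * (x * n ^ (k + 1)) + j * (z * n ^ (k + 1))
      + mu * ((A * p + D * q) * ((n + 1) * n ^ (k + 1))) := by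
    rw [hbal]; ring
  have hexp : y * n ^ (k + 2) * mu + b * y * n ^ (k + 1) = (b + n * mu) * y * n ^ (k + 1) := by
    ring
  linarith

namespace IsRMS

variable {c : ℕ} {l1 l2 mu nu : ℝ} {r0 r1 : ℕ → ℕ → ℝ}

theorem r0_mul_le (hr : IsRMS c l1 l2 mu nu r0 r1) (hmu : 0 < mu) {n i : ℕ} (hn : 1 ≤ n)
    (hi : i < c) : r0 n i * n ≤ l2 / mu := by
  obtain ⟨h0, -, hsys⟩ := hr
  obtain ⟨-, -, -, -, -, -, -, hsum, -⟩ := hsys n hn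
  have hn' : (0 : ℝ) < n := by exact_mod_cast hn
  have := Finset.single_le_sum (fun j _ => h0 n j) (Finset.mem_range.2 hi)
  rw [hsum, le_div_iff₀ (by positivity)] at this
  rw [le_div_iff₀ hmu]
  linarith

theorem r1_mul_le (hr : IsRMS c l1 l2 mu nu r0 r1) (hmu : 0 < mu) {n i : ℕ} (hn : 1 ≤ n)
    (hi : i < c) : r1 n i * n ≤ (l1 + l2) / mu := by
  obtain ⟨-, h1, hsys⟩ := hr
  obtain ⟨-, -, -, -, -, -, -, -, hsum⟩ := hsys n hn
  have hn' : (0 : ℝ) < n := by exact_mod_cast hn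
  have := Finset.single_le_sum (fun j _ => h1 n j) (Finset.mem_range.2 hi)
  rw [hsum, le_div_iff₀ (by positivity)] at this
  rw [le_div_iff₀ hmu]
  linarith

/-- The last two columns of the rate matrices are bounded. -/
theorem exists_last_le (hr : IsRMS c l1 l2 mu nu r0 r1) (hc : 2 ≤ c) (hl1 : 0 < l1)
    (hl2 : 0 < l2) (hmu : 0 < mu) (hnu : 0 < nu) :
    ∃ M : ℝ, 0 ≤ M ∧ ∀ n : ℕ, 1 ≤ n →
      r0 n (c - 1) ≤ M ∧ r0 n c ≤ M ∧ r1 n (c - 1) ≤ M ∧ r1 n c ≤ M := by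
  have hc0 : (0 : ℝ) < c := by exact_mod_cast (by omega : 0 < c)
  set B := (l1 + l2) / mu with hB
  have hB0 : 0 < B := by positivity
  set E := ((l1 + l2) * B + (l1 + l2)) / (c * nu) with hE
  have hE0 : 0 < E := by positivity
  have hlast {u w s t : ℝ} (hu : 0 ≤ u) (huB : u ≤ B) (hw : 0 ≤ w) {e : ℝ} (he : e ≤ l1 + l2)
      (hs : s ≤ l2) (ht : t ≤ l1 + l2)
      (heq : l1 * u - ((l1 + l2) + c * nu) * w + (u * s + w * t) = -e) : w ≤ E := by
    rw [hE, le_div_iff₀ (by positivity)]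
    nlinarith [mul_le_mul_of_nonneg_left hs hu, mul_le_mul_of_nonneg_left ht hw,
      mul_le_mul_of_nonneg_left huB (by positivity : 0 ≤ l1 + l2)]
  refine ⟨B + E, by positivity, fun n hn => ?_⟩
  have hn1 : (1 : ℝ) ≤ n := by exact_mod_cast hn
  have a0 := hr.1 n (c - 1)
  have a1 := hr.2.1 n (c - 1)
  have b0 : r0 n (c - 1) ≤ B := by
    have h := hr.r0_mul_le hmu hn (by omega : c - 1 < c)
    have h' : l2 / mu ≤ B := by rw [hB]; gcongr; linarith
    nlinarith
  have b1 : r1 n (c - 1) ≤ B := by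
    have h := hr.r1_mul_le hmu hn (by omega : c - 1 < c)
    nlinarith
  have hs := hr.r0_mul_le hmu (by omega : 1 ≤ n + 1) (by omega : c - 1 < c)
  have ht := hr.r1_mul_le hmu (by omega : 1 ≤ n + 1) (by omega : c - 1 < c)
  rw [le_div_iff₀ hmu] at hs ht
  push_cast at hs ht
  obtain ⟨-, -, -, e0, -, -, e1, -, -⟩ := hr.2.2 n hn
  have d0 := hlast a0 b0 (hr.1 n c) (e := 0) (by positivity) hs ht (by linear_combination e0)
  have d1 := hlast a1 b1 (hr.2.1 n c) le_rfl hs ht (by linear_combination e1)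
  exact ⟨by linarith, by linarith, by linarith, by linarith⟩

/-- The `i`-th column of the rate matrices is `O(n⁻ᵏ)` for every `1 ≤ k ≤ c - i`. -/
theorem exists_mul_pow_le (hr : IsRMS c l1 l2 mu nu r0 r1) (hc : 2 ≤ c) (hl1 : 0 < l1)
    (hl2 : 0 < l2) (hmu : 0 < mu) (hnu : 0 < nu) (k i : ℕ) (hik : i + k + 1 ≤ c) :
    ∃ K : ℝ, ∀ n : ℕ, 1 ≤ n →
      r0 n i * (n : ℝ) ^ (k + 1) ≤ K ∧ r1 n i * (n : ℝ) ^ (k + 1) ≤ K := by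
  obtain ⟨M, hM, hlast⟩ := hr.exists_last_le hc hl1 hl2 hmu hnu
  induction k generalizing i with
  | zero =>
    refine ⟨(l1 + l2) / mu, fun n hn => ?_⟩
    have h' : l2 / mu ≤ (l1 + l2) / mu := by gcongr; linarith
    simp only [zero_add, pow_one]
    exact ⟨(hr.r0_mul_le hmu hn (by omega)).trans h', hr.r1_mul_le hmu hn (by omega)⟩
  | succ k ihk =>
    induction i with
    | zero =>
      obtain ⟨K, hK⟩ := ihk 1 (by omega)
      refine ⟨((l1 + l2) * 0 + nu * K + mu * (M * (0 + 0))) / mu,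
        fun n hn => ?_⟩
      have hn1 : (1 : ℝ) ≤ n := by exact_mod_cast hn
      obtain ⟨e0, -, -, -, e1, -⟩ := hr.2.2 n hn
      constructor
      · exact mul_pow_le_of_balance (b := l1 + l2) (x := 0) (A := 0) (D := 0) (p := 0) (q := 0) k
          hn1 (by positivity) hmu hnu.le (by positivity) le_rfl (hr.1 n 0) le_rfl le_rfl hM hM hM
          (by linear_combination -e0) (by simp) (hK n hn).1 (by simp) (by simp)
      · exact mul_pow_le_of_balance (b := l1 + l2) (x := 0) (A := 0) (D := 0) (p := 0) (q := 0) k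
          hn1 (by positivity) hmu hnu.le (by positivity) le_rfl (hr.2.1 n 0) le_rfl le_rfl hM hM hM
          (by linear_combination -e1) (by simp) (hK n hn).2 (by simp) (by simp)
    | succ i ihi =>
      obtain ⟨K1, hK1⟩ := ihi (by omega)
      obtain ⟨K2, hK2⟩ := ihk (i + 2) (by omega)
      refine ⟨((l1 + l2) * K1 + (((i : ℝ) + 2) * nu) * K2 + mu * (M * (K1 + K1))) / mu,
        fun n hn => ?_⟩
      have hn1 : (1 : ℝ) ≤ n := by exact_mod_cast hn
      obtain ⟨-, e0, -, -, -, e1, -⟩ := hr.2.2 n hn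
      have e0 := e0 (i + 1) (by omega) (by omega)
      have e1 := e1 (i + 1) (by omega) (by omega)
      obtain ⟨m1, m2, m3, m4⟩ := hlast n hn
      obtain ⟨p0, p1⟩ := hK1 (n + 1) (by omega)
      push_cast at e0 e1 p0 p1
      constructor
      · exact mul_pow_le_of_balance (b := l1 + l2 + (i + 1) * nu) k hn1 (by positivity) hmu
          (by positivity) (by positivity) (hr.1 n i) (hr.1 n (i + 1)) (hr.1 (n + 1) i)
          (hr.2.1 (n + 1) i) m1 m2 hM (by linear_combination -e0)
          (hK1 n hn).1 (hK2 n hn).1 p0 p1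
      · exact mul_pow_le_of_balance (b := l1 + l2 + (i + 1) * nu) k hn1 (by positivity) hmu
          (by positivity) (by positivity) (hr.2.1 n i) (hr.2.1 n (i + 1)) (hr.1 (n + 1) i)
          (hr.2.1 (n + 1) i) m3 m4 hM (by linear_combination -e1)
          (hK1 n hn).2 (hK2 n hn).2 p0 p1

end IsRMS

/-- Corollary 4.1: if `π_{i,n} = π_{c−1,n−1} r_i^{(0,n)} + π_{c,n−1} r_i^{(1,n)}`
and `|π_{c−1,n}| + |π_{c,n}| = O(n^a ρ^n)` with `ρ = λ/(cν)` and
`a = (c²ν + λ)/(cμ)`, then `π_{i,n} = O(n^{a−c+i} ρ^n)` for each `0 ≤ i ≤ c`. -/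
theorem stationary_distribution_asymptotic_bound
    (c : ℕ) (hc : 2 ≤ c)
    (l1 l2 mu nu : ℝ) (hl1 : 0 < l1) (hl2 : 0 < l2) (hmu : 0 < mu) (hnu : 0 < nu)
    (hstab : l1 + l2 < (c : ℝ) * nu)
    (ρ a : ℝ)
    (hρ : ρ = (l1 + l2) / ((c : ℝ) * nu))
    (ha : a = ((c : ℝ) ^ 2 * nu + (l1 + l2)) / ((c : ℝ) * mu))
    (r0 r1 : ℕ → ℕ → ℝ) (hr : IsRMS c l1 l2 mu nu r0 r1)
    (pi : ℕ → ℕ → ℝ)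
    (hrec : ∀ n : ℕ, 1 ≤ n → ∀ i : ℕ, i ≤ c →
      pi n i = pi (n - 1) (c - 1) * r0 n i + pi (n - 1) c * r1 n i)
    (hlast : ∃ C : ℝ, ∃ N0 : ℕ, ∀ n : ℕ, N0 ≤ n →
      |pi n (c - 1)| + |pi n c| ≤ C * (n : ℝ) ^ a * ρ ^ n) :
    ∀ i : ℕ, i ≤ c →
      ∃ C : ℝ, ∃ N0 : ℕ, ∀ n : ℕ, N0 ≤ n →
        |pi n i| ≤ C * (n : ℝ) ^ (a - (c : ℝ) + (i : ℝ)) * ρ ^ n := by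
  intro i hi
  obtain ⟨C, N0, hC⟩ := hlast
  obtain rfl | hic := hi.eq_or_lt
  · refine ⟨C, N0, fun n hn => ?_⟩
    rw [sub_add_cancel]
    exact (le_add_of_nonneg_left (abs_nonneg _)).trans (hC n hn)
  obtain ⟨k, rfl⟩ : ∃ k, c = i + k + 1 := ⟨c - i - 1, by omega⟩
  obtain ⟨K, hK⟩ := hr.exists_mul_pow_le hc hl1 hl2 hmu hnu k i le_rfl
  have hρ0 : 0 < ρ := by rw [hρ]; positivity
  have ha0 : 0 ≤ a := by rw [ha]; positivity
  refine ⟨|C| * K / ρ, N0 + 1, fun n hn => ?_⟩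
  obtain ⟨m, rfl⟩ : ∃ m, n = m + 1 := ⟨n - 1, by omega⟩
  obtain ⟨k0, k1⟩ := hK (m + 1) (by omega)
  have hm := hC m (by omega)
  have hrm := hrec (m + 1) (by omega) i (by omega)
  simp only [Nat.add_sub_cancel] at hm hrm
  set N : ℝ := ((m + 1 : ℕ) : ℝ) with hN
  have hN0 : 0 < N := by rw [hN]; positivity
  have hmN : (m : ℝ) ≤ N := by rw [hN]; push_cast; linarith
  have hP : 0 < N ^ (k + 1) := by positivity
  have hK0 : 0 ≤ K := (mul_nonneg (hr.1 (m + 1) i) hP.le).trans k0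
  have hexp : N ^ (a - ((i + k + 1 : ℕ) : ℝ) + (i : ℝ)) = N ^ a / N ^ (k + 1) := by
    rw [← Real.rpow_natCast N (k + 1), ← Real.rpow_sub hN0]
    congr 1
    push_cast
    ring
  have hm' : |pi m (i + k)| + |pi m (i + k + 1)| ≤ |C| * N ^ a * ρ ^ m := by
    refine hm.trans ?_
    gcongr
    exact le_abs_self C
  rw [← le_div_iff₀ hP] at k0 k1
  calc |pi (m + 1) i|
      ≤ |pi m (i + k)| * r0 (m + 1) i + |pi m (i + k + 1)| * r1 (m + 1) i := by
        rw [hrm]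
        refine (abs_add_le _ _).trans_eq ?_
        rw [abs_mul, abs_mul, abs_of_nonneg (hr.1 (m + 1) i), abs_of_nonneg (hr.2.1 (m + 1) i)]
    _ ≤ |pi m (i + k)| * (K / N ^ (k + 1)) + |pi m (i + k + 1)| * (K / N ^ (k + 1)) := by gcongr
    _ = (|pi m (i + k)| + |pi m (i + k + 1)|) * (K / N ^ (k + 1)) := by ring
    _ ≤ |C| * N ^ a * ρ ^ m * (K / N ^ (k + 1)) := by gcongr
    _ = |C| * K / ρ * N ^ (a - ((i + k + 1 : ℕ) : ℝ) + (i : ℝ)) * ρ ^ (m + 1) := by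
        rw [hexp, pow_succ ρ]
        field_simp
end

section
/- Fix an integer c ≥ 2 and positive reals λ₁, λ₂, μ, ν with λ = λ₁ + λ₂, and let r_j^{(0)}, r_j^{(1)} (0 ≤ j ≤ c−1) be nonnegative reals. Suppose x = (x_0, …, x_c) ∈ ℝ^{c+1} satisfies: −λ x_0 + ν x_1 = 0; λ x_{j−1} − (λ + jν) x_j + (j+1)ν x_{j+1} + μ(x_{c−1} r_{j−1}^{(0)} + x_c r_{j−1}^{(1)}) = 0 for 1 ≤ j ≤ c−2; λ x_{c−2} − (λ + (c−1)ν) x_{c−1} + cν x_c + μ(x_{c−1} r_{c−2}^{(0)} + x_c r_{c−2}^{(1)}) = 0; λ₁ x_{c−1} − (λ + cν) x_c + μ(x_{c−1} r_{c−1}^{(0)} + x_c r_{c−1}^{(1)}) = 0; and x_0 + x_1 + ⋯ + x_c = 1. Define β_c = 1, β_{c−1} = (λ + cν − μ r_{c−1}^{(1)}) / (λ₁ + μ r_{c−1}^{(0)}), and for i = c−1, c−2, …, 1: β_{i−1} = ((λ + iν) β_i − (i+1)ν β_{i+1} − μ(r_{i−1}^{(0)} β_{c−1} + r_{i−1}^{(1)}))/λ.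 Then x_i = β_i x_c for every i = 0, 1, …, c; in particular β_0 + β_1 + ⋯ + β_c ≠ 0 and x_c = 1/(β_0 + β_1 + ⋯ + β_c). -/
/-- Lemma 5.3: the normalized solution of `x(Q₁^{(0)} + R^{(1)} Q₂^{(1)}) = 0`,
`x·e = 1`, is given by `x_i = β_i x_c` with the stated recursion, and
`x_c = 1/(β_0 + ⋯ + β_c)`.  Here `λ = l1 + l2` and `r0 j = r_j^{(0,1)}`,
`r1 j = r_j^{(1,1)}` are the two nonzero rows of the rate matrix `R^{(1)}`. -/
theorem level_zero_stationary_vector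
    (c : ℕ) (hc : 2 ≤ c)
    (l1 l2 mu nu : ℝ) (hl1 : 0 < l1) (hl2 : 0 < l2) (hmu : 0 < mu) (hnu : 0 < nu)
    (r0 r1 : ℕ → ℝ)
    (hr0 : ∀ j : ℕ, j + 1 ≤ c → 0 ≤ r0 j) (hr1 : ∀ j : ℕ, j + 1 ≤ c → 0 ≤ r1 j)
    (x : ℕ → ℝ)
    (hx0 : -(l1 + l2) * x 0 + nu * x 1 = 0)
    (hxmid : ∀ j : ℕ, 1 ≤ j → j + 2 ≤ c →
      (l1 + l2) * x (j - 1) - ((l1 + l2) + (j : ℝ) * nu) * x j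
        + ((j : ℝ) + 1) * nu * x (j + 1)
        + mu * (x (c - 1) * r0 (j - 1) + x c * r1 (j - 1)) = 0)
    (hxcm1 : (l1 + l2) * x (c - 2) - ((l1 + l2) + ((c : ℝ) - 1) * nu) * x (c - 1)
        + (c : ℝ) * nu * x c
        + mu * (x (c - 1) * r0 (c - 2) + x c * r1 (c - 2)) = 0)
    (hxc : l1 * x (c - 1) - ((l1 + l2) + (c : ℝ) * nu) * x c
        + mu * (x (c - 1) * r0 (c - 1) + x c * r1 (c - 1)) = 0)
    (hsum : ∑ i ∈ Finset.range (c + 1), x i = 1)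
    (β : ℕ → ℝ)
    (hβc : β c = 1)
    (hβcm1 : β (c - 1) =
      ((l1 + l2) + (c : ℝ) * nu - mu * r1 (c - 1)) / (l1 + mu * r0 (c - 1)))
    (hβrec : ∀ i : ℕ, 1 ≤ i → i + 1 ≤ c →
      β (i - 1) =
        (((l1 + l2) + (i : ℝ) * nu) * β i - ((i : ℝ) + 1) * nu * β (i + 1)
          - mu * (r0 (i - 1) * β (c - 1) + r1 (i - 1))) / (l1 + l2)) :
    (∀ i : ℕ, i ≤ c → x i = β i * x c) ∧
    (∑ i ∈ Finset.range (c + 1), β i) ≠ 0 ∧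
    x c = 1 / (∑ i ∈ Finset.range (c + 1), β i) := by
  have hl : l1 + l2 ≠ 0 := by positivity
  have hden : l1 + mu * r0 (c - 1) ≠ 0 := by
    have := mul_nonneg hmu.le (hr0 (c - 1) (by omega))
    positivity
  have hlast : x (c - 1) = β (c - 1) * x c := by
    rw [hβcm1, div_mul_eq_mul_div, eq_div_iff hden]
    linear_combination hxc
  have hbal : ∀ j : ℕ, j + 2 ≤ c →
      (l1 + l2) * x j - ((l1 + l2) + ((j : ℝ) + 1) * nu) * x (j + 1)
        + ((j : ℝ) + 2) * nu * x (j + 2)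
        + mu * (x (c - 1) * r0 j + x c * r1 j) = 0 := by
    intro j hj
    rcases hj.eq_or_lt with rfl | hlt
    · have h := hxcm1
      simp only [Nat.add_sub_cancel, show j + 2 - 1 = j + 1 by omega] at h ⊢
      push_cast at h
      linear_combination h
    · have h := hxmid (j + 1) (by omega) (by omega)
      simp only [Nat.add_sub_cancel] at h
      push_cast at h
      linear_combination h
  have hpair : ∀ k i : ℕ, i + k + 1 = c →
      x i = β i * x c ∧ x (i + 1) = β (i + 1) * x c := by
    intro k
    induction k with
    | zero =>
      rintro i rfl
      exact ⟨hlast, by simp [hβc]⟩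
    | succ k ih =>
      intro i hi
      obtain ⟨h1, h2⟩ := ih (i + 1) (by omega)
      refine ⟨?_, h1⟩
      have hβ := hβrec (i + 1) (by omega) (by omega)
      simp only [Nat.add_sub_cancel] at hβ
      push_cast at hβ
      rw [hβ, div_mul_eq_mul_div, eq_div_iff hl]
      linear_combination hbal i (by omega) + ((l1 + l2) + ((i : ℝ) + 1) * nu) * h1
        - ((i : ℝ) + 2) * nu * h2 - mu * r0 i * hlast
  have hmul : ∀ i : ℕ, i ≤ c → x i = β i * x c := by
    intro i hi
    rcases hi.eq_or_lt with rfl | hlt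
    · simp [hβc]
    · exact (hpair (c - 1 - i) i (by omega)).1
  have hprod : (∑ i ∈ Finset.range (c + 1), β i) * x c = 1 := by
    rw [Finset.sum_mul, ← hsum]
    exact Finset.sum_congr rfl fun i hi =>
      (hmul i (Nat.lt_succ_iff.mp (Finset.mem_range.mp hi))).symm
  have hne : (∑ i ∈ Finset.range (c + 1), β i) ≠ 0 := left_ne_zero_of_mul_eq_one hprod
  exact ⟨hmul, hne, by rw [eq_div_iff hne, mul_comm, hprod]⟩
end

section
/- Fix an integer c ≥ 3, positive reals λ, μ, ν, an integer n ≥ 1, and nonnegative reals s_j^{(0)}, s_j^{(1)} (0 ≤ j ≤ c−3) and x_{c−1}, x_c ≥ 0. Suppose (x_0, …, x_c) ∈ ℝ^{c+1} satisfies −(λ + nμ) x_0 + ν x_1 = 0 and, for 1 ≤ i ≤ c−2, λ x_{i−1} − (λ + iν + nμ) x_i + (i+1)ν x_{i+1} + x̃_i = 0, where x̃_i = (n+1)μ (s_{i−1}^{(0)} x_{c−1} + s_{i−1}^{(1)} x_c). Define B_0 = λ + nμ, D_0 = 0, and for i = 1, …, c−2: B_i = (λ + iν + nμ) − λiν/B_{i−1}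 and D_i = x̃_i + λ D_{i−1}/B_{i−1}. Then for every i = 0, 1, …, c−2: B_i > λ, D_i ≥ 0, and x_i = ((i+1)ν x_{i+1} + D_i) / B_i. -/
/-- Theorem 5.1: numerically stable forward-elimination scheme for the
tridiagonal system satisfied by the entries `x_i` of the iterates of the rate
matrices: with `B_0 = λ + nμ`, `D_0 = 0`,
`B_i = (λ + iν + nμ) − λiν/B_{i−1}` and `D_i = x̃_i + λD_{i−1}/B_{i−1}`, one has
`B_i > λ`, `D_i ≥ 0` and `x_i = ((i+1)ν x_{i+1} + D_i)/B_i` for `0 ≤ i ≤ c−2`. -/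
theorem forward_elimination_scheme
    (c : ℕ) (hc : 3 ≤ c)
    (lam mu nu : ℝ) (hlam : 0 < lam) (hmu : 0 < mu) (hnu : 0 < nu)
    (n : ℕ) (hn : 1 ≤ n)
    (s0 s1 : ℕ → ℝ)
    (hs0 : ∀ j : ℕ, j + 3 ≤ c → 0 ≤ s0 j) (hs1 : ∀ j : ℕ, j + 3 ≤ c → 0 ≤ s1 j)
    (x : ℕ → ℝ) (hxcm1 : 0 ≤ x (c - 1)) (hxc : 0 ≤ x c)
    (hx0 : -(lam + (n : ℝ) * mu) * x 0 + nu * x 1 = 0)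
    (hxmid : ∀ i : ℕ, 1 ≤ i → i + 2 ≤ c →
      lam * x (i - 1) - (lam + (i : ℝ) * nu + (n : ℝ) * mu) * x i
        + ((i : ℝ) + 1) * nu * x (i + 1)
        + ((n : ℝ) + 1) * mu * (s0 (i - 1) * x (c - 1) + s1 (i - 1) * x c) = 0)
    (B D : ℕ → ℝ)
    (hB0 : B 0 = lam + (n : ℝ) * mu) (hD0 : D 0 = 0)
    (hBrec : ∀ i : ℕ, 1 ≤ i → i + 2 ≤ c →
      B i = (lam + (i : ℝ) * nu + (n : ℝ) * mu) - lam * (i : ℝ) * nu / B (i - 1))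
    (hDrec : ∀ i : ℕ, 1 ≤ i → i + 2 ≤ c →
      D i = ((n : ℝ) + 1) * mu * (s0 (i - 1) * x (c - 1) + s1 (i - 1) * x c)
        + lam * D (i - 1) / B (i - 1)) :
    ∀ i : ℕ, i + 2 ≤ c →
      lam < B i ∧ 0 ≤ D i ∧
      x i = (((i : ℝ) + 1) * nu * x (i + 1) + D i) / B i := by
  have hnmu : 0 < (n : ℝ) * mu := mul_pos (by exact_mod_cast hn) hmu
  intro i
  induction i with
  | zero =>
    intro _
    refine ⟨by linarith, hD0.ge, ?_⟩
    rw [eq_div_iff (by linarith), hB0, hD0]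
    push_cast
    linarith
  | succ i ih =>
    intro hi
    obtain ⟨hB, hD, hx⟩ := ih (by omega)
    have hBpos : 0 < B i := hlam.trans hB
    have hBi := hBrec (i + 1) (by omega) hi
    have hDi := hDrec (i + 1) (by omega) hi
    have hxi := hxmid (i + 1) (by omega) hi
    simp only [Nat.add_sub_cancel] at hBi hDi hxi
    push_cast at hBi hDi hxi ⊢
    have hB' : lam < B (i + 1) := by
      have : lam * ((i : ℝ) + 1) * nu / B i ≤ ((i : ℝ) + 1) * nu := by
        rw [div_le_iff₀ hBpos, mul_assoc, mul_comm]
        gcongr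
      linarith
    refine ⟨hB', ?_, ?_⟩
    · rw [hDi]
      have h0 := hs0 i (by omega)
      have h1 := hs1 i (by omega)
      positivity
    · rw [eq_div_iff (hlam.trans hB').ne', hBi, hDi]
      have hlx : lam * x i
          = lam * ((i : ℝ) + 1) * nu / B i * x (i + 1) + lam * D i / B i := by
        rw [hx]
        ring
      linear_combination hlx - hxi
end
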